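/- Let f_1(z), …, f_n(z) be E-functions such that the column vector Y(z) = (f_1(z), …, f_n(z))^T satisfies Y'(z) = A(z) Y(z) where A(z) is an n×n matrix with entries in ℚ̄(z), and let T(z) ∈ ℚ̄[z] be a nonzero polynomial such that T(z)A(z) has entries in ℚ̄[z]. Then for every algebraic number α with α·T(α) ≠ 0 and every homogeneous polynomial P ∈ ℚ̄[X_1, …, X_n] such that P(f_1(α), …, f_n(α)) = 0, there exists a polynomial Q ∈ ℚ̄[Z, X_1, …, X_n], homogeneous in the variables X_1, …, X_n, such that Q(α, X_1, …, X_n) = P(X_1, …, X_n) as polynomials and Q(z, f_1(z), …, f_n(z)) = 0 identically as a function of z. -/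

import Mathlib

noncomputable section

/-- `ℚ̄`: the field of algebraic numbers, i.e. the algebraic closure of `ℚ` inside `ℂ`. -/
def Qbar : IntermediateField ℚ ℂ := algebraicClosure ℚ ℂ

/-- `f : ℂ → ℂ` is the E-function with Taylor coefficients `aₙ/n!` (the `aₙ` being
algebraic numbers): `f(z) = ∑ aₙ/n! zⁿ`; the conjugates of the `aₙ` grow at most
geometrically; the `aₙ` admit denominators growing at most geometrically; and `f`
satisfies a nonzero linear differential equation with coefficients in `ℚ̄(z)`
(equivalently, after clearing denominators, with polynomial coefficients all of
whose coefficients are algebraic). -/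
def IsEFunctionWith (a : ℕ → Qbar) (f : ℂ → ℂ) : Prop :=
  (∀ z : ℂ, HasSum (fun n : ℕ => (a n : ℂ) / n.factorial * z ^ n) (f z)) ∧
  (∃ C : ℝ, 0 < C ∧ ∀ σ : Qbar →+* ℂ, ∀ n : ℕ, ‖σ (a n)‖ ≤ C ^ (n + 1)) ∧
  (∃ D : ℝ, 0 < D ∧ ∃ d : ℕ → ℕ, (∀ n : ℕ, d n ≠ 0 ∧ (d n : ℝ) ≤ D ^ (n + 1)) ∧
    ∀ n : ℕ, ∀ m ≤ n, IsIntegral ℤ ((d n : ℂ) * (a m : ℂ))) ∧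
  (∃ r : ℕ, ∃ p : Fin (r + 1) → Polynomial ℂ,
    (∀ j, ∀ i, IsAlgebraic ℚ ((p j).coeff i)) ∧ (∃ j, p j ≠ 0) ∧
    ∀ z : ℂ, ∑ j : Fin (r + 1), (p j).eval z * iteratedDeriv (j : ℕ) f z = 0)

/-- `f : ℂ → ℂ` is an E-function. -/
def IsEFunction (f : ℂ → ℂ) : Prop := ∃ a : ℕ → Qbar, IsEFunctionWith a f

open Polynomial

/-- The ring of entire functions of one complex variable. -/
def Entire : Subalgebra ℂ (ℂ → ℂ) where
  carrier := {f | Differentiable ℂ f}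
  mul_mem' hf hg := Differentiable.mul hf hg
  add_mem' hf hg := Differentiable.add hf hg
  algebraMap_mem' c := differentiable_const c

namespace Entire

instance : CoeFun Entire fun _ => ℂ → ℂ := ⟨fun f => f.1⟩

@[ext] theorem ext {f g : Entire} (h : ∀ z, f z = g z) : f = g := Subtype.ext (funext h)

@[simp] theorem mul_apply (f g : Entire) (z : ℂ) : (f * g) z = f z * g z := rfl
@[simp] theorem zero_apply (z : ℂ) : (0 : Entire) z = 0 := rfl

/-- Evaluation of entire functions at a point. -/
def eval (z : ℂ) : Entire →+* ℂ := (Pi.evalRingHom (fun _ : ℂ => ℂ) z).comp Entire.val.toRingHom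

@[simp] theorem eval_apply (z : ℂ) (f : Entire) : eval z f = f z := rfl

instance : IsDomain Entire := by
  have : NoZeroDivisors Entire := by
    refine ⟨fun {f g} h => ?_⟩
    by_contra! hne
    obtain ⟨hf, hg⟩ := hne
    have hfa : AnalyticOnNhd ℂ f Set.univ := fun z _ => f.2.analyticAt z
    have hga : AnalyticOnNhd ℂ g Set.univ := fun z _ => g.2.analyticAt z
    rcases (hfa 0 trivial).eventually_eq_zero_or_eventually_ne_zero with h0 | h0
    · exact hf (ext fun z => hfa.eqOn_zero_of_preconnected_of_eventuallyEq_zero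
        isPreconnected_univ (Set.mem_univ 0) h0 (Set.mem_univ z))
    · refine hg (ext fun z => hga.eqOn_zero_of_preconnected_of_frequently_eq_zero
        isPreconnected_univ (Set.mem_univ 0) (Filter.Eventually.frequently ?_) (Set.mem_univ z))
      filter_upwards [h0] with w hw
      have := congrArg (fun u : Entire => u w) h
      simpa [hw] using this
  exact NoZeroDivisors.to_isDomain _

section poly

variable {K : Type*} [Field K] [Algebra K ℂ]

/-- The identity function as an entire function. -/
def id : Entire := ⟨fun z => z, differentiable_id⟩

instance : Algebra K[X] Entire := (aeval (R := K) id).toAlgebra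

theorem algebraMap_poly_apply (p : K[X]) (z : ℂ) : algebraMap K[X] Entire p z = aeval z p := by
  change (aeval (R := K) id p).1 z = _
  induction p using Polynomial.induction_on' with
  | add p q hp hq => simp [hp, hq]
  | monomial n a => simp [aeval_monomial, id]

@[simp] theorem smul_poly_apply (p : K[X]) (f : Entire) (z : ℂ) : (p • f) z = aeval z p * f z := by
  rw [Algebra.smul_def, mul_apply, algebraMap_poly_apply]

theorem algebraMap_poly_injective : Function.Injective (algebraMap K[X] Entire) := by
  rw [injective_iff_map_eq_zero]
  intro p hp
  have h : p.map (algebraMap K ℂ) = 0 := by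
    refine Polynomial.funext fun z => ?_
    have := congrArg (fun u : Entire => u z) hp
    simpa [algebraMap_poly_apply, eval_map_algebraMap] using this
  exact (Polynomial.map_eq_zero _).1 h

instance : FaithfulSMul K[X] Entire := (faithfulSMul_iff_algebraMap_injective _ _).2 algebraMap_poly_injective

instance : Module.IsTorsionFree K[X] Entire := by infer_instance

end poly

/-- Differentiation of entire functions. -/
def D : Derivation ℂ Entire Entire where
  toFun f := ⟨deriv f, f.2.contDiff.differentiable_deriv_two⟩
  map_add' f g := ext fun z => deriv_add (f.2 z) (g.2 z)
  map_smul' c f := ext fun z => deriv_const_smul c (f.2 z)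
  map_one_eq_zero' := ext fun z => deriv_const z (1 : ℂ)
  leibniz' f g := ext fun z => by
    change deriv (f.1 * g.1) z = f z * deriv g z + g z * deriv f z
    rw [deriv_mul (f.2 z) (g.2 z)]
    ring

@[simp] theorem D_apply (f : Entire) (z : ℂ) : D f z = deriv f z := rfl

theorem D_algebraMap {K : Type*} [Field K] [Algebra K ℂ] (p : K[X]) :
    D (algebraMap K[X] Entire p) = algebraMap K[X] Entire (derivative p) := by
  refine ext fun z => ?_
  have : (algebraMap K[X] Entire p).1 = fun z => (p.map (algebraMap K ℂ)).eval z := by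
    funext w; rw [algebraMap_poly_apply, eval_map_algebraMap]
  rw [D_apply, this, Polynomial.deriv, algebraMap_poly_apply, derivative_map, eval_map_algebraMap]

theorem D_poly_smul {K : Type*} [Field K] [Algebra K ℂ] (p : K[X]) (f : Entire) :
    D (p • f) = derivative p • f + p • D f := by
  rw [Algebra.smul_def, Derivation.leibniz, D_algebraMap, smul_eq_mul, smul_eq_mul,
    Algebra.smul_def, Algebra.smul_def]
  ring

theorem D_iterate_apply (n : ℕ) (f : Entire) (z : ℂ) : (D^[n] f) z = iteratedDeriv n f z := by
  induction n generalizing f with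
  | zero => simp
  | succ n ih => rw [Function.iterate_succ_apply, ih, iteratedDeriv_succ']; rfl

/-- The Taylor series at the origin. -/
def taylor : Entire →+* PowerSeries ℂ where
  toFun f := PowerSeries.mk fun n => iteratedDeriv n f 0 / n.factorial
  map_one' := by
    ext n
    rcases n with _ | n
    · simp [OneMemClass.coe_one]
    · have : ((1 : Entire) : ℂ → ℂ) = fun _ => 1 := rfl
      rw [PowerSeries.coeff_mk, this]
      simp [iteratedDeriv_const, PowerSeries.coeff_one]
  map_mul' f g := by
    ext n
    have hf : ContDiffAt ℂ n f 0 := f.2.contDiff.contDiffAt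
    have hg : ContDiffAt ℂ n g 0 := g.2.contDiff.contDiffAt
    have : ((f * g : Entire) : ℂ → ℂ) = f.1 * g.1 := rfl
    rw [PowerSeries.coeff_mk, this, iteratedDeriv_mul hf hg, PowerSeries.coeff_mul,
      Finset.Nat.sum_antidiagonal_eq_sum_range_succ_mk, Finset.sum_div]
    refine Finset.sum_congr rfl fun i hi => ?_
    have hi : i ≤ n := Nat.lt_succ_iff.1 (Finset.mem_range.1 hi)
    simp only [PowerSeries.coeff_mk]
    rw [Nat.cast_choose ℂ hi]
    have := Nat.factorial_ne_zero n
    field_simp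
  map_zero' := by
    ext n
    have : ((0 : Entire) : ℂ → ℂ) = fun _ => 0 := rfl
    simp
  map_add' f g := by
    ext n
    have hf : ContDiffAt ℂ n f 0 := f.2.contDiff.contDiffAt
    have hg : ContDiffAt ℂ n g 0 := g.2.contDiff.contDiffAt
    have : ((f + g : Entire) : ℂ → ℂ) = f.1 + g.1 := rfl
    rw [PowerSeries.coeff_mk, this, iteratedDeriv_add hf hg]
    simp [add_div]

theorem coeff_taylor (f : Entire) (n : ℕ) :
    (taylor f).coeff n = iteratedDeriv n f 0 / n.factorial :=
  PowerSeries.coeff_mk (R := ℂ) n fun n => iteratedDeriv n f 0 / n.factorial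

theorem hasSum_taylor (f : Entire) (z : ℂ) :
    HasSum (fun n : ℕ => (taylor f).coeff n * z ^ n) (f z) := by
  have h := Complex.hasSum_taylorSeries_of_entire f.2 0 z
  have e : (fun n : ℕ => (taylor f).coeff n * z ^ n) =
      fun n : ℕ => ((n.factorial : ℂ)⁻¹ • (z - 0) ^ n • iteratedDeriv n f.1 0) := by
    funext n
    rw [coeff_taylor, sub_zero, smul_eq_mul, smul_eq_mul]
    ring
  rw [e]
  exact h

theorem taylor_injective : Function.Injective taylor := by
  rw [injective_iff_map_eq_zero]
  intro f hf
  refine ext fun z => ?_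
  have h := hasSum_taylor f z
  simp only [hf, map_zero, zero_mul] at h
  exact h.unique hasSum_zero

theorem taylor_D (f : Entire) : taylor (D f) = PowerSeries.derivative ℂ (taylor f) := by
  ext n
  have h : ((D f : Entire) : ℂ → ℂ) = deriv f := rfl
  rw [PowerSeries.coeff_derivative, coeff_taylor, coeff_taylor, h, ← iteratedDeriv_succ',
    Nat.factorial_succ]
  have := Nat.factorial_ne_zero n
  push_cast
  field_simp

theorem taylor_smul (c : ℂ) (f : Entire) : taylor (c • f) = c • taylor f := by
  ext n
  have : ((c • f : Entire) : ℂ → ℂ) = c • f.1 := rfl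
  rw [coeff_taylor, this, iteratedDeriv_const_smul f.2.contDiff.contDiffAt]
  simp [coeff_taylor, mul_div_assoc]

theorem taylor_algebraMap {K : Type*} [Field K] [Algebra K ℂ] (p : K[X]) :
    taylor (algebraMap K[X] Entire p) = ((p.map (algebraMap K ℂ) : ℂ[X]) : PowerSeries ℂ) := by
  induction p using Polynomial.induction_on' with
  | add p q hp hq => simp [hp, hq]
  | monomial n a =>
    have hX : taylor id = PowerSeries.X := by
      ext n
      have : (id : ℂ → ℂ) = _root_.id := rfl
      rw [coeff_taylor, this, PowerSeries.coeff_X]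
      rcases n with _ | _ | n
      · simp
      · simp
      · simp [iteratedDeriv_succ', iteratedDeriv_const]
    have : algebraMap K[X] Entire (monomial n a) = algebraMap K ℂ a • id ^ n := by
      refine ext fun z => ?_
      rw [algebraMap_poly_apply, aeval_monomial]
      rfl
    have h3 : algebraMap K ℂ a • (id ^ n : Entire) = (algebraMap K ℂ a • (id ^ n : Entire)) := rfl
    rw [this, taylor_smul, map_pow, hX, map_monomial, ← C_mul_X_pow_eq_monomial,
      PowerSeries.smul_eq_C_mul]
    simp

theorem exists_eq_mul_of_apply_eq_zero (f : Entire) (a : ℂ) (h : f a = 0) :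
    ∃ g : Entire, ∀ z, f z = (z - a) * g z := by
  refine ⟨⟨dslope f a, ?_⟩, fun z => ?_⟩
  · have := (Complex.differentiableOn_dslope (f := f) (s := Set.univ) (c := a) Filter.univ_mem).2
      f.2.differentiableOn
    exact differentiableOn_univ.1 this
  · have := sub_smul_dslope f.1 a z
    rw [h, sub_zero] at this
    exact this.symm

end Entire

namespace Entire

theorem norm_root_le {n : ℕ} (c : ℕ → ℂ) (w : ℂ)
    (h : w ^ n + ∑ i ∈ Finset.range n, c i * w ^ i = 0) :
    ‖w‖ ≤ 1 + ∑ i ∈ Finset.range n, ‖c i‖ := by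
  have hS : 0 ≤ ∑ i ∈ Finset.range n, ‖c i‖ := Finset.sum_nonneg fun i _ => norm_nonneg _
  by_cases hw : ‖w‖ ≤ 1
  · linarith
  push Not at hw
  rcases n with _ | n
  · simp at h
  have h1 : ‖w‖ ^ n * ‖w‖ ≤ ‖w‖ ^ n * ∑ i ∈ Finset.range (n + 1), ‖c i‖ := by
    rw [← pow_succ, ← norm_pow, eq_neg_of_add_eq_zero_left h, norm_neg, Finset.mul_sum]
    refine (norm_sum_le _ _).trans (Finset.sum_le_sum fun i hi => ?_)
    rw [norm_mul, norm_pow, mul_comm]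
    gcongr
    · exact hw.le
    · exact Nat.lt_succ_iff.1 (Finset.mem_range.1 hi)
  have := le_of_mul_le_mul_left h1 (by positivity)
  linarith

theorem exists_norm_eval_le (p : ℂ[X]) :
    ∃ C : ℝ, ∃ m : ℕ, 0 ≤ C ∧ ∀ z, ‖p.eval z‖ ≤ C * (1 + ‖z‖) ^ m := by
  refine ⟨∑ i ∈ Finset.range (p.natDegree + 1), ‖p.coeff i‖, p.natDegree,
    Finset.sum_nonneg fun i _ => norm_nonneg _, fun z => ?_⟩
  rw [eval_eq_sum_range, Finset.sum_mul]
  refine (norm_sum_le _ _).trans (Finset.sum_le_sum fun i hi => ?_)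
  rw [norm_mul, norm_pow]
  gcongr ?_ * ?_
  calc ‖z‖ ^ i ≤ (1 + ‖z‖) ^ i := by gcongr; linarith
    _ ≤ _ := pow_le_pow_right₀ (by linarith [norm_nonneg z])
      (Nat.lt_succ_iff.1 (Finset.mem_range.1 hi))

theorem eq_algebraMap_of_norm_le (g : Entire) (C : ℝ) (m : ℕ)
    (h : ∀ z, ‖g z‖ ≤ C * (1 + ‖z‖) ^ m) :
    g ∈ Set.range (algebraMap ℂ[X] Entire) := by
  have hz : ∀ n, m < n → iteratedDeriv n g 0 = 0 := by
    intro n hn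
    have hC : 0 ≤ C := by simpa using (norm_nonneg _).trans (h 0)
    have key : ∀ R : ℝ, 1 ≤ R → ‖iteratedDeriv n g 0‖ ≤ n.factorial * (C * 2 ^ m) / R := by
      intro R hR
      have hR0 : 0 < R := by linarith
      refine (Complex.norm_iteratedDeriv_le_of_forall_mem_sphere_norm_le (C := C * (2 * R) ^ m) n hR0
        g.2.diffContOnCl ?_).trans ?_
      · intro z hz
        refine (h z).trans ?_
        have : ‖z‖ = R := by simpa using hz
        rw [this]
        gcongr
        linarith
      · obtain ⟨k, rfl⟩ := Nat.exists_eq_add_of_lt hn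
        rw [div_le_div_iff₀ (by positivity) hR0, mul_pow, pow_add, pow_add, pow_one]
        have : (1 : ℝ) ≤ R ^ k := one_le_pow₀ hR
        have h2 : 0 ≤ ((m + k + 1).factorial : ℝ) * (C * 2 ^ m) * (R ^ m * R) := by positivity
        nlinarith
    have h0 : ‖iteratedDeriv n g 0‖ ≤ 0 := by
      refine ge_of_tendsto (x := Filter.atTop) (tendsto_const_nhds.div_atTop Filter.tendsto_id)
        (f := fun R : ℝ => (n.factorial : ℝ) * (C * 2 ^ m) / R) ?_
      filter_upwards [Filter.eventually_ge_atTop 1] with R hR using key R hR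
    exact norm_le_zero_iff.1 h0
  refine ⟨∑ i ∈ Finset.range (m + 1), Polynomial.C ((taylor g).coeff i) * X ^ i, ?_⟩
  refine ext fun z => ?_
  rw [algebraMap_poly_apply]
  have h1 := hasSum_taylor g z
  have h2 : HasSum (fun n : ℕ => (taylor g).coeff n * z ^ n)
      (∑ i ∈ Finset.range (m + 1), (taylor g).coeff i * z ^ i) := by
    refine hasSum_sum_of_ne_finset_zero fun i hi => ?_
    rw [coeff_taylor, hz i (by simpa using hi)]
    simp
  rw [h1.unique h2]
  simp

theorem isIntegral_iff_exists (u v : Entire) (hv : v ≠ 0)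
    {n : ℕ} (p : ℕ → ℂ[X])
    (h : u ^ n + ∑ i ∈ Finset.range n, p i • (u ^ i * v ^ (n - i)) = 0) :
    ∃ q : ℂ[X], u = q • v := by
  set B : ℂ → ℝ := fun z => 1 + ∑ i ∈ Finset.range n, ‖(p i).eval z‖ with hB
  have hBc : Continuous B := by
    refine continuous_const.add (continuous_finsetSum _ fun i _ => ?_)
    exact (p i).continuous.norm
  have hbound : ∀ z, v z ≠ 0 → ‖u z / v z‖ ≤ B z := by
    intro z hz
    refine norm_root_le (fun i => (p i).eval z) _ ?_
    have h1 := congrArg (fun w : Entire => w z) h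
    have h2 : u z ^ n + ∑ i ∈ Finset.range n, (p i).eval z * (u z ^ i * v z ^ (n - i)) = 0 := by
      have e : (u ^ n + ∑ i ∈ Finset.range n, p i • (u ^ i * v ^ (n - i)) : Entire) z =
        eval z (u ^ n + ∑ i ∈ Finset.range n, p i • (u ^ i * v ^ (n - i))) := rfl
      simp only [e] at h1
      rw [map_add, map_sum] at h1
      simpa [coe_aeval_eq_eval] using h1
    have h3 : (u z / v z) ^ n + ∑ i ∈ Finset.range n, (p i).eval z * (u z / v z) ^ i =
      (u z ^ n + ∑ i ∈ Finset.range n, (p i).eval z * (u z ^ i * v z ^ (n - i))) / v z ^ n := by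
      rw [add_div, div_pow, Finset.sum_div]
      congr 1
      refine Finset.sum_congr rfl fun i hi => ?_
      have hi : i ≤ n := (Finset.mem_range.1 hi).le
      obtain ⟨k, rfl⟩ := Nat.exists_eq_add_of_le hi
      rw [Nat.add_sub_cancel_left, div_pow, pow_add]
      field_simp
    rw [h3, h2, zero_div]
  -- the quotient extends to an entire function
  have hva : AnalyticOnNhd ℂ v Set.univ := fun z _ => v.2.analyticAt z
  have hiso : ∀ a, ∀ᶠ z in nhdsWithin a {a}ᶜ, v z ≠ 0 := by
    intro a
    rcases (hva a trivial).eventually_eq_zero_or_eventually_ne_zero with h0 | h0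
    · exact absurd (ext fun z => hva.eqOn_zero_of_preconnected_of_eventuallyEq_zero
        isPreconnected_univ (Set.mem_univ a) h0 (Set.mem_univ z)) hv
    · exact h0
  set w : ℂ → ℂ := fun z => u z / v z with hw
  set G : ℂ → ℂ := fun a => Filter.limUnder (nhdsWithin a {a}ᶜ) w with hG
  have hGv : ∀ z, v z ≠ 0 → G z = w z := by
    intro z hz
    refine Filter.Tendsto.limUnder_eq ?_
    have : ContinuousAt w z := (u.2 z).continuousAt.div (v.2 z).continuousAt hz
    exact this.tendsto.mono_left nhdsWithin_le_nhds
  have hGd : Differentiable ℂ G := by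
    intro a
    obtain ⟨r, hr, hrb⟩ := Metric.mem_nhdsWithin_iff.1 (hiso a)
    have hne : ∀ z ∈ Metric.ball a r \ {a}, v z ≠ 0 := fun z hz => hrb ⟨hz.1, hz.2⟩
    have hd := Complex.differentiableOn_update_limUnder_of_bddAbove (f := w)
      (Metric.ball_mem_nhds a hr)
      (fun z hz => ((u.2 z).div (v.2 z) (hne z hz)).differentiableWithinAt) (by
        obtain ⟨M, hM⟩ := (isCompact_closedBall a r).bddAbove_image hBc.continuousOn
        refine ⟨M, ?_⟩
        rintro _ ⟨z, hz, rfl⟩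
        exact (hbound z (hne z hz)).trans
          (hM ⟨z, Metric.ball_subset_closedBall hz.1, rfl⟩))
    have he : Set.EqOn G (Function.update w a (Filter.limUnder (nhdsWithin a {a}ᶜ) w))
        (Metric.ball a r) := by
      intro z hz
      by_cases hza : z = a
      · subst hza; simp [hG]
      · rw [Function.update_of_ne hza, hGv z (hne z ⟨hz, hza⟩)]
    exact ((hd.congr he).differentiableAt (Metric.ball_mem_nhds a hr))
  set g : Entire := ⟨G, hGd⟩ with hg
  have huv : u = g * v := by
    refine ext fun a => ?_
    have h1 : Filter.Tendsto (fun z => u z - (g * v) z) (nhdsWithin a {a}ᶜ)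
        (nhds (u a - (g * v) a)) :=
      ((u - g * v).2.continuous.tendsto a).mono_left nhdsWithin_le_nhds
    have h2 : Filter.Tendsto (fun z => u z - (g * v) z) (nhdsWithin a {a}ᶜ) (nhds 0) := by
      refine tendsto_const_nhds.congr' ?_
      filter_upwards [hiso a] with z hz
      rw [mul_apply]
      change _ = u z - G z * v z
      rw [hGv z hz, hw]
      simp [hz]
    exact sub_eq_zero.1 (tendsto_nhds_unique h1 h2)
  have hgint : g ^ n + ∑ i ∈ Finset.range n, p i • g ^ i = 0 := by
    have : v ^ n * (g ^ n + ∑ i ∈ Finset.range n, p i • g ^ i) = 0 := by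
      rw [← h, huv, mul_add, Finset.mul_sum]
      congr 1
      · ring
      · refine Finset.sum_congr rfl fun i hi => ?_
        have hi : i ≤ n := (Finset.mem_range.1 hi).le
        obtain ⟨k, rfl⟩ := Nat.exists_eq_add_of_le hi
        rw [Nat.add_sub_cancel_left, mul_smul_comm]
        congr 1
        ring
    exact (mul_eq_zero.1 this).resolve_left (pow_ne_zero _ hv)
  have hgB : ∀ z, ‖g z‖ ≤ B z := by
    intro z
    refine norm_root_le (fun i => (p i).eval z) _ ?_
    have h1 := congrArg (eval z) hgint
    rw [map_add, map_sum] at h1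
    simpa [coe_aeval_eq_eval] using h1
  choose C m hC hCm using fun i => exists_norm_eval_le (p i)
  obtain ⟨q, hq⟩ := eq_algebraMap_of_norm_le g (1 + ∑ i ∈ Finset.range n, C i)
    (∑ i ∈ Finset.range n, m i) (by
      intro z
      refine (hgB z).trans ?_
      have h1 : (1 : ℝ) ≤ 1 + ‖z‖ := by linarith [norm_nonneg z]
      rw [add_mul, Finset.sum_mul, one_mul]
      refine add_le_add (one_le_pow₀ h1) (Finset.sum_le_sum fun i hi => ?_)
      · refine (hCm i z).trans ?_
        gcongr
        · exact hC i
        · exact Finset.single_le_sum (f := m) (fun _ _ => Nat.zero_le _) hi)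
  exact ⟨q, by rw [huv, ← hq, Algebra.smul_def]⟩

/-- In the fraction field of `E`, elements algebraic over `R` are fractions of elements of `R`,
as soon as this holds for elements integral over `R`. -/
theorem exists_of_isAlgebraic_fraction {R E F : Type*} [CommRing R] [IsDomain R] [CommRing E]
    [IsDomain E] [Field F] [Algebra R E] [Algebra E F] [Algebra R F] [IsScalarTower R E F]
    [IsFractionRing E F] [FaithfulSMul R E]
    (H : ∀ u v : E, v ≠ 0 → ∀ (n : ℕ) (p : ℕ → R),
      u ^ n + ∑ i ∈ Finset.range n, p i • (u ^ i * v ^ (n - i)) = 0 → ∃ q : R, u = q • v)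
    (x : F) (hx : IsAlgebraic R x) :
    ∃ p q : R, q ≠ 0 ∧ algebraMap R F q * x = algebraMap R F p := by
  obtain ⟨y, hy, P, hPm, hP⟩ := hx.exists_integral_multiple
  obtain ⟨u, v, hv, huv⟩ := IsFractionRing.div_surjective (A := E) (y • x)
  have hv0 : v ≠ 0 := nonZeroDivisors.ne_zero hv
  have hvF : algebraMap E F v ≠ 0 := fun h => hv0 (IsFractionRing.injective E F (by simpa using h))
  obtain ⟨q, hq⟩ := H u v hv0 P.natDegree P.coeff (by
    apply IsFractionRing.injective E F
    rw [← huv, ← aeval_def, aeval_eq_sum_range, Finset.sum_range_succ,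
      hPm.coeff_natDegree, one_smul] at hP
    rw [map_add, map_sum, map_zero, map_pow]
    have := congrArg (fun t => algebraMap E F v ^ P.natDegree * t) hP
    simp only [mul_zero, mul_add, Finset.mul_sum] at this
    rw [← this, add_comm]
    congr 1
    · refine Finset.sum_congr rfl fun i hi => ?_
      have hi : i ≤ P.natDegree := (Finset.mem_range.1 hi).le
      obtain ⟨k, hk⟩ := Nat.exists_eq_add_of_le hi
      rw [hk, Nat.add_sub_cancel_left, Algebra.smul_def, Algebra.smul_def, map_mul,
        ← IsScalarTower.algebraMap_apply, map_mul, map_pow, map_pow, pow_add, div_pow]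
      field_simp
    · rw [div_pow]
      field_simp)
  refine ⟨q, y, hy, ?_⟩
  rw [← Algebra.smul_def, ← huv, hq, Algebra.smul_def, map_mul, ← IsScalarTower.algebraMap_apply]
  exact mul_div_cancel_right₀ _ hvF

end Entire

section LinearDisjoint

variable {k F L : Type*} [Field k] [Field F] [Field L] [Algebra k F] [Algebra F L] [Algebra k L]
  [IsScalarTower k F L]

theorem natDegree_minpoly_le_of_algebraic_mem (hkF : ∀ x : F, IsAlgebraic k x →
      x ∈ Set.range (algebraMap k F)) (t : L) (ht : IsIntegral k t) :
    (minpoly k t).natDegree ≤ (minpoly F t).natDegree := by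
  have htF : IsIntegral F t := ht.tower_top
  have hdvd : minpoly F t ∣ (minpoly k t).map (algebraMap k F) := minpoly.dvd_map_of_isScalarTower k F t
  have h1 := integralClosure.mem_lifts_of_monic_of_dvd_map F (minpoly.monic ht)
    (minpoly.monic htF) hdvd
  have h2 : minpoly F t ∈ lifts (algebraMap k F) := by
    rw [lifts_iff_coeff_lifts] at h1 ⊢
    intro n
    obtain ⟨y, hy⟩ := h1 n
    rw [← hy]
    exact hkF _ y.2.isAlgebraic
  obtain ⟨q, hq⟩ := h2
  have hq0 : q ≠ 0 := by
    rintro rfl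
    exact minpoly.ne_zero htF (by simpa using hq.symm)
  have hq1 : aeval t q = 0 := by
    rw [← aeval_map_algebraMap F t q]
    have : q.map (algebraMap k F) = minpoly F t := hq
    rw [this, minpoly.aeval]
  rw [← hq]
  calc (minpoly k t).natDegree ≤ q.natDegree := natDegree_le_of_dvd (minpoly.dvd k t hq1) hq0
    _ = _ := (natDegree_map _).symm

theorem eq_zero_of_sum_mul_eq_zero [CharZero k] (hkF : ∀ x : F, IsAlgebraic k x →
      x ∈ Set.range (algebraMap k F)) {ι : Type*} [Fintype ι] (u : ι → F)
    (hu : LinearIndependent k u) (ξ : ι → L) (hξ : ∀ i, IsAlgebraic k (ξ i))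
    (h : ∑ i, algebraMap F L (u i) * ξ i = 0) : ξ = 0 := by
  have hintegral : ∀ x ∈ Set.range ξ, IsIntegral k x := by
    rintro _ ⟨i, rfl⟩; exact (hξ i).isIntegral
  have : FiniteDimensional k (IntermediateField.adjoin k (Set.range ξ)) :=
    IntermediateField.finiteDimensional_adjoin hintegral
  obtain ⟨t0, ht0⟩ := Field.exists_primitive_element k (IntermediateField.adjoin k (Set.range ξ))
  set t : L := t0.1 with ht
  have htint : IsIntegral k t := (Algebra.IsIntegral.isIntegral (R := k) t0).map
    (IntermediateField.val _)
  set pb := IntermediateField.adjoin.powerBasis (K := k) (Algebra.IsIntegral.isIntegral (R := k) t0)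
  have hP : ∀ i, ∃ P : k[X], P.natDegree < (minpoly k t).natDegree ∧ ξ i = aeval t P := by
    intro i
    have hmem : (⟨ξ i, IntermediateField.subset_adjoin _ _ ⟨i, rfl⟩⟩ :
        IntermediateField.adjoin k (Set.range ξ)) ∈ IntermediateField.adjoin k {t0} := by
      rw [ht0]; trivial
    rw [← IntermediateField.mem_toSubalgebra,
      IntermediateField.adjoin_simple_toSubalgebra_of_isAlgebraic
        (Algebra.IsAlgebraic.isAlgebraic t0)] at hmem
    rw [Algebra.adjoin_singleton_eq_range_aeval] at hmem
    obtain ⟨P, hP⟩ := hmem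
    refine ⟨P %ₘ minpoly k t, natDegree_modByMonic_lt _ (minpoly.monic htint)
      (minpoly.ne_one k t), ?_⟩
    have h1 := congrArg (IntermediateField.val _) hP
    simp only [AlgHom.toRingHom_eq_coe, RingHom.coe_coe] at h1
    rw [← aeval_algHom_apply] at h1
    have h2 := h1.symm
    rw [aeval_modByMonic_eq_self_of_root (minpoly.aeval k t)]
    exact h2
  choose P hPd hP using hP
  set Q : F[X] := ∑ i, C (u i) * (P i).map (algebraMap k F) with hQ
  have hQ0 : aeval t Q = 0 := by
    rw [hQ, map_sum, ← h]
    refine Finset.sum_congr rfl fun i _ => ?_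
    rw [map_mul, aeval_C, aeval_map_algebraMap, ← hP]
  have hmpos : 0 < (minpoly k t).natDegree := minpoly.natDegree_pos htint
  have hQd : Q.natDegree < (minpoly k t).natDegree := by
    refine lt_of_le_of_lt (natDegree_sum_le_of_forall_le (n := (minpoly k t).natDegree - 1) _ _ ?_)
      (Nat.sub_lt hmpos one_pos)
    intro i _
    refine (natDegree_C_mul_le _ _).trans ?_
    rw [natDegree_map]
    exact Nat.le_pred_of_lt (hPd i)
  have hQz : Q = 0 := by
    by_contra hne
    have := natDegree_le_of_dvd (minpoly.dvd F t hQ0) hne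
    exact absurd (hQd.trans_le (natDegree_minpoly_le_of_algebraic_mem hkF t htint)) this.not_gt
  funext i
  have hPi : P i = 0 := by
    ext n
    have h1 : ∑ i, (P i).coeff n • u i = 0 := by
      have := congrArg (fun q => q.coeff n) hQz
      simp only [hQ, finsetSum_coeff, coeff_C_mul, coeff_map, coeff_zero] at this
      rw [← this]
      refine Finset.sum_congr rfl fun i _ => ?_
      rw [Algebra.smul_def, mul_comm]
    exact Fintype.linearIndependent_iff.1 hu _ h1 i
  rw [hP i, hPi]; simp

end LinearDisjoint

/-- A nontrivial finitely generated algebra over a field `k` has an algebraic point. -/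
theorem exists_algHom_isAlgebraic (k A L : Type*) [Field k] [CommRing A] [Nontrivial A] [Field L]
    [Algebra k A] [Algebra k L] [IsAlgClosed L] [Algebra.FiniteType k A] :
    ∃ φ : A →ₐ[k] L, ∀ x, IsAlgebraic k (φ x) := by
  obtain ⟨m, hm⟩ := Ideal.exists_maximal A
  let _ := Ideal.Quotient.field m
  have : Algebra.FiniteType k (A ⧸ m) :=
    Algebra.FiniteType.of_surjective (Ideal.Quotient.mkₐ k m) (Ideal.Quotient.mkₐ_surjective k m)
  have hfin : Module.Finite k (A ⧸ m) := finite_of_finite_type_of_isJacobsonRing k _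
  have : Algebra.IsAlgebraic k (A ⧸ m) := Algebra.IsAlgebraic.of_finite k (A ⧸ m)
  let ψ : (A ⧸ m) →ₐ[k] L := IsAlgClosed.lift
  refine ⟨ψ.comp (Ideal.Quotient.mkₐ k m), fun x => ?_⟩
  exact (Algebra.IsAlgebraic.isAlgebraic (R := k) (Ideal.Quotient.mkₐ k m x)).algHom ψ

/-- A bilinear family of products that degenerates over a field extension of the base already
degenerates trivially, when the base is algebraically closed in the fraction field. -/
theorem eq_zero_or_eq_zero_of_bilinear {R E F Ω : Type*} [CommRing R] [IsDomain R] [CharZero R]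
    [CommRing E] [IsDomain E] [Field F] [Field Ω] [Algebra R E] [Algebra E F] [Algebra R F]
    [IsScalarTower R E F] [IsFractionRing E F] [FaithfulSMul R E] (ψ : R →+* Ω)
    (hψ : Function.Injective ψ)
    (H : ∀ x : F, IsAlgebraic R x → ∃ p q : R, q ≠ 0 ∧ algebraMap R F q * x = algebraMap R F p)
    {ιa ιb ιc : Type*} [Fintype ιa] [Fintype ιb] [Fintype ιc]
    (u : ιa → E) (hu : LinearIndependent R u) (v : ιb → E) (hv : LinearIndependent R v)
    (w : ιc → E) (γ : ιa → ιb → ιc → R) (hγ : ∀ a b, u a * v b = ∑ c, γ a b c • w c)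
    (ξ : ιa → Ω) (η : ιb → Ω)
    (h : ∀ c, ∑ a, ∑ b, ξ a * η b * ψ (γ a b c) = 0) : ξ = 0 ∨ η = 0 := by
  have : FaithfulSMul R F := FaithfulSMul.trans R E F
  let _ : Algebra R Ω := ψ.toAlgebra
  have : FaithfulSMul R Ω := (faithfulSMul_iff_algebraMap_injective _ _).2 hψ
  let k := FractionRing R
  let _ : Algebra k F := FractionRing.liftAlgebra R F
  let _ : Algebra k Ω := FractionRing.liftAlgebra R Ω
  have : IsScalarTower R k F := FractionRing.isScalarTower_liftAlgebra R F
  have : IsScalarTower R k Ω := FractionRing.isScalarTower_liftAlgebra R Ω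
  have : CharZero k := IsFractionRing.charZero_of_isFractionRing R
  let L := AlgebraicClosure F
  have hkF : ∀ x : F, IsAlgebraic k x → x ∈ Set.range (algebraMap k F) := by
    intro x hx
    obtain ⟨p, q, hq, hpq⟩ := H x ((IsFractionRing.isAlgebraic_iff R k F).2 hx)
    refine ⟨algebraMap R k p / algebraMap R k q, ?_⟩
    rw [map_div₀, ← IsScalarTower.algebraMap_apply, ← IsScalarTower.algebraMap_apply, ← hpq]
    refine mul_div_cancel_left₀ _ fun h0 => hq ?_
    exact FaithfulSMul.algebraMap_injective R F (by rw [h0, map_zero])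
  have hinj := (IsFractionRing.injective E F).injOn (s := Set.univ)
  have hu' : LinearIndependent k (fun i => algebraMap E F (u i)) :=
    (LinearIndependent.iff_fractionRing R k).1
      (hu.map_injOn (Algebra.linearMap E F |>.restrictScalars R) (hinj.mono (Set.subset_univ _)))
  have hv' : LinearIndependent k (fun i => algebraMap E F (v i)) :=
    (LinearIndependent.iff_fractionRing R k).1
      (hv.map_injOn (Algebra.linearMap E F |>.restrictScalars R) (hinj.mono (Set.subset_univ _)))
  by_contra! hne
  obtain ⟨a0, ha0⟩ := Function.ne_iff.1 hne.1
  obtain ⟨b0, hb0⟩ := Function.ne_iff.1 hne.2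
  simp only [Pi.zero_apply] at ha0 hb0
  set s : Set Ω := Set.range ξ ∪ Set.range η ∪ {(ξ a0)⁻¹, (η b0)⁻¹} with hs
  have hsf : s.Finite := by
    refine ((Set.finite_range _).union (Set.finite_range _)).union (Set.toFinite _)
  have : Algebra.FiniteType k (Algebra.adjoin k s) :=
    (Subalgebra.fg_iff_finiteType _).1 ⟨hsf.toFinset, by simp⟩
  obtain ⟨φ, hφ⟩ := exists_algHom_isAlgebraic k (Algebra.adjoin k s) L
  have hsub : ∀ x ∈ s, x ∈ Algebra.adjoin k s := fun x hx => Algebra.subset_adjoin hx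
  let ξ' : ιa → Algebra.adjoin k s := fun a => ⟨ξ a, hsub _ (Or.inl (Or.inl ⟨a, rfl⟩))⟩
  let η' : ιb → Algebra.adjoin k s := fun b => ⟨η b, hsub _ (Or.inl (Or.inr ⟨b, rfl⟩))⟩
  have hξ0 : φ (ξ' a0) ≠ 0 := by
    have h1 : ξ' a0 * ⟨(ξ a0)⁻¹, hsub _ (Or.inr (Or.inl rfl))⟩ = 1 :=
      Subtype.ext (mul_inv_cancel₀ ha0)
    intro h0
    have := congrArg φ h1
    rw [map_mul, h0, zero_mul, map_one] at this
    exact zero_ne_one this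
  have hη0 : φ (η' b0) ≠ 0 := by
    have h1 : η' b0 * ⟨(η b0)⁻¹, hsub _ (Or.inr (Or.inr rfl))⟩ = 1 :=
      Subtype.ext (mul_inv_cancel₀ hb0)
    intro h0
    have := congrArg φ h1
    rw [map_mul, h0, zero_mul, map_one] at this
    exact zero_ne_one this
  have hc : ∀ c, ∑ a, ∑ b, φ (ξ' a) * φ (η' b) * algebraMap R L (γ a b c) = 0 := by
    intro c
    have h1 : ∑ a, ∑ b, ξ' a * η' b * algebraMap k _ (algebraMap R k (γ a b c)) = 0 := by
      apply Subtype.ext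
      have := h c
      push_cast
      rw [← this]
      refine Finset.sum_congr rfl fun a _ => Finset.sum_congr rfl fun b _ => ?_
      have e : algebraMap k Ω (algebraMap R k (γ a b c)) = ψ (γ a b c) :=
        (IsScalarTower.algebraMap_apply R k Ω _).symm
      rw [e]
    have h2 := congrArg φ h1
    simp only [map_sum, map_mul, map_zero, AlgHom.commutes] at h2
    rw [← h2]
    refine Finset.sum_congr rfl fun a _ => Finset.sum_congr rfl fun b _ => ?_
    rw [← IsScalarTower.algebraMap_apply R k L]
  have hprod : (∑ a, algebraMap F L (algebraMap E F (u a)) * φ (ξ' a)) *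
      (∑ b, algebraMap F L (algebraMap E F (v b)) * φ (η' b)) = 0 := by
    have h1 : ∑ c, (∑ a, ∑ b, φ (ξ' a) * φ (η' b) * algebraMap R L (γ a b c)) *
        algebraMap F L (algebraMap E F (w c)) = 0 :=
      Finset.sum_eq_zero fun c _ => by rw [hc c, zero_mul]
    rw [← h1, Finset.sum_mul_sum]
    simp only [Finset.sum_mul]
    conv_rhs => rw [Finset.sum_comm]; enter [2, a]; rw [Finset.sum_comm]
    refine Finset.sum_congr rfl fun a _ => Finset.sum_congr rfl fun b _ => ?_
    have h2 := congrArg (fun t => algebraMap F L (algebraMap E F t)) (hγ a b)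
    simp only [map_mul, map_sum, Algebra.smul_def] at h2
    calc _ = (algebraMap F L (algebraMap E F (u a)) * algebraMap F L (algebraMap E F (v b))) *
          (φ (ξ' a) * φ (η' b)) := by ring
      _ = _ := by
        rw [h2, Finset.sum_mul]
        refine Finset.sum_congr rfl fun c _ => ?_
        rw [IsScalarTower.algebraMap_apply R F L, IsScalarTower.algebraMap_apply R E F]
        ring
  rcases mul_eq_zero.1 hprod with h0 | h0
  · exact hξ0 (congrFun (eq_zero_of_sum_mul_eq_zero hkF _ hu' (fun a => φ (ξ' a))
      (fun a => hφ _) h0) a0)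
  · exact hη0 (congrFun (eq_zero_of_sum_mul_eq_zero hkF _ hv' (fun a => φ (η' a))
      (fun a => hφ _) h0) b0)

section FormalODE

open PowerSeries

variable {ι : Type*} [Fintype ι] (M : ι → ι → PowerSeries ℂ) (x₀ : ι → ℂ)

/-- Coefficients of the formal solution of `ξ' = M ξ`, `ξ(0) = x₀`. -/
def formalSolCoeff : ℕ → ι → ℂ
  | 0 => x₀
  | n + 1 => fun i => ((n : ℂ) + 1)⁻¹ *
      ∑ j, ∑ q : Fin (n + 1), (M i j).coeff (n - q) * formalSolCoeff q j
  termination_by n => n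
  decreasing_by exact q.2

theorem exists_formal_solution : ∃ ξ : ι → PowerSeries ℂ,
    (∀ i, (ξ i).coeff 0 = x₀ i) ∧ ∀ i, PowerSeries.derivative ℂ (ξ i) = ∑ j, M i j * ξ j := by
  refine ⟨fun i => PowerSeries.mk fun n => formalSolCoeff M x₀ n i, fun i => ?_, fun i => ?_⟩
  · rw [PowerSeries.coeff_mk, formalSolCoeff]
  · ext n
    rw [PowerSeries.coeff_derivative, PowerSeries.coeff_mk, formalSolCoeff, map_sum, mul_comm,
      mul_inv_cancel_left₀ (Nat.cast_add_one_ne_zero n)]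
    refine Finset.sum_congr rfl fun j _ => ?_
    rw [mul_comm (M i j), PowerSeries.coeff_mul, Finset.Nat.sum_antidiagonal_eq_sum_range_succ_mk,
      Finset.sum_range]
    refine Finset.sum_congr rfl fun q _ => ?_
    rw [PowerSeries.coeff_mk, mul_comm]

theorem formal_solution_eq_zero (ζ : ι → PowerSeries ℂ) (h0 : ∀ i, (ζ i).coeff 0 = 0)
    (h : ∀ i, derivative ℂ (ζ i) = ∑ j, M i j * ζ j) : ζ = 0 := by
  have key : ∀ n, ∀ i, (ζ i).coeff n = 0 := by
    intro n
    induction n using Nat.strong_induction_on with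
    | _ n ih =>
      rcases n with _ | n
      · exact h0
      intro i
      have h1 := congrArg (PowerSeries.coeff n) (h i)
      rw [PowerSeries.coeff_derivative, map_sum] at h1
      rw [Finset.sum_eq_zero] at h1
      · exact (mul_eq_zero.1 h1).resolve_right (Nat.cast_add_one_ne_zero n)
      · intro j _
        rw [PowerSeries.coeff_mul]
        refine Finset.sum_eq_zero fun p hp => ?_
        rw [ih p.2 (by have := Finset.HasAntidiagonal.mem_antidiagonal.1 hp; omega), mul_zero]
  funext i
  ext n
  exact key n i

end FormalODE

/-- Expansion of polynomials in powers of `z - α`. -/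
def expandAt (α : ℂ) : ℂ[X] →+* PowerSeries ℂ :=
  (Polynomial.coeToPowerSeries.ringHom).comp (Polynomial.compRingHom (Polynomial.X + Polynomial.C α))

theorem expandAt_apply (α : ℂ) (p : ℂ[X]) :
    expandAt α p = ((p.comp (Polynomial.X + Polynomial.C α) : ℂ[X]) : PowerSeries ℂ) := rfl

theorem expandAt_injective (α : ℂ) : Function.Injective (expandAt α) := by
  rw [injective_iff_map_eq_zero]
  intro p hp
  rw [expandAt_apply, Polynomial.coe_eq_zero_iff] at hp
  exact Polynomial.comp_X_add_C_eq_zero_iff.1 hp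

theorem coeff_zero_expandAt (α : ℂ) (p : ℂ[X]) : (expandAt α p).coeff 0 = p.eval α := by
  rw [expandAt_apply, Polynomial.coeff_coe, Polynomial.coeff_zero_eq_eval_zero]
  simp

theorem derivative_expandAt (α : ℂ) (p : ℂ[X]) :
    PowerSeries.derivative ℂ (expandAt α p) = expandAt α (Polynomial.derivative p) := by
  rw [expandAt_apply, expandAt_apply, PowerSeries.derivative_coe, Polynomial.derivative_comp]
  simp

/-- Multiplicative structure constants of differential modules are, at a regular point,
without zero divisors up to formal horizontal sections. -/
theorem exists_horizontal {ιa ιb ιc : Type*} [Fintype ιa] [Fintype ιb] [Fintype ιc]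
    (α : ℂ) (T : ℂ[X]) (hT : T.eval α ≠ 0)
    (U : ιa → ιa → ℂ[X]) (V : ιb → ιb → ℂ[X]) (W : ιc → ιc → ℂ[X])
    (γ : ιa → ιb → ιc → ℂ[X])
    (hγ : ∀ a b c, ∑ a', U a a' * γ a' b c + ∑ b', V b b' * γ a b' c =
      T * Polynomial.derivative (γ a b c) + ∑ c', γ a b c' * W c' c)
    (x : ιa → ℂ) (y : ιb → ℂ) (hxy : ∀ c, ∑ a, ∑ b, x a * y b * (γ a b c).eval α = 0) :
    ∃ ξ : ιa → PowerSeries ℂ, ∃ η : ιb → PowerSeries ℂ,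
      (∀ a, (ξ a).coeff 0 = x a) ∧ (∀ b, (η b).coeff 0 = y b) ∧
      ∀ c, ∑ a, ∑ b, ξ a * η b * expandAt α (γ a b c) = 0 := by
  set φ := expandAt α with hφ
  obtain ⟨S, hS⟩ : ∃ S, φ T * S = 1 := by
    have : IsUnit (φ T) := by
      rw [PowerSeries.isUnit_iff_constantCoeff, ← PowerSeries.coeff_zero_eq_constantCoeff_apply,
        coeff_zero_expandAt]
      exact hT.isUnit
    exact this.exists_right_inv
  obtain ⟨ξ, hξ0, hξ⟩ := exists_formal_solution (fun a a' => - (S * φ (U a' a))) x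
  obtain ⟨η, hη0, hη⟩ := exists_formal_solution (fun b b' => - (S * φ (V b' b))) y
  refine ⟨ξ, η, hξ0, hη0, fun c => congrFun (formal_solution_eq_zero
    (fun c c' => - (S * φ (W c' c))) (fun c => ∑ a, ∑ b, ξ a * η b * φ (γ a b c))
    (fun c => ?_) (fun c => ?_)) c⟩
  · rw [← hxy c, map_sum]
    refine Finset.sum_congr rfl fun a _ => ?_
    rw [map_sum]
    refine Finset.sum_congr rfl fun b _ => ?_
    simp only [PowerSeries.coeff_zero_eq_constantCoeff, map_mul]
    simp only [← PowerSeries.coeff_zero_eq_constantCoeff_apply, hξ0, hη0, hφ, coeff_zero_expandAt]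
  · have e1 : ∀ a b, PowerSeries.derivative ℂ (ξ a * η b * φ (γ a b c)) =
        PowerSeries.derivative ℂ (ξ a) * η b * φ (γ a b c) +
          ξ a * PowerSeries.derivative ℂ (η b) * φ (γ a b c)
        + ξ a * η b * φ (Polynomial.derivative (γ a b c)) := by
      intro a b
      rw [Derivation.leibniz, Derivation.leibniz, derivative_expandAt]
      simp only [smul_eq_mul]
      ring
    have e2 : ∀ a b, S * (∑ a', φ (U a a') * φ (γ a' b c) + ∑ b', φ (V b b') * φ (γ a b' c)) =
      φ (Polynomial.derivative (γ a b c)) + S * ∑ c', φ (γ a b c') * φ (W c' c) := by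
      intro a b
      have := congrArg φ (hγ a b c)
      simp only [map_add, map_sum, map_mul] at this
      rw [this]
      linear_combination (φ (Polynomial.derivative (γ a b c))) * hS
    have e3 : ∑ a, ∑ b, PowerSeries.derivative ℂ (ξ a) * η b * φ (γ a b c) =
        - ∑ a, ∑ b, ξ a * η b * (S * ∑ a', φ (U a a') * φ (γ a' b c)) := by
      simp only [hξ, Finset.sum_mul, Finset.mul_sum, ← Finset.sum_neg_distrib]
      rw [Finset.sum_comm]
      conv_rhs => rw [Finset.sum_comm]
      refine Finset.sum_congr rfl fun b _ => ?_
      rw [Finset.sum_comm]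
      refine Finset.sum_congr rfl fun a _ => Finset.sum_congr rfl fun a' _ => ?_
      ring
    have e4 : ∑ a, ∑ b, ξ a * PowerSeries.derivative ℂ (η b) * φ (γ a b c) =
        - ∑ a, ∑ b, ξ a * η b * (S * ∑ b', φ (V b b') * φ (γ a b' c)) := by
      simp only [hη, Finset.sum_mul, Finset.mul_sum, ← Finset.sum_neg_distrib]
      refine Finset.sum_congr rfl fun a _ => ?_
      rw [Finset.sum_comm]
      refine Finset.sum_congr rfl fun b _ => Finset.sum_congr rfl fun b' _ => ?_
      ring
    have e5 : ∑ c', -(S * φ (W c' c)) * ∑ a, ∑ b, ξ a * η b * φ (γ a b c') =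
        - ∑ a, ∑ b, ξ a * η b * (S * ∑ c', φ (γ a b c') * φ (W c' c)) := by
      simp only [Finset.mul_sum, ← Finset.sum_neg_distrib]
      rw [Finset.sum_comm]
      refine Finset.sum_congr rfl fun a _ => ?_
      rw [Finset.sum_comm]
      refine Finset.sum_congr rfl fun b _ => Finset.sum_congr rfl fun b' _ => ?_
      ring
    rw [e5, map_sum]
    simp only [map_sum, e1, Finset.sum_add_distrib]
    rw [e3, e4, ← sub_eq_zero]
    simp only [← Finset.sum_neg_distrib, ← Finset.sum_add_distrib, ← Finset.sum_sub_distrib]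
    refine Finset.sum_eq_zero fun a _ => Finset.sum_eq_zero fun b _ => ?_
    linear_combination -(ξ a * η b) * e2 a b

theorem exists_linearIndependent_span_eq {R M : Type*} [CommRing R] [IsDomain R]
    [IsPrincipalIdealRing R] [AddCommGroup M] [Module R M] [Module.IsTorsionFree R M]
    (s : Finset M) : ∃ r : ℕ, ∃ g : Fin r → M, r ≤ s.card ∧ LinearIndependent R g ∧
      Submodule.span R (Set.range g) = Submodule.span R (s : Set M) := by
  set A := Submodule.span R (s : Set M) with hA
  have : Module.Finite R A := Module.Finite.span_finset R s
  have : Module.Free R A := Module.free_of_finite_type_torsion_free'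
  let b := Module.finBasis R A
  refine ⟨_, fun i => (b i : M), ?_, b.linearIndependent.map' A.subtype A.ker_subtype, ?_⟩
  · exact finrank_span_finset_le_card s
  have : Set.range (fun i => (b i : M)) = A.subtype '' Set.range b := by
    rw [← Set.range_comp]; rfl
  rw [this, Submodule.span_image, b.span_eq, Submodule.map_top, Submodule.range_subtype]

namespace Entire

theorem exists_basis {K : Type*} [Field K] [Algebra K ℂ] (A : Submodule K[X] Entire) (hA : A.FG) :
    ∃ r : ℕ, ∃ g : Fin r → Entire, LinearIndependent K[X] g ∧
      Submodule.span K[X] (Set.range g) = A := by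
  obtain ⟨s, hs⟩ := hA
  obtain ⟨r, g, -, hg, h⟩ := exists_linearIndependent_span_eq (R := K[X]) s
  exact ⟨r, g, hg, h.trans hs⟩

theorem smul_D_sum {K : Type*} [Field K] [Algebra K ℂ] {ι : Type*} [Fintype ι] (T : K[X])
    (p : ι → K[X]) (g : ι → Entire) :
    T • D (∑ i, p i • g i) = ∑ i, (T * derivative (p i)) • g i + ∑ i, p i • (T • D (g i)) := by
  rw [map_sum, Finset.smul_sum, ← Finset.sum_add_distrib]
  refine Finset.sum_congr rfl fun i _ => ?_
  rw [D_poly_smul, smul_add, smul_smul, smul_smul, smul_smul, mul_comm (p i)]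

theorem mem_of_mul_mem_smul (A B C : Submodule ℂ[X] Entire) (hA : A.FG) (hB : B.FG) (hC : C.FG)
    (T : ℂ[X]) (hAD : ∀ x ∈ A, T • D x ∈ A) (hBD : ∀ x ∈ B, T • D x ∈ B)
    (hCD : ∀ x ∈ C, T • D x ∈ C) (hABC : ∀ x ∈ A, ∀ y ∈ B, x * y ∈ C)
    (α : ℂ) (hT : T.eval α ≠ 0) (x y z : Entire) (hx : x ∈ A) (hy : y ∈ B) (hz : z ∈ C)
    (hxyz : x * y = (X - Polynomial.C α : ℂ[X]) • z) :
    (∃ x' ∈ A, x = (X - Polynomial.C α : ℂ[X]) • x') ∨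
      ∃ y' ∈ B, y = (X - Polynomial.C α : ℂ[X]) • y' := by
  obtain ⟨ra, u, hu, rfl⟩ := exists_basis A hA
  obtain ⟨rb, v, hv, rfl⟩ := exists_basis B hB
  obtain ⟨rc, w, hw, rfl⟩ := exists_basis C hC
  have hcoord : ∀ {r : ℕ} (g : Fin r → Entire) (x : Entire),
      x ∈ Submodule.span ℂ[X] (Set.range g) → ∃ p : Fin r → ℂ[X], ∑ i, p i • g i = x :=
    fun g x h => (Submodule.mem_span_range_iff_exists_fun _).1 h
  have hmem : ∀ {r : ℕ} (g : Fin r → Entire) (p : Fin r → ℂ[X]),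
      ∑ i, p i • g i ∈ Submodule.span ℂ[X] (Set.range g) :=
    fun g p => (Submodule.mem_span_range_iff_exists_fun _).2 ⟨p, rfl⟩
  have hg : ∀ {r : ℕ} (g : Fin r → Entire) (i : Fin r),
      g i ∈ Submodule.span ℂ[X] (Set.range g) := fun g i => Submodule.subset_span ⟨i, rfl⟩
  choose U hU using fun a => hcoord u _ (hAD _ (hg u a))
  choose V hV using fun a => hcoord v _ (hBD _ (hg v a))
  choose W hW using fun a => hcoord w _ (hCD _ (hg w a))
  choose γ hγ using fun a b => hcoord w _ (hABC _ (hg u a) _ (hg v b))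
  obtain ⟨p, rfl⟩ := hcoord u x hx
  obtain ⟨q, rfl⟩ := hcoord v y hy
  obtain ⟨s, rfl⟩ := hcoord w z hz
  have hind := Fintype.linearIndependent_iff.1 hw
  have hsub : ∀ p q : Fin rc → ℂ[X], ∑ i, p i • w i = ∑ i, q i • w i → p = q := by
    intro p q hpq
    funext i
    refine sub_eq_zero.1 (hind (fun i => p i - q i) ?_ i)
    simp only [sub_smul, Finset.sum_sub_distrib, hpq, sub_self]
  have hγ' : ∀ a b c, ∑ a', U a a' * γ a' b c + ∑ b', V b b' * γ a b' c =
      T * Polynomial.derivative (γ a b c) + ∑ c', γ a b c' * W c' c := by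
    intro a b
    have h1 : T • D (u a * v b) = ∑ c, (∑ a', U a a' * γ a' b c + ∑ b', V b b' * γ a b' c) • w c := by
      rw [Derivation.leibniz, smul_add, smul_eq_mul, smul_eq_mul, ← mul_smul_comm, ← mul_smul_comm,
        ← hU, ← hV, Finset.mul_sum, Finset.mul_sum]
      simp only [add_smul, Finset.sum_add_distrib, Finset.sum_smul, mul_smul]
      rw [add_comm]
      congr 1
      · rw [Finset.sum_comm]
        refine Finset.sum_congr rfl fun a' _ => ?_
        rw [mul_smul_comm, mul_comm, ← hγ, Finset.smul_sum]
      · rw [Finset.sum_comm]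
        refine Finset.sum_congr rfl fun a' _ => ?_
        rw [mul_smul_comm, ← hγ, Finset.smul_sum]
    have h2 : T • D (u a * v b) =
        ∑ c, (T * Polynomial.derivative (γ a b c) + ∑ c', γ a b c' * W c' c) • w c := by
      rw [← hγ, smul_D_sum]
      simp only [add_smul, Finset.sum_add_distrib, Finset.sum_smul, mul_smul]
      congr 1
      rw [Finset.sum_comm]
      refine Finset.sum_congr rfl fun c _ => ?_
      rw [← hW, Finset.smul_sum]
    exact fun c => congrFun (hsub _ _ (h1.symm.trans h2)) c
  have hpq : ∀ c, ∑ a, ∑ b, (p a).eval α * (q b).eval α * (γ a b c).eval α = 0 := by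
    have h1 : (∑ a, p a • u a) * (∑ b, q b • v b) =
        ∑ c, (∑ a, ∑ b, p a * q b * γ a b c) • w c := by
      rw [Finset.sum_mul_sum]
      simp only [Finset.sum_smul]
      conv_rhs => rw [Finset.sum_comm]; enter [2, a]; rw [Finset.sum_comm]
      refine Finset.sum_congr rfl fun a _ => Finset.sum_congr rfl fun b _ => ?_
      rw [smul_mul_smul_comm, ← hγ, Finset.smul_sum]
      exact Finset.sum_congr rfl fun c _ => by rw [smul_smul]
    rw [h1, Finset.smul_sum] at hxyz
    simp only [smul_smul] at hxyz
    intro c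
    have h2 := congrArg (Polynomial.eval α) (congrFun (hsub _ _ hxyz) c)
    simpa [Polynomial.eval_finsetSum] using h2
  obtain ⟨ξ, η, hξ, hη, hζ⟩ := exists_horizontal α T hT U V W γ hγ' _ _ hpq
  have key := eq_zero_or_eq_zero_of_bilinear (R := ℂ[X]) (E := Entire) (F := FractionRing Entire)
    (Ω := FractionRing (PowerSeries ℂ))
    ((algebraMap (PowerSeries ℂ) (FractionRing (PowerSeries ℂ))).comp (expandAt α))
    ((IsFractionRing.injective (PowerSeries ℂ) (FractionRing (PowerSeries ℂ))).comp
      (expandAt_injective α))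
    (exists_of_isAlgebraic_fraction fun u v hv n p h => isIntegral_iff_exists u v hv p h)
    u hu v hv w γ (fun a b => (hγ a b).symm)
    (fun a => algebraMap _ (FractionRing (PowerSeries ℂ)) (ξ a))
    (fun b => algebraMap _ (FractionRing (PowerSeries ℂ)) (η b)) (by
      intro c
      have := congrArg (algebraMap _ (FractionRing (PowerSeries ℂ))) (hζ c)
      simpa only [map_sum, map_mul, map_zero, RingHom.comp_apply] using this)
  have hdiv : ∀ {r : ℕ} (g : Fin r → Entire) (p : Fin r → ℂ[X]), (∀ i, (p i).eval α = 0) →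
      ∃ x' ∈ Submodule.span ℂ[X] (Set.range g),
        ∑ i, p i • g i = (X - Polynomial.C α : ℂ[X]) • x' := by
    intro r g p hp
    choose p' hp' using fun i => Polynomial.dvd_iff_isRoot.2 (hp i)
    refine ⟨_, hmem g p', ?_⟩
    rw [Finset.smul_sum]
    exact Finset.sum_congr rfl fun i _ => by rw [smul_smul, ← hp']
  have hinj := IsFractionRing.injective (PowerSeries ℂ) (FractionRing (PowerSeries ℂ))
  rcases key with h | h
  · left
    refine hdiv u p fun i => ?_
    have : ξ i = 0 := hinj (by simpa using congrFun h i)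
    rw [← hξ, this, map_zero]
  · right
    refine hdiv v q fun i => ?_
    have : η i = 0 := hinj (by simpa using congrFun h i)
    rw [← hη, this, map_zero]

end Entire

section Descend

variable {K : Type*} [Field K] [Algebra K ℂ] (φ : ℂ →ₗ[K] K)

/-- A `K`-linear form applied to the coefficients of a power series. -/
def descend : PowerSeries ℂ →+ PowerSeries K where
  toFun s := PowerSeries.mk fun n => φ (s.coeff n)
  map_zero' := by ext; simp
  map_add' s t := by ext; simp

theorem coeff_descend (s : PowerSeries ℂ) (n : ℕ) : (descend φ s).coeff n = φ (s.coeff n) :=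
  PowerSeries.coeff_mk (R := K) n fun n => φ (s.coeff n)

theorem descend_mul (s : PowerSeries ℂ) (g : PowerSeries K) :
    descend φ (s * PowerSeries.map (algebraMap K ℂ) g) = descend φ s * g := by
  ext n
  rw [coeff_descend, PowerSeries.coeff_mul, PowerSeries.coeff_mul, map_sum]
  refine Finset.sum_congr rfl fun p _ => ?_
  rw [PowerSeries.coeff_map, coeff_descend, mul_comm, ← Algebra.smul_def, map_smul, smul_eq_mul,
    mul_comm]

theorem descend_map (h : ∀ a : K, φ (algebraMap K ℂ a) = a) (g : PowerSeries K) :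
    descend φ (PowerSeries.map (algebraMap K ℂ) g) = g := by
  ext n
  rw [coeff_descend, PowerSeries.coeff_map, h]

theorem exists_descend_coe (q : ℂ[X]) : ∃ q' : K[X], (q' : PowerSeries K) = descend φ q := by
  refine ⟨(descend φ q).trunc (q.natDegree + 1), ?_⟩
  ext n
  rw [Polynomial.coeff_coe, PowerSeries.coeff_trunc]
  split_ifs with h
  · rfl
  · rw [coeff_descend, Polynomial.coeff_coe, Polynomial.coeff_eq_zero_of_natDegree_lt (by omega),
      map_zero]

end Descend

namespace Entire

variable (K : Type*) [Field K] [Algebra K ℂ] {n : ℕ} (f : Fin n → Entire)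

/-- The entire functions whose Taylor coefficients at the origin lie in `K`. -/
def rational : Subring Entire := (PowerSeries.map (algebraMap K ℂ)).range.comap taylor

/-- The monomial with exponents `m` in the functions `f`. -/
def mono (m : Fin n →₀ ℕ) : Entire := ∏ i, f i ^ m i

/-- The exponents of the monomials of degree `N` in `n` variables. -/
def expSet (n N : ℕ) : Finset (Fin n →₀ ℕ) := Finset.finsuppAntidiag Finset.univ N

/-- The `K[z]`-module of homogeneous polynomials of degree `N` in the functions `f`. -/
def homSpan (N : ℕ) : Submodule K[X] Entire :=
  Submodule.span K[X] (mono f '' (expSet n N : Set (Fin n →₀ ℕ)))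

theorem mem_expSet {N : ℕ} {m : Fin n →₀ ℕ} : m ∈ expSet n N ↔ ∑ i, m i = N := by
  simp [expSet, Finset.mem_finsuppAntidiag]

theorem card_expSet_le (n N : ℕ) : (expSet n N).card ≤ (N + 1) ^ n := by
  have h : (expSet n N).card ≤ (Finset.univ : Finset (Fin n → Fin (N + 1))).card := by
    refine Finset.card_le_card_of_injOn (fun m i => Fin.ofNat (N + 1) (m i))
      (fun _ _ => Finset.mem_coe.2 (Finset.mem_univ _)) ?_
    intro m hm m' hm' h
    have hle : ∀ m ∈ expSet n N, ∀ i, m i < N + 1 := by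
      intro m hm i
      have := mem_expSet.1 hm
      exact Nat.lt_succ_of_le (this ▸ Finset.single_le_sum (f := fun i => m i)
        (fun _ _ => Nat.zero_le _) (Finset.mem_univ i))
    ext i
    have := congrArg Fin.val (congrFun h i)
    simpa [Fin.ofNat, Nat.mod_eq_of_lt (hle m hm i), Nat.mod_eq_of_lt (hle m' hm' i)] using this
  simpa using h

theorem mono_add (m m' : Fin n →₀ ℕ) : mono f (m + m') = mono f m * mono f m' := by
  simp [mono, pow_add, Finset.prod_mul_distrib]

theorem mono_mem {N : ℕ} {m : Fin n →₀ ℕ} (h : ∑ i, m i = N) : mono f m ∈ homSpan K f N :=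
  Submodule.subset_span (Set.mem_image_of_mem _ (Finset.mem_coe.2 (mem_expSet.2 h)))

theorem mono_single (i : Fin n) : mono f (Finsupp.single i 1) = f i := by
  rw [mono, Finset.prod_eq_single i] <;> simp +contextual [eq_comm]

theorem apply_mem_homSpan (i : Fin n) : f i ∈ homSpan K f 1 := by
  have := mono_mem K f (N := 1) (m := Finsupp.single i 1) (by simp [Finsupp.single_apply])
  rwa [mono_single] at this

theorem mul_mem_homSpan {N M : ℕ} {x y : Entire} (hx : x ∈ homSpan K f N)
    (hy : y ∈ homSpan K f M) : x * y ∈ homSpan K f (N + M) := by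
  have h : homSpan K f N * homSpan K f M ≤ homSpan K f (N + M) := by
    rw [homSpan, homSpan, Submodule.span_mul_span, Submodule.span_le]
    rintro _ ⟨_, hx, _, hy, rfl⟩
    obtain ⟨m, hm, rfl⟩ := hx
    obtain ⟨m', hm', rfl⟩ := hy
    rw [Finset.mem_coe] at hm hm'
    change mono f m * mono f m' ∈ _
    rw [← mono_add]
    refine mono_mem K f ?_
    rw [← mem_expSet.1 hm, ← mem_expSet.1 hm', ← Finset.sum_add_distrib]
    rfl
  exact h (Submodule.mul_mem_mul hx hy)

theorem homSpan_fg (N : ℕ) : (homSpan K f N).FG :=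
  Submodule.fg_span ((expSet n N).finite_toSet.image _)

theorem exists_sum_of_mem_homSpan {N : ℕ} {x : Entire} (hx : x ∈ homSpan K f N) :
    ∃ q : (Fin n →₀ ℕ) → K[X], x = ∑ m ∈ expSet n N, q m • mono f m := by
  rw [homSpan] at hx
  obtain ⟨q, hq⟩ := (Submodule.mem_span_image_finset_iff_exists_fun' K[X]).1 hx
  exact ⟨q, hq.symm⟩

theorem sum_mem_homSpan {N : ℕ} (q : (Fin n →₀ ℕ) → K[X]) :
    ∑ m ∈ expSet n N, q m • mono f m ∈ homSpan K f N :=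
  Submodule.sum_mem _ fun _ hm => Submodule.smul_mem _ _ (mono_mem K f (mem_expSet.1 hm))

theorem smul_D_mem_span {K : Type*} [Field K] [Algebra K ℂ] (T : K[X]) (s : Set Entire)
    (h : ∀ x ∈ s, T • D x ∈ Submodule.span K[X] s) {x : Entire}
    (hx : x ∈ Submodule.span K[X] s) : T • D x ∈ Submodule.span K[X] s := by
  induction hx using Submodule.span_induction with
  | mem x hx => exact h x hx
  | zero => simp
  | add x y _ _ hx hy => rw [map_add, smul_add]; exact Submodule.add_mem _ hx hy
  | smul p x hx h =>
    rw [D_poly_smul, smul_add, smul_smul, smul_comm]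
    exact Submodule.add_mem _ (Submodule.smul_mem _ _ hx) (Submodule.smul_mem _ _ h)

theorem smul_D_mem_homSpan (T : K[X]) (hf : ∀ i, T • D (f i) ∈ homSpan K f 1) (N : ℕ) :
    ∀ x ∈ homSpan K f N, T • D x ∈ homSpan K f N := by
  induction N with
  | zero =>
    intro x hx
    refine smul_D_mem_span T _ ?_ hx
    intro y hy
    obtain ⟨m, hm, rfl⟩ := hy
    have h0 : ∀ i, m i = 0 := by simpa using mem_expSet.1 hm
    have : mono f m = 1 := by simp [mono, h0]
    rw [this, Derivation.map_one_eq_zero, smul_zero]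
    exact Submodule.zero_mem _
  | succ N ih =>
    intro x hx
    refine smul_D_mem_span T _ ?_ hx
    intro y hy
    obtain ⟨m, hm, rfl⟩ := hy
    have hm := mem_expSet.1 hm
    obtain ⟨i, hi⟩ : ∃ i, m i ≠ 0 := by
      by_contra! h
      simp [h] at hm
    obtain ⟨m', rfl⟩ : ∃ m', m = Finsupp.single i 1 + m' := by
      refine ⟨m - Finsupp.single i 1, ?_⟩
      rw [add_tsub_cancel_of_le]
      exact Finsupp.single_le_iff.2 (Nat.one_le_iff_ne_zero.2 hi)
    have hm' : ∑ i, m' i = N := by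
      simp [Finset.sum_add_distrib, Finsupp.single_apply] at hm
      omega
    rw [mono_add, mono_single, Derivation.leibniz, smul_add, smul_eq_mul, smul_eq_mul,
      ← mul_smul_comm, ← mul_smul_comm]
    change _ ∈ homSpan K f (N + 1)
    rw [add_comm N 1]
    refine Submodule.add_mem _ (mul_mem_homSpan K f (apply_mem_homSpan K f i)
      (ih _ (mono_mem K f hm'))) ?_
    rw [mul_comm]
    exact mul_mem_homSpan K f (hf i) (mono_mem K f hm')

theorem poly_smul_eq_map_smul {K : Type*} [Field K] [Algebra K ℂ] (p : K[X]) (g : Entire) :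
    p • g = (p.map (algebraMap K ℂ)) • g := by
  refine ext fun z => ?_
  rw [smul_poly_apply, smul_poly_apply, aeval_map_algebraMap]

theorem homSpan_le {N : ℕ} {x : Entire} (hx : x ∈ homSpan K f N) : x ∈ homSpan ℂ f N := by
  obtain ⟨q, rfl⟩ := exists_sum_of_mem_homSpan K f hx
  rw [Finset.sum_congr rfl fun m _ => poly_smul_eq_map_smul (q m) (mono f m)]
  exact sum_mem_homSpan ℂ f _

theorem taylor_smul_poly {K : Type*} [Field K] [Algebra K ℂ] (p : K[X]) (g : Entire) :
    taylor (p • g) = PowerSeries.map (algebraMap K ℂ) p * taylor g := by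
  rw [Algebra.smul_def, map_mul, taylor_algebraMap, Polynomial.polynomial_map_coe]

theorem mem_homSpan_of_rational (hf : ∀ i, f i ∈ rational K) {N : ℕ} {x : Entire}
    (hx : x ∈ homSpan ℂ f N) (hxr : x ∈ rational K) : x ∈ homSpan K f N := by
  obtain ⟨φ, hφ⟩ : ∃ φ : ℂ →ₗ[K] K, ∀ a : K, φ (algebraMap K ℂ a) = a := by
    obtain ⟨φ, hφ⟩ := (Algebra.linearMap K ℂ).exists_leftInverse_of_injective
      (LinearMap.ker_eq_bot.2 (algebraMap K ℂ).injective)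
    exact ⟨φ, fun a => LinearMap.congr_fun hφ a⟩
  have hmono : ∀ m, mono f m ∈ rational K := fun m =>
    Subring.prod_mem _ fun i _ => Subring.pow_mem _ (hf i) _
  choose s hs using hmono
  obtain ⟨t, ht⟩ := hxr
  obtain ⟨q, hq⟩ := exists_sum_of_mem_homSpan ℂ f hx
  choose q' hq' using fun m => exists_descend_coe φ (q m)
  have : x = ∑ m ∈ expSet n N, q' m • mono f m := by
    apply taylor_injective
    have h1 : t = ∑ m ∈ expSet n N, (q' m : PowerSeries K) * s m := by
      rw [← descend_map φ hφ t, ht, hq, map_sum, map_sum]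
      refine Finset.sum_congr rfl fun m _ => ?_
      rw [taylor_smul_poly, ← hs, descend_mul, hq']
      congr 2
    rw [← ht, h1, map_sum, map_sum]
    refine Finset.sum_congr rfl fun m _ => ?_
    rw [taylor_smul_poly, map_mul, hs]
  rw [this]
  exact sum_mem_homSpan K f _

theorem rational_smul (p : K[X]) {x : Entire} (hx : x ∈ rational K) : p • x ∈ rational K := by
  obtain ⟨t, ht⟩ := hx
  refine ⟨p * t, ?_⟩
  rw [taylor_smul_poly, map_mul, ht]

theorem rational_of_smul {a : K} (ha : a ≠ 0) {x : Entire}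
    (hx : (X - C a : K[X]) • x ∈ rational K) : x ∈ rational K := by
  obtain ⟨t, ht⟩ := hx
  have hu : IsUnit ((X - C a : K[X]) : PowerSeries K) := by
    rw [PowerSeries.isUnit_iff_constantCoeff]
    simp [ha]
  obtain ⟨v, hv⟩ := hu.exists_right_inv
  refine ⟨v * t, ?_⟩
  rw [map_mul, ht, taylor_smul_poly, ← mul_assoc, ← map_mul, mul_comm v, hv, map_one, one_mul]

theorem homSpan_le_rational (hf : ∀ i, f i ∈ rational K) {N : ℕ} {x : Entire}
    (hx : x ∈ homSpan K f N) : x ∈ rational K := by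
  obtain ⟨q, rfl⟩ := exists_sum_of_mem_homSpan K f hx
  exact Subring.sum_mem _ fun m _ => rational_smul K _
    (Subring.prod_mem _ fun i _ => Subring.pow_mem _ (hf i) _)

/-- Divisibility by `z - a` in the graded ring of the `homSpan`s is a prime condition. -/
theorem homSpan_prime (hf : ∀ i, f i ∈ rational K) (T : K[X])
    (hfD : ∀ i, T • D (f i) ∈ homSpan K f 1) {a : K} (ha : a ≠ 0) (hTa : T.eval a ≠ 0)
    {d e : ℕ} {x y z : Entire} (hx : x ∈ homSpan K f d) (hy : y ∈ homSpan K f e)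
    (hz : z ∈ homSpan K f (d + e)) (h : x * y = (X - C a : K[X]) • z) :
    (∃ x' ∈ homSpan K f d, x = (X - C a : K[X]) • x') ∨
      ∃ y' ∈ homSpan K f e, y = (X - C a : K[X]) • y' := by
  have hπ : ∀ w : Entire, (X - C a : K[X]) • w = (X - C (algebraMap K ℂ a) : ℂ[X]) • w := by
    intro w
    rw [poly_smul_eq_map_smul]
    simp
  have hdesc : ∀ {N : ℕ} {x : Entire}, x ∈ homSpan K f N →
      (∃ x' ∈ homSpan ℂ f N, x = (X - C (algebraMap K ℂ a) : ℂ[X]) • x') →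
      ∃ x' ∈ homSpan K f N, x = (X - C a : K[X]) • x' := by
    rintro N x hx ⟨x', hx', rfl⟩
    refine ⟨x', mem_homSpan_of_rational K f hf hx' ?_, (hπ x').symm⟩
    refine rational_of_smul K ha ?_
    rw [hπ]
    exact homSpan_le_rational K f hf hx
  have hD : ∀ N, ∀ x ∈ homSpan ℂ f N, T.map (algebraMap K ℂ) • D x ∈ homSpan ℂ f N := by
    refine smul_D_mem_homSpan ℂ f _ fun i => ?_
    rw [← poly_smul_eq_map_smul]
    exact homSpan_le K f (hfD i)
  refine (mem_of_mul_mem_smul (homSpan ℂ f d) (homSpan ℂ f e) (homSpan ℂ f (d + e))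
    (homSpan_fg ℂ f d) (homSpan_fg ℂ f e) (homSpan_fg ℂ f _) (T.map (algebraMap K ℂ))
    (hD d) (hD e) (hD _) (fun x hx y hy => mul_mem_homSpan ℂ f hx hy) (algebraMap K ℂ a) ?_
    x y z (homSpan_le K f hx) (homSpan_le K f hy) (homSpan_le K f hz) ?_).imp (hdesc hx) (hdesc hy)
  · rw [eval_map_algebraMap, aeval_algebraMap_apply]
    simpa using hTa
  · rw [h, hπ]

end Entire

section Derivation

theorem exists_derivation_extending {K : Type*} [Field K] (k : Type*) [Field k] [Algebra K k]
    [Algebra K[X] k] [IsScalarTower K K[X] k] [IsFractionRing K[X] k] :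
    ∃ δ : Derivation K k k, ∀ p : K[X],
      δ (algebraMap K[X] k p) = algebraMap K[X] k (derivative p) := by
  have : Algebra.FormallyEtale K[X] k := .of_isLocalization (nonZeroDivisors K[X])
  let d : Derivation K K[X] k := (Algebra.linearMap K[X] k).compDer Polynomial.derivative'
  let e := KaehlerDifferential.tensorKaehlerEquivOfFormallyEtale K K[X] k
  let δ : Derivation K k k := ((LinearMap.liftBaseChange k d.liftKaehlerDifferential) ∘ₗ
    e.symm.toLinearMap).compDer (KaehlerDifferential.D K k)
  refine ⟨δ, fun p => ?_⟩
  have h : e (1 ⊗ₜ[K[X]] KaehlerDifferential.D K K[X] p) =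
      KaehlerDifferential.D K k (algebraMap K[X] k p) := by
    simp [e]
  have h' : e.symm (KaehlerDifferential.D K k (algebraMap K[X] k p)) =
      1 ⊗ₜ[K[X]] KaehlerDifferential.D K K[X] p := by
    rw [← h, e.symm_apply_apply]
  change LinearMap.liftBaseChange k d.liftKaehlerDifferential (e.symm _) = _
  refine (congrArg _ h').trans ?_
  simp [d]

theorem mem_range_of_derivation_eq_zero {K : Type*} [Field K] [CharZero K] {k : Type*} [Field k]
    [Algebra K k] [Algebra K[X] k] [IsScalarTower K K[X] k] [IsFractionRing K[X] k]
    (δ : Derivation K k k)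
    (hδ : ∀ p : K[X], δ (algebraMap K[X] k p) = algebraMap K[X] k (derivative p))
    {a : k} (ha : δ a = 0) : ∃ c : K, algebraMap K k c = a := by
  obtain ⟨p, q, hpq, h⟩ := IsFractionRing.exists_reduced_fraction (A := K[X]) a
  have hq : (q : K[X]) ≠ 0 := nonZeroDivisors.ne_zero q.2
  have hinj := IsFractionRing.injective K[X] k
  have hq' : algebraMap K[X] k q ≠ 0 := fun h => hq ((map_eq_zero_iff _ hinj).1 h)
  have h : a * algebraMap K[X] k q = algebraMap K[X] k p := by
    rw [← h, IsLocalization.mk'_spec]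
  have h1 := congrArg δ h
  rw [Derivation.leibniz, ha, smul_zero, add_zero, hδ, hδ, smul_eq_mul] at h1
  have h2 : p * derivative (q : K[X]) = q * derivative p := by
    apply hinj
    rw [map_mul, map_mul, ← h1, ← h]
    ring
  have hdvd : (q : K[X]) ∣ derivative (q : K[X]) :=
    (isRelPrime_iff_isCoprime.1 hpq).symm.dvd_of_dvd_mul_left ⟨_, h2⟩
  have hq0 : derivative (q : K[X]) = 0 := by
    by_contra hne
    exact absurd (degree_le_of_dvd hdvd hne) (not_le.2 (degree_derivative_lt hq))
  have hp0 : derivative p = 0 := by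
    rw [hq0, mul_zero] at h2
    exact (mul_eq_zero.1 h2.symm).resolve_left hq
  have e1 := eq_C_of_derivative_eq_zero hq0
  have e2 := eq_C_of_derivative_eq_zero hp0
  refine ⟨p.coeff 0 / (q : K[X]).coeff 0, ?_⟩
  have hC : ∀ c : K, algebraMap K[X] k (C c) = algebraMap K k c := fun c =>
    (IsScalarTower.algebraMap_apply K K[X] k c).symm
  rw [map_div₀, ← hC, ← hC, ← e1, ← e2, ← h, mul_div_assoc, div_self hq', mul_one]

end Derivation

theorem exists_submodule_maps_into (A : Type*) {V : Type*} [Ring A] [AddCommGroup V] [Module A V]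
    [IsArtinian A V] : ∃ S : Submodule A V, ∀ W : Submodule A V, W ≠ ⊥ →
      ∃ φ : S →ₗ[A] V, φ ≠ 0 ∧ ∀ s, φ s ∈ W := by
  let S : Submodule A V := sSup {m | IsSimpleModule A m}
  have hS : IsSemisimpleModule A S := by
    have := isSemisimpleModule_biSup_of_isSemisimpleModule_submodule (R := A) (M := V)
      (s := {m : Submodule A V | IsSimpleModule A m}) (p := fun m => m) (fun m hm => by
        have : IsSimpleModule A m := hm
        infer_instance)
    rwa [← sSup_eq_iSup] at this
  have := hS.toComplementedLattice
  have hart : IsArtinian A V := inferInstance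
  have : IsAtomic (Submodule A V) := isAtomic_of_orderBot_wellFounded_lt hart.wf
  refine ⟨S, fun W hW => ?_⟩
  obtain ⟨a, ha, haW⟩ := (IsAtomic.eq_bot_or_exists_atom_le W).resolve_left hW
  have haS : a ≤ S := le_sSup (isSimpleModule_iff_isAtom.2 ha)
  obtain ⟨q, hq⟩ := exists_isCompl (a.comap S.subtype)
  refine ⟨S.subtype ∘ₗ (a.comap S.subtype).subtype ∘ₗ
    Submodule.projectionOnto (a.comap S.subtype) q hq, fun h0 => ?_, fun s =>
    haW (Submodule.projectionOnto (a.comap S.subtype) q hq s).2⟩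
  obtain ⟨v, hv, hv0⟩ := Submodule.exists_mem_ne_zero_of_ne_bot ha.1
  have h1 := Submodule.projectionOnto_apply_left hq ⟨⟨v, haS hv⟩, hv⟩
  have h2 := LinearMap.congr_fun h0 ⟨v, haS hv⟩
  rw [LinearMap.comp_apply, LinearMap.comp_apply, h1] at h2
  exact hv0 h2

section Connection

variable {K k : Type*} [Field K] [Field k] [Algebra K k] (δ : Derivation K k k)

theorem linearIndependent_of_constants
    (hδ : ∀ a, δ a = 0 → ∃ c : K, algebraMap K k c = a)
    {M ι : Type*} [AddCommGroup M] [Module k M] [Module K M]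
    [IsScalarTower K k M] (v : ι → M)
    (hv : ∀ (s : Finset ι) (a : ι → k), ∑ i ∈ s, a i • v i = 0 → ∑ i ∈ s, δ (a i) • v i = 0)
    (hli : LinearIndependent K v) : LinearIndependent k v := by
  classical
  rw [linearIndependent_iff'] at hli ⊢
  intro s
  suffices H : ∀ (n : ℕ) (a : ι → k), (s.filter fun i => a i ≠ 0).card = n →
      ∑ i ∈ s, a i • v i = 0 → ∀ i ∈ s, a i = 0 from fun a => H _ a rfl
  intro n
  induction n using Nat.strong_induction_on with
  | _ n ih =>
    intro a hn ha j hj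
    by_contra hne
    have hb : ∑ i ∈ s, ((a j)⁻¹ * a i) • v i = 0 := by
      simp_rw [mul_smul, ← Finset.smul_sum, ha, smul_zero]
    have hzero := ih _ ?_ (fun i => δ ((a j)⁻¹ * a i)) rfl (hv s _ hb)
    · have : ∀ i, ∃ c : K, i ∈ s → algebraMap K k c = (a j)⁻¹ * a i := by
        intro i
        by_cases hi : i ∈ s
        · obtain ⟨c, hc⟩ := hδ _ (hzero i hi)
          exact ⟨c, fun _ => hc⟩
        · exact ⟨0, fun h => absurd h hi⟩
      choose c hc using this
      have h0 := hli s c (by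
        rw [← hb]
        exact Finset.sum_congr rfl fun i hi => by rw [← hc i hi, algebraMap_smul]) j hj
      have := hc j hj
      rw [h0, map_zero, inv_mul_cancel₀ hne] at this
      exact zero_ne_one this
    · rw [← hn]
      refine Finset.card_lt_card (Finset.ssubset_iff_of_subset ?_ |>.2 ⟨j, ?_, ?_⟩)
      · intro i hi
        rw [Finset.mem_filter] at hi ⊢
        refine ⟨hi.1, fun h => hi.2 ?_⟩
        rw [h, mul_zero, map_zero]
      · simp [hj, hne]
      · intro h
        refine (Finset.mem_filter.1 h).2 ?_
        rw [inv_mul_cancel₀ hne, Derivation.map_one_eq_zero]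

variable {S V : Type*} [AddCommGroup S] [Module k S] [Module K S]
  [AddCommGroup V] [Module k V] [Module K V] [IsScalarTower K k V]

/-- The `k`-linear maps commuting with two connections. -/
def horizontalHom (d : S →ₗ[K] S) (d' : V →ₗ[K] V) : Submodule K (S →ₗ[k] V) where
  carrier := {φ | ∀ s, d' (φ s) = φ (d s)}
  zero_mem' := by simp
  add_mem' h h' s := by simp [h s, h' s]
  smul_mem' c φ h s := by simp [h s]

theorem finite_horizontalHom [FiniteDimensional k S] [FiniteDimensional k V]
    (hδ : ∀ a, δ a = 0 → ∃ c : K, algebraMap K k c = a)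
    (d : S →ₗ[K] S) (d' : V →ₗ[K] V) (hd' : ∀ (a : k) v, d' (a • v) = δ a • v + a • d' v) :
    FiniteDimensional K (horizontalHom (k := k) d d') := by
  let b := Module.Basis.ofVectorSpace K (horizontalHom (k := k) d d')
  have hli : LinearIndependent K fun i => (b i : S →ₗ[k] V) :=
    b.linearIndependent.map' (horizontalHom (k := k) d d').subtype (Submodule.ker_subtype _)
  have hlik : LinearIndependent k fun i => (b i : S →ₗ[k] V) := by
    refine linearIndependent_of_constants δ hδ _ (fun s a h => ?_) hli
    ext x
    have h1 : ∑ i ∈ s, a i • (b i : S →ₗ[k] V) x = 0 := by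
      simpa using congrArg (fun φ : S →ₗ[k] V => φ x) h
    have h2 : ∑ i ∈ s, a i • (b i : S →ₗ[k] V) (d x) = 0 := by
      simpa using congrArg (fun φ : S →ₗ[k] V => φ (d x)) h
    have h3 := congrArg d' h1
    simp_rw [map_sum, map_zero, hd', Finset.sum_add_distrib, (b _).2 x, h2, add_zero] at h3
    simpa using h3
  have := hlik.finite
  exact Module.Finite.of_basis b

/-- Over a differential field, finitely many constants suffice to meet every stable subspace of a
vector space with connection. -/
theorem exists_finite_meets_stable [FiniteDimensional k V]
    (hδ : ∀ a, δ a = 0 → ∃ c : K, algebraMap K k c = a)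
    (d : V →ₗ[K] V)
    (hd : ∀ (a : k) v, d (a • v) = δ a • v + a • d v) :
    ∃ U : Submodule K V, FiniteDimensional K U ∧ ∀ W : Submodule k V, W ≠ ⊥ →
      (∀ w ∈ W, d w ∈ W) → ∃ u ∈ U, u ∈ W ∧ u ≠ 0 := by
  let A : Subalgebra K (Module.End K V) :=
    Algebra.adjoin K (insert d (Set.range fun a : k => DistribSMul.toLinearMap K V a))
  let dA : A := ⟨d, Algebra.subset_adjoin (Set.mem_insert _ _)⟩
  let mA : k → A := fun a => ⟨DistribSMul.toLinearMap K V a,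
    Algebra.subset_adjoin (Set.mem_insert_of_mem _ ⟨a, rfl⟩)⟩
  have hdA : ∀ v : V, dA • v = d v := fun v => rfl
  have hmA : ∀ a (v : V), mA a • v = a • v := fun a v => rfl
  let toK : Submodule A V → Submodule k V := fun W =>
    { W with smul_mem' := fun a v hv => W.smul_mem (mA a) hv }
  have htoK : ∀ W v, v ∈ toK W ↔ v ∈ W := fun W v => Iff.rfl
  have hstable : ∀ W : Submodule k V, (∀ w ∈ W, d w ∈ W) → ∃ W' : Submodule A V, toK W' = W := by
    intro W hW
    have key : ∀ a ∈ A, ∀ v ∈ W, a v ∈ W := by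
      intro a ha
      induction ha using Algebra.adjoin_induction with
      | mem x hx =>
        rcases hx with rfl | ⟨c, rfl⟩
        · exact hW
        · exact fun v hv => W.smul_mem c hv
      | algebraMap c => exact fun v hv => (W.restrictScalars K).smul_mem c hv
      | add x y _ _ hx hy => exact fun v hv => W.add_mem (hx v hv) (hy v hv)
      | mul x y _ _ hx hy => exact fun v hv => hx _ (hy v hv)
    exact ⟨{ W with smul_mem' := fun a v hv => key a a.2 v hv }, by ext; rfl⟩
  have hmono : StrictMono toK := by
    intro W W' h
    obtain ⟨h1, v, h2, h3⟩ := SetLike.lt_iff_le_and_exists.1 h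
    exact SetLike.lt_iff_le_and_exists.2 ⟨h1, v, h2, h3⟩
  have hart : IsArtinian A V := hmono.wellFoundedLT
  obtain ⟨Soc, hSoc⟩ := exists_submodule_maps_into A (V := V)
  let dS : toK Soc →ₗ[K] toK Soc := (d.restrict (p := (toK Soc).restrictScalars K)
    (q := (toK Soc).restrictScalars K) fun v hv => Soc.smul_mem dA hv)
  have hfin := finite_horizontalHom δ hδ dS d hd
  let b := Module.finBasis k (toK Soc)
  refine ⟨⨆ j, (horizontalHom (k := k) dS d).map
    ((LinearMap.applyₗ' K (b j)) : (toK Soc →ₗ[k] V) →ₗ[K] V), inferInstance, ?_⟩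
  intro W hW0 hW
  obtain ⟨W', rfl⟩ := hstable W hW
  obtain ⟨φ, hφ0, hφ⟩ := hSoc W' (by
    rintro rfl
    exact hW0 (by ext; rfl))
  let ψ : toK Soc →ₗ[k] V :=
    { toFun := fun s => φ s
      map_add' := fun s t => φ.map_add s t
      map_smul' := fun c s => φ.map_smul (mA c) s }
  have hψ : ψ ∈ horizontalHom (k := k) dS d := fun s => (φ.map_smul dA s).symm
  obtain ⟨j, hj⟩ : ∃ j, ψ (b j) ≠ 0 := by
    by_contra! h
    have h0 : ψ = 0 := b.ext h
    exact hφ0 (LinearMap.ext fun s => LinearMap.congr_fun h0 s)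
  exact ⟨ψ (b j), Submodule.mem_iSup_of_mem j ⟨ψ, hψ, rfl⟩, hφ _, hj⟩

end Connection

theorem Matrix.exists_submatrix_det_ne_zero {k : Type*} [Field k] {l r : ℕ}
    (M : Matrix (Fin l) (Fin r) k) (h : LinearIndependent k M.row) :
    ∃ c : Fin l → Fin r, (M.submatrix _root_.id c).det ≠ 0 := by
  have hrank : Module.finrank k (Submodule.span k (Set.range M.col)) = l := by
    rw [← Matrix.rank_eq_finrank_span_cols, h.rank_matrix, Fintype.card_fin]
  obtain ⟨f, hf, -, hli⟩ := Submodule.exists_fun_fin_finrank_span_eq k (Set.range M.col)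
  choose c hc using hf
  let e := finCongr hrank.symm
  refine ⟨fun i => c (e i), ?_⟩
  have h1 : LinearIndependent k (M.submatrix _root_.id fun i => c (e i)).col := by
    have : (M.submatrix _root_.id fun i => c (e i)).col = f ∘ e := by
      funext i
      exact hc (e i)
    rw [this]
    exact hli.comp e e.injective
  exact ((Matrix.isUnit_iff_isUnit_det _).1
    (Matrix.linearIndependent_cols_iff_isUnit.1 h1)).ne_zero

theorem natDegree_det_le {K : Type*} [Field K] {l : ℕ} (M : Matrix (Fin l) (Fin l) K[X]) (c : ℕ)
    (h : ∀ i j, (M i j).natDegree ≤ c) : M.det.natDegree ≤ l * c := by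
  rw [Matrix.det_apply]
  refine natDegree_sum_le_of_forall_le _ _ fun σ _ => ?_
  refine (natDegree_smul_le _ _).trans ((natDegree_prod_le _ _).trans ?_)
  refine (Finset.sum_le_card_nsmul _ _ c fun i _ => h _ _).trans ?_
  simp

theorem exists_linearIndependent_mem_span {k V : Type*} [Field k] [AddCommGroup V] [Module k V]
    [FiniteDimensional k V] (v : ℕ → V) : ∃ l, LinearIndependent k (fun i : Fin l => v i) ∧
      v l ∈ Submodule.span k (Set.range fun i : Fin l => v i) := by
  by_contra! h
  have : ∀ l, LinearIndependent k (fun i : Fin l => v i) := by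
    intro l
    induction l with
    | zero => exact linearIndependent_empty_type
    | succ l ih =>
      rw [linearIndependent_finSucc']
      exact ⟨ih, h l ih⟩
  have := (this (Module.finrank k V + 1)).fintype_card_le_finrank
  simp at this

section Connection

variable {K : Type*} [Field K] {r : ℕ} (T : K[X]) (B : Matrix (Fin r) (Fin r) K[X])

/-- The action of `T d/dz` on coordinates, for the system with matrix `B / T`. -/
def coordD (P : Fin r → K[X]) : Fin r → K[X] :=
  fun j => T * derivative (P j) + ∑ i, P i * B i j

theorem exists_natDegree_coordD_le : ∃ c, ∀ N (P : Fin r → K[X]), (∀ i, (P i).natDegree ≤ N) →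
    ∀ i, (coordD T B P i).natDegree ≤ N + c := by
  refine ⟨T.natDegree + ∑ i, ∑ j, (B i j).natDegree, fun N P hP j => ?_⟩
  refine natDegree_add_le_of_degree_le ?_ (natDegree_sum_le_of_forall_le _ _ fun i _ => ?_)
  · refine natDegree_mul_le.trans ?_
    have := natDegree_derivative_le (P j)
    have := hP j
    omega
  · refine natDegree_mul_le.trans ?_
    have h1 : (B i j).natDegree ≤ ∑ j, (B i j).natDegree :=
      Finset.single_le_sum (f := fun j => (B i j).natDegree) (fun _ _ => Nat.zero_le _)
        (Finset.mem_univ j)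
    have h2 : ∑ j, (B i j).natDegree ≤ ∑ i, ∑ j, (B i j).natDegree :=
      Finset.single_le_sum (f := fun i => ∑ j, (B i j).natDegree) (fun _ _ => Nat.zero_le _)
        (Finset.mem_univ i)
    have := hP i
    omega

theorem exists_natDegree_iterate_coordD_le : ∃ c, ∀ N (P : Fin r → K[X]),
    (∀ i, (P i).natDegree ≤ N) → ∀ k i, ((coordD T B)^[k] P i).natDegree ≤ N + k * c := by
  obtain ⟨c, hc⟩ := exists_natDegree_coordD_le T B
  refine ⟨c, fun N P hP k => ?_⟩
  induction k with
  | zero => simpa using hP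
  | succ k ih =>
    rw [Function.iterate_succ_apply', add_mul, one_mul, ← add_assoc]
    exact hc _ _ ih

theorem exists_bounded_multiple [CharZero K] (hT : T ≠ 0) :
    ∃ U : Submodule K (Fin r → K[X]), FiniteDimensional K U ∧ ∃ c, ∀ N (P : Fin r → K[X]),
      P ≠ 0 → (∀ i, (P i).natDegree ≤ N) → ∃ Δ : K[X], Δ ≠ 0 ∧ Δ.natDegree ≤ c * (N + 1) ∧
        ∃ Q ∈ U, Q ≠ 0 ∧ ∃ l ≤ r, ∃ e : Fin l → K[X],
          Δ • Q = ∑ i, e i • (coordD T B)^[i] P := by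
  let k := FractionRing K[X]
  obtain ⟨δ, hδ⟩ := exists_derivation_extending (K := K) k
  have hinj : Function.Injective (algebraMap K[X] k) := IsFractionRing.injective K[X] k
  let emb : (Fin r → K[X]) →ₗ[K[X]] (Fin r → k) := LinearMap.compLeft (Algebra.linearMap K[X] k) _
  have hemb : ∀ P i, emb P i = algebraMap K[X] k (P i) := fun _ _ => rfl
  have hembi : Function.Injective emb := fun P Q h => funext fun i => hinj (congrFun h i)
  have hτ : algebraMap K[X] k T ≠ 0 := fun h => hT ((map_eq_zero_iff _ hinj).1 h)
  let d : (Fin r → k) →ₗ[K] (Fin r → k) :=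
    LinearMap.pi fun j => δ.toLinearMap ∘ₗ LinearMap.proj j +
      ∑ i, LinearMap.mulLeft K ((algebraMap K[X] k T)⁻¹ * algebraMap K[X] k (B i j)) ∘ₗ
        LinearMap.proj i
  have hd : ∀ v j, d v j = δ (v j) +
      ∑ i, (algebraMap K[X] k T)⁻¹ * algebraMap K[X] k (B i j) * v i := by
    intro v j
    simp [d, mul_assoc]
  have hdemb : ∀ P, d (emb P) = (algebraMap K[X] k T)⁻¹ • emb (coordD T B P) := by
    intro P
    ext j
    rw [hd, Pi.smul_apply, smul_eq_mul, hemb, hemb, hδ, coordD, map_add, map_mul, mul_add,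
      inv_mul_cancel_left₀ hτ, map_sum, Finset.mul_sum]
    simp only [map_mul, hemb]
    congr 1
    exact Finset.sum_congr rfl fun i _ => by ring
  have hdl : ∀ (a : k) v, d (a • v) = δ a • v + a • d v := by
    intro a v
    ext j
    simp only [hd, Pi.add_apply, Pi.smul_apply, smul_eq_mul, Derivation.leibniz, mul_add]
    rw [add_comm (a * δ _), add_assoc, mul_comm, Finset.mul_sum]
    congr 2
    exact Finset.sum_congr rfl fun i _ => by ring
  have hembK : ∀ (a : K) P, emb (a • P) = a • emb P := fun a P => funext fun i =>
    map_smul (IsScalarTower.toAlgHom K K[X] k) a (P i)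
  obtain ⟨U, hU, hUW⟩ := exists_finite_meets_stable δ
    (fun a ha => mem_range_of_derivation_eq_zero δ hδ ha) d hdl
  let b := Module.finBasis K U
  obtain ⟨⟨q, hq⟩, hqb⟩ := IsLocalization.exist_integer_multiples_of_finite (nonZeroDivisors K[X])
    (fun p : Fin (Module.finrank K U) × Fin r => (b p.1 : Fin r → k) p.2)
  choose Q hQ using hqb
  have hq0 : q ≠ 0 := nonZeroDivisors.ne_zero hq
  let Q' : Fin (Module.finrank K U) → Fin r → K[X] := fun j i => Q (j, i)
  have hQ' : ∀ j, emb (Q' j) = q • (b j : Fin r → k) := fun j => funext fun i => hQ (j, i)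
  obtain ⟨c, hc⟩ := exists_natDegree_iterate_coordD_le T B
  refine ⟨Submodule.span K (Set.range Q'), FiniteDimensional.span_of_finite K (Set.finite_range _),
    r * (1 + r * c), fun N P hP hPN => ?_⟩
  obtain ⟨l, hli, hl⟩ := exists_linearIndependent_mem_span (k := k)
    (fun i => emb ((coordD T B)^[i] P))
  have hlr : l ≤ r := by simpa using hli.fintype_card_le_finrank
  let W := Submodule.span k (Set.range fun i : Fin l => emb ((coordD T B)^[i] P))
  have hW : ∀ w ∈ W, d w ∈ W := by
    intro w hw
    induction hw using Submodule.span_induction with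
    | mem x hx =>
      obtain ⟨i, rfl⟩ := hx
      dsimp only
      rw [hdemb, ← Function.iterate_succ_apply' (coordD T B)]
      refine W.smul_mem _ ?_
      rcases (Nat.succ_le_of_lt i.2).eq_or_lt with h | h
      · rw [h]
        exact hl
      · exact Submodule.subset_span ⟨⟨_, h⟩, rfl⟩
    | zero => rw [map_zero]; exact W.zero_mem
    | add x y _ _ hx hy => rw [map_add]; exact W.add_mem hx hy
    | smul a x hx h =>
      rw [hdl]
      exact W.add_mem (W.smul_mem _ hx) (W.smul_mem _ h)
  obtain ⟨u, hu, huW, hu0⟩ := hUW W (by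
    intro h0
    have hPW : emb P ∈ W := by
      rcases Nat.eq_zero_or_pos l with rfl | h
      · exact hl
      · exact Submodule.subset_span ⟨⟨0, h⟩, rfl⟩
    rw [h0, Submodule.mem_bot] at hPW
    exact hP (hembi (hPW.trans (map_zero emb).symm))) hW
  obtain ⟨s, hs⟩ : ∃ s : Fin l → k, ∑ i, s i • emb ((coordD T B)^[i] P) = u :=
    Submodule.mem_span_range_iff_exists_fun k |>.1 huW
  obtain ⟨Qu, hQu, hQuu⟩ : ∃ Qu ∈ Submodule.span K (Set.range Q'), emb Qu = q • u := by
    refine ⟨∑ j, b.repr ⟨u, hu⟩ j • Q' j, Submodule.sum_mem _ fun j _ =>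
      Submodule.smul_mem _ _ (Submodule.subset_span ⟨j, rfl⟩), ?_⟩
    have h1 : ∑ j, b.repr ⟨u, hu⟩ j • (b j : Fin r → k) = u := by
      have := congrArg U.subtype (b.sum_repr ⟨u, hu⟩)
      rw [map_sum] at this
      exact this
    rw [map_sum]
    refine Eq.trans ?_ (congrArg (q • ·) h1)
    rw [Finset.smul_sum]
    refine Finset.sum_congr rfl fun j _ => ?_
    rw [hembK, hQ', smul_comm]
  let M : Matrix (Fin l) (Fin r) K[X] := fun i j => (coordD T B)^[i] P j
  obtain ⟨col, hcol⟩ := Matrix.exists_submatrix_det_ne_zero (M.map (algebraMap K[X] k)) hli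
  let M' := M.submatrix _root_.id col
  have hdet : algebraMap K[X] k M'.det ≠ 0 := by
    rw [RingHom.map_det]
    exact hcol
  have hs' : ∀ j, algebraMap K[X] k (Qu j) =
      ∑ i, (algebraMap K[X] k q * s i) * algebraMap K[X] k (M i j) := by
    intro j
    have := congrFun hQuu j
    rw [← hs] at this
    rw [← hemb, this, Pi.smul_apply, Finset.sum_apply, Algebra.smul_def, Finset.mul_sum]
    exact Finset.sum_congr rfl fun i _ => (mul_assoc _ _ _).symm
  have he : ∀ i, algebraMap K[X] k (Matrix.vecMul (Qu ∘ col) M'.adjugate i) =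
      algebraMap K[X] k M'.det * (algebraMap K[X] k q * s i) := by
    intro i
    have h1 : algebraMap K[X] k ∘ (Qu ∘ col) =
        Matrix.vecMul (fun i => algebraMap K[X] k q * s i) (M'.map (algebraMap K[X] k)) :=
      funext fun j => hs' (col j)
    rw [RingHom.map_vecMul, h1, Matrix.vecMul_vecMul, ← Matrix.map_mul, Matrix.mul_adjugate,
      Matrix.map_smul' _ _ _ (map_mul _), Matrix.map_one _ (map_zero _) (map_one _),
      Matrix.vecMul_smul, Matrix.vecMul_one]
    rfl
  refine ⟨M'.det, fun h => hdet (by rw [h, map_zero]), ?_, Qu, hQu, ?_, l, hlr,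
    Matrix.vecMul (Qu ∘ col) M'.adjugate, ?_⟩
  · refine (natDegree_det_le M' (N + r * c) fun i j => (hc N P hPN i _).trans ?_).trans ?_
    · have : (i : ℕ) * c ≤ r * c := Nat.mul_le_mul_right _ (by omega)
      omega
    · nlinarith [Nat.mul_le_mul_right (N + r * c) hlr, Nat.zero_le (r * (r * c * N))]
  · rintro rfl
    refine hu0 (funext fun j => ?_)
    have := congrFun hQuu j
    rw [map_zero, Pi.smul_apply, Algebra.smul_def] at this
    exact (mul_eq_zero.1 this.symm).resolve_left fun h => hq0 ((map_eq_zero_iff _ hinj).1 h)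
  · funext j
    apply hinj
    rw [Pi.smul_apply, smul_eq_mul, map_mul, hs', Finset.mul_sum, Finset.sum_apply, map_sum]
    refine Finset.sum_congr rfl fun i _ => ?_
    rw [Pi.smul_apply, smul_eq_mul, map_mul, he, mul_assoc, mul_assoc, mul_assoc]

end Connection

section ZeroEstimate

variable {K L : Type*} [Field K] [Field L] [Algebra K L] {r : ℕ}

/-- A polynomial over `K` seen as a power series over `L`. -/
def polySeries (K L : Type*) [Field K] [Field L] [Algebra K L] : K[X] →+* PowerSeries L :=
  (PowerSeries.map (algebraMap K L)).comp (Polynomial.coeToPowerSeries.ringHom)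

theorem polySeries_apply (p : K[X]) :
    polySeries K L p = PowerSeries.map (algebraMap K L) (p : PowerSeries K) := rfl

theorem coeff_polySeries (p : K[X]) (n : ℕ) :
    PowerSeries.coeff n (polySeries K L p) = algebraMap K L (p.coeff n) := by
  simp [polySeries_apply]

theorem derivative_polySeries (p : K[X]) :
    PowerSeries.derivative L (polySeries K L p) = polySeries K L (derivative p) := by
  ext n
  simp [PowerSeries.coeff_derivative, coeff_polySeries, coeff_derivative]

theorem le_natDegree_of_X_pow_dvd_polySeries {p : K[X]} (hp : p ≠ 0) {m : ℕ}
    (h : PowerSeries.X ^ m ∣ polySeries K L p) : m ≤ p.natDegree := by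
  by_contra! hlt
  have := PowerSeries.X_pow_dvd_iff.1 h _ hlt
  rw [coeff_polySeries, map_eq_zero] at this
  exact hp (leadingCoeff_eq_zero.1 this)

theorem PowerSeries.X_pow_dvd_of_X_pow_dvd_mul {a b : PowerSeries L} {m k : ℕ}
    (h : PowerSeries.X ^ m ∣ a * b) (hk : ¬ PowerSeries.X ^ (k + 1) ∣ a) :
    PowerSeries.X ^ (m - k) ∣ b := by
  rw [pow_dvd_iff_le_emultiplicity, ← PowerSeries.order_eq_emultiplicity_X] at h hk ⊢
  rw [PowerSeries.order_mul] at h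
  have hk' : a.order ≤ k := by
    have : a.order < ((k + 1 : ℕ) : ℕ∞) := not_le.1 hk
    exact Order.le_of_lt_add_one (by exact_mod_cast this)
  have h2 : (m : ℕ∞) ≤ k + b.order := h.trans (add_le_add_left hk' _)
  rcases eq_or_ne b.order ⊤ with hb | hb
  · rw [hb]; exact le_top
  · lift b.order to ℕ using hb with x
    have : m ≤ k + x := by exact_mod_cast h2
    exact_mod_cast (by omega : m - k ≤ x)

/-- The linear form `∑ Pᵢ Gᵢ` with polynomial coefficients in given power series. -/
def seriesForm (G : Fin r → PowerSeries L) : (Fin r → K[X]) →+ PowerSeries L where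
  toFun P := ∑ i, polySeries K L (P i) * G i
  map_zero' := by simp
  map_add' P Q := by simp [add_mul, Finset.sum_add_distrib]

theorem seriesForm_apply (G : Fin r → PowerSeries L) (P : Fin r → K[X]) :
    seriesForm G P = ∑ i, polySeries K L (P i) * G i := rfl

theorem seriesForm_smul (G : Fin r → PowerSeries L) (a : K[X]) (P : Fin r → K[X]) :
    seriesForm G (a • P) = polySeries K L a * seriesForm G P := by
  simp [seriesForm_apply, Finset.mul_sum, mul_assoc]

theorem exists_not_X_pow_dvd_seriesForm (G : Fin r → PowerSeries L)
    (hG : ∀ P : Fin r → K[X], seriesForm G P = 0 → P = 0)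
    (U : Submodule K (Fin r → K[X])) [FiniteDimensional K U] :
    ∃ c, ∀ Q ∈ U, Q ≠ 0 → ¬ PowerSeries.X ^ c ∣ seriesForm G Q := by
  have hsmul : ∀ (a : K) (Q : Fin r → K[X]),
      seriesForm G (a • Q) = polySeries K L (C a) * seriesForm G Q := fun a Q => by
    rw [← seriesForm_smul]
    congr 1
    funext i
    simp [smul_eq_C_mul]
  let V : ℕ →o (Submodule K U)ᵒᵈ :=
    { toFun := fun m => OrderDual.toDual
        { carrier := {Q | PowerSeries.X ^ m ∣ seriesForm G (Q : Fin r → K[X])}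
          add_mem' := fun {a b} ha hb => by
            simp only [Set.mem_ofPred_eq, Submodule.coe_add, map_add] at *
            exact dvd_add ha hb
          zero_mem' := by simp
          smul_mem' := fun a Q hQ => by
            simp only [Set.mem_ofPred_eq, Submodule.coe_smul] at *
            rw [hsmul]
            exact hQ.mul_left _ }
      monotone' := fun m k hmk Q hQ => (pow_dvd_pow _ hmk).trans hQ }
  obtain ⟨c, hc⟩ := IsArtinian.monotone_stabilizes V
  refine ⟨c, fun Q hQ hQ0 hdvd => hQ0 (hG _ ?_)⟩
  have hmem : ∀ m, c ≤ m → PowerSeries.X ^ m ∣ seriesForm G Q := fun m hm => by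
    have h1 : (⟨Q, hQ⟩ : U) ∈ OrderDual.ofDual (V c) := hdvd
    rw [hc m hm] at h1
    exact h1
  ext m
  rw [map_zero]
  exact PowerSeries.X_pow_dvd_iff.1 (hmem (c + m + 1) (by omega)) m (by omega)

/-- A zero estimate: if the power series `Gᵢ` are linearly independent over polynomials and
form a solution of a linear differential system, then `∑ Pᵢ Gᵢ` with `deg Pᵢ ≤ N` vanishes at
the origin to order at most linear in `N`. -/
theorem exists_zero_estimate [CharZero K] (T : K[X]) (hT : T ≠ 0) (B : Matrix (Fin r) (Fin r) K[X])
    (G : Fin r → PowerSeries L)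
    (hGD : ∀ i, polySeries K L T * PowerSeries.derivative L (G i) =
      ∑ j, polySeries K L (B i j) * G j)
    (hG : ∀ P : Fin r → K[X], seriesForm G P = 0 → P = 0) :
    ∃ c, ∀ N (P : Fin r → K[X]), P ≠ 0 → (∀ i, (P i).natDegree ≤ N) →
      ∀ m, PowerSeries.X ^ m ∣ seriesForm G P → m ≤ c * (N + 1) := by
  obtain ⟨U, hU, c, hc⟩ := exists_bounded_multiple T B hT
  obtain ⟨c₂, hc₂⟩ := exists_not_X_pow_dvd_seriesForm G hG U
  have hD : ∀ P : Fin r → K[X], seriesForm G (coordD T B P) =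
      polySeries K L T * PowerSeries.derivative L (seriesForm G P) := fun P => by
    have h1 : ∀ i, polySeries K L T * PowerSeries.derivative L (polySeries K L (P i) * G i) =
        polySeries K L (T * derivative (P i)) * G i +
          ∑ j, polySeries K L (P i * B i j) * G j := fun i => by
      rw [Derivation.leibniz, derivative_polySeries, smul_eq_mul, smul_eq_mul, mul_add,
        mul_left_comm, hGD, map_mul, Finset.mul_sum, add_comm]
      congr 1
      · ring
      · exact Finset.sum_congr rfl fun j _ => by rw [map_mul, mul_assoc]
    rw [seriesForm_apply, seriesForm_apply, map_sum, Finset.mul_sum, Finset.sum_congr rfl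
      fun i _ => h1 i, Finset.sum_add_distrib, Finset.sum_comm, ← Finset.sum_add_distrib]
    refine Finset.sum_congr rfl fun j _ => ?_
    rw [coordD, map_add, add_mul, map_sum, Finset.sum_mul]
  have hdvd : ∀ (k m : ℕ) (P : Fin r → K[X]), PowerSeries.X ^ m ∣ seriesForm G P →
      PowerSeries.X ^ (m - k) ∣ seriesForm G ((coordD T B)^[k] P) := by
    intro k
    induction k with
    | zero => intro m P h; simpa using h
    | succ k ih =>
      intro m P h
      rw [Function.iterate_succ_apply', hD]
      refine Dvd.dvd.mul_left ?_ _
      rw [PowerSeries.X_pow_dvd_iff]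
      intro n hn
      rw [PowerSeries.coeff_derivative]
      rw [PowerSeries.X_pow_dvd_iff.1 (ih m P h) (n + 1) (by omega), zero_mul]
  refine ⟨r + c + c₂ + 1, fun N P hP hPN m hm => ?_⟩
  obtain ⟨Δ, hΔ, hΔN, Q, hQU, hQ, l, hl, e, he⟩ := hc N P hP hPN
  have h1 : PowerSeries.X ^ (m - r) ∣ polySeries K L Δ * seriesForm G Q := by
    rw [← seriesForm_smul, he, map_sum]
    refine Finset.dvd_sum fun i _ => ?_
    rw [seriesForm_smul]
    exact ((pow_dvd_pow _ (by omega)).trans (hdvd i m P hm)).mul_left _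
  have h2 := PowerSeries.X_pow_dvd_of_X_pow_dvd_mul h1 (k := Δ.natDegree)
    fun h => absurd (le_natDegree_of_X_pow_dvd_polySeries hΔ h) (by omega)
  have h3 : m - r - Δ.natDegree < c₂ := by
    by_contra! hle
    exact hc₂ Q hQU hQ ((pow_dvd_pow _ hle).trans h2)
  nlinarith [Nat.zero_le ((r + c₂) * N), Nat.sub_le_iff_le_add.1 (le_refl (m - r)),
    Nat.sub_le_iff_le_add.1 (le_refl (m - r - Δ.natDegree))]

end ZeroEstimate

section House

open NumberField

variable {K : Type*} [Field K] [NumberField K]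

theorem house_zero : house (0 : K) = 0 := by simp [house]

theorem house_one : house (1 : K) = 1 := by
  simpa using house_intCast (K := K) 1

theorem one_le_norm_mul_house_pow {x : K} (hx : IsIntegral ℤ x) (hx0 : x ≠ 0) (σ : K →+* ℂ) :
    1 ≤ ‖σ x‖ * house x ^ (Module.finrank ℚ K - 1) := by
  refine le_trans ?_ (norm_norm_le_norm_mul_house_pow x σ)
  obtain ⟨z, hz⟩ := IsIntegrallyClosed.isIntegral_iff.1 (Algebra.isIntegral_norm ℚ hx)
  rw [← hz]
  have hz0 : z ≠ 0 := by
    rintro rfl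
    rw [map_zero, eq_comm, Algebra.norm_eq_zero_iff] at hz
    exact hx0 hz
  rw [eq_intCast, Int.norm_cast_rat]
  rw [Int.norm_eq_abs]
  exact_mod_cast Int.one_le_abs hz0

theorem exists_common_denominator (s : Finset K) :
    ∃ δ : ℕ, δ ≠ 0 ∧ ∀ x ∈ s, IsIntegral ℤ ((δ : K) * x) := by
  obtain ⟨y, hy0, hy⟩ := exists_integral_multiples ℤ ℚ s
  refine ⟨y.natAbs, Int.natAbs_ne_zero.2 hy0, fun x hx => ?_⟩
  have h := hy x hx
  rw [zsmul_eq_mul] at h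
  have hcast : (y : K) * (y.sign : K) = (y.natAbs : K) := by
    have : ((y.natAbs : ℤ) : K) = ((y * y.sign : ℤ) : K) := by rw [Int.mul_sign_self]
    rw [← Int.cast_mul, ← this, Int.cast_natCast]
  have h2 := h.mul (isIntegral_algebraMap (R := ℤ) (A := K) (x := y.sign))
  rwa [eq_intCast, mul_right_comm, hcast] at h2

/-- Siegel's lemma in the form in which there are many more unknowns than equations. -/
theorem exists_siegel (K : Type*) [Field K] [NumberField K] (b : ℕ) (hb : 0 < b) :
    ∃ c : ℝ, 1 ≤ c ∧ ∀ {α β : Type} [Fintype α] [Fintype β] (a : Matrix α β (𝓞 K)) (Y : ℝ),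
      1 ≤ Y → 0 < Fintype.card α → (b + 1) * Fintype.card α ≤ Fintype.card β →
      (∀ i j, c * Fintype.card β * house (algebraMap (𝓞 K) K (a i j)) ≤ Y ^ b) →
      ∃ ξ : β → 𝓞 K, ξ ≠ 0 ∧ a.mulVec ξ = 0 ∧ ∀ j, house (algebraMap (𝓞 K) K (ξ j)) ≤ c * Y := by
  classical
  have key : ∃ c : ℝ, ∀ {α β : Type} [Fintype α] [Fintype β] (a : Matrix α β (𝓞 K)) (A : ℝ),
      a ≠ 0 → 0 < Fintype.card α → Fintype.card α < Fintype.card β →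
      (∀ i j, house (algebraMap (𝓞 K) K (a i j)) ≤ A) →
      ∃ ξ : β → 𝓞 K, ξ ≠ 0 ∧ a.mulVec ξ = 0 ∧ ∀ j, house (algebraMap (𝓞 K) K (ξ j)) ≤
        c * (c * Fintype.card β * A) ^
          ((Fintype.card α : ℝ) / ((Fintype.card β : ℝ) - (Fintype.card α : ℝ))) := by
    refine ⟨?c, ?_⟩
    rotate_left
    · intro α β _ _ a A ha h0 hlt hA
      exact house.exists_ne_zero_int_vec_house_le K a ha h0 hlt rfl hA rfl
  obtain ⟨c, hc⟩ := key
  refine ⟨max |c| 1, le_max_right _ _, fun {α β} _ _ a Y hY h0 hle ha => ?_⟩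
  have hq : 0 < Fintype.card β := by nlinarith
  have hm : (0 : ℝ) < max |c| 1 := lt_of_lt_of_le one_pos (le_max_right _ _)
  by_cases ha0 : a = 0
  · obtain ⟨j⟩ := Fintype.card_pos_iff.1 hq
    refine ⟨Pi.single j 1, by simp, by simp only [ha0, Matrix.zero_mulVec], fun i => ?_⟩
    have h1 : (1 : ℝ) ≤ max |c| 1 * Y := one_le_mul_of_one_le_of_one_le (le_max_right _ _) hY
    by_cases hij : i = j
    · subst hij; simpa [house_one] using h1
    · simp [Pi.single_eq_of_ne hij, house_zero]; linarith
  have hq' : (0 : ℝ) < Fintype.card β := by exact_mod_cast hq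
  have hYb : (0 : ℝ) ≤ Y ^ b := by positivity
  obtain ⟨ξ, h1, h2, h3⟩ := hc a (Y ^ b / (max |c| 1 * Fintype.card β)) ha0 h0 (by nlinarith)
    fun i j => by
      rw [le_div_iff₀ (by positivity), mul_comm]
      exact ha i j
  refine ⟨ξ, h1, h2, fun j => (h3 j).trans ?_⟩
  set e : ℝ := (Fintype.card α : ℝ) / ((Fintype.card β : ℝ) - (Fintype.card α : ℝ)) with he
  have hle' : ((b : ℝ) + 1) * Fintype.card α ≤ Fintype.card β := by exact_mod_cast hle
  have h0' : (0 : ℝ) < Fintype.card α := by exact_mod_cast h0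
  have hb' : (0 : ℝ) < b := by exact_mod_cast hb
  have hsub : (0 : ℝ) < (Fintype.card β : ℝ) - Fintype.card α := by nlinarith
  have he0 : 0 ≤ e := by positivity
  have heb : e ≤ 1 / b := by
    rw [he, div_le_div_iff₀ hsub hb']
    nlinarith
  have hYm : (0 : ℝ) ≤ Y ^ b / (max |c| 1 * Fintype.card β) := by positivity
  set t : ℝ := c * Fintype.card β * (Y ^ b / (max |c| 1 * Fintype.card β)) with ht
  have h6 : |t| ≤ Y ^ b := by
    rw [ht, abs_mul, abs_mul, abs_of_nonneg hYm, Nat.abs_cast, mul_div_assoc',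
      div_le_iff₀ (by positivity), mul_comm]
    gcongr
    exact le_max_left _ _
  have h7 : |t| ^ e ≤ Y := by
    calc _ ≤ (Y ^ b) ^ e := Real.rpow_le_rpow (abs_nonneg _) h6 he0
      _ ≤ (Y ^ b) ^ (1 / b : ℝ) := Real.rpow_le_rpow_of_exponent_le (one_le_pow₀ hY) heb
      _ = Y := by
        rw [one_div, Real.pow_rpow_inv_natCast (by positivity) hb.ne']
  calc c * t ^ e ≤ |c| * |t ^ e| := (le_abs_self _).trans (abs_mul _ _).le
    _ ≤ max |c| 1 * Y := mul_le_mul (le_max_left _ _) ((Real.abs_rpow_le_abs_rpow _ _).trans h7)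
      (abs_nonneg _) hm.le

end House

section House

set_option linter.unusedSectionVars false

open NumberField

variable {K : Type*} [Field K] [NumberField K]

/-- The sum of the houses of the coefficients of a polynomial. -/
def polyHouse (p : K[X]) : ℝ := ∑ j ∈ p.support, house (p.coeff j)

theorem polyHouse_nonneg (p : K[X]) : 0 ≤ polyHouse p :=
  Finset.sum_nonneg fun _ _ => house_nonneg _

theorem house_coeff_mul_le (q p : K[X]) {H : ℝ} (hp : ∀ n, house (p.coeff n) ≤ H) (n : ℕ) :
    house ((q * p).coeff n) ≤ polyHouse q * H := by
  have hH : 0 ≤ H := (house_nonneg _).trans (hp 0)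
  rw [coeff_mul, Finset.Nat.sum_antidiagonal_eq_sum_range_succ_mk]
  calc _ ≤ ∑ j ∈ Finset.range n.succ, house (q.coeff j) * H :=
        (house_sum_le_sum_house _ _).trans (Finset.sum_le_sum fun j _ => (house_mul_le _ _).trans
          (mul_le_mul_of_nonneg_left (hp _) (house_nonneg _)))
    _ = (∑ j ∈ Finset.range n.succ, house (q.coeff j)) * H := by rw [Finset.sum_mul]
    _ ≤ _ := by
      refine mul_le_mul_of_nonneg_right ?_ hH
      rw [← Finset.sum_filter_of_ne (p := fun j => j ∈ q.support) fun j _ hj => by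
        rw [mem_support_iff]
        rintro h
        exact hj (by rw [h, house_zero])]
      refine Finset.sum_le_sum_of_subset_of_nonneg (fun j hj => (Finset.mem_filter.1 hj).2)
        fun _ _ _ => house_nonneg _

variable {r : ℕ} (T : K[X]) (B : Matrix (Fin r) (Fin r) K[X])

theorem exists_house_coordD_le : ∃ h : ℝ, 1 ≤ h ∧ ∀ (N : ℕ) (P : Fin r → K[X]) (H : ℝ),
    (∀ i, (P i).natDegree ≤ N) → (∀ i n, house ((P i).coeff n) ≤ H) →
    ∀ i n, house ((coordD T B P i).coeff n) ≤ h * (N + 1) * H := by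
  refine ⟨1 + polyHouse T + ∑ j, ∑ i, polyHouse (B i j), ?_, fun N P H hN hP j n => ?_⟩
  · have := polyHouse_nonneg T
    have : 0 ≤ ∑ j, ∑ i, polyHouse (B i j) :=
      Finset.sum_nonneg fun _ _ => Finset.sum_nonneg fun _ _ => polyHouse_nonneg _
    linarith
  have hH : 0 ≤ H := (house_nonneg _).trans (hP j 0)
  have h1 : ∀ n, house ((derivative (P j)).coeff n) ≤ (N + 1) * H := fun n => by
    rw [coeff_derivative]
    rcases le_or_gt (n + 1) N with hn | hn
    · have : house ((P j).coeff (n + 1) * (n + 1)) = (n + 1) * house ((P j).coeff (n + 1)) := by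
        have := house_nat_mul ((P j).coeff (n + 1)) (n + 1)
        push_cast at this
        rw [mul_comm, this]
      rw [this]
      have hn' : (n : ℝ) + 1 ≤ N := by exact_mod_cast hn
      exact mul_le_mul (by linarith) (hP _ _) (house_nonneg _) (by positivity)
    · rw [coeff_eq_zero_of_natDegree_lt ((hN j).trans_lt hn), zero_mul, house_zero]
      positivity
  rw [coordD, coeff_add, finsetSum_coeff]
  have h2 : house ((T * derivative (P j)).coeff n) ≤ polyHouse T * ((N + 1) * H) :=
    house_coeff_mul_le _ _ h1 n
  have h3 : house (∑ i, (P i * B i j).coeff n) ≤ (∑ i, polyHouse (B i j)) * H := by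
    rw [Finset.sum_mul]
    refine (house_sum_le_sum_house _ _).trans (Finset.sum_le_sum fun i _ => ?_)
    rw [mul_comm]
    exact house_coeff_mul_le _ _ (hP i) n
  have h4 : ∑ i, polyHouse (B i j) ≤ ∑ j, ∑ i, polyHouse (B i j) :=
    Finset.single_le_sum (f := fun j => ∑ i, polyHouse (B i j))
      (fun _ _ => Finset.sum_nonneg fun _ _ => polyHouse_nonneg _) (Finset.mem_univ j)
  have h5 : 0 ≤ ∑ i, polyHouse (B i j) := Finset.sum_nonneg fun _ _ => polyHouse_nonneg _
  have h6 : H ≤ (N + 1) * H := le_mul_of_one_le_left hH (by linarith [Nat.cast_nonneg (α := ℝ) N])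
  calc _ ≤ polyHouse T * ((N + 1) * H) + (∑ i, polyHouse (B i j)) * H :=
        (house_add_le _ _).trans (add_le_add h2 h3)
    _ ≤ polyHouse T * ((N + 1) * H) + (∑ j, ∑ i, polyHouse (B i j)) * ((N + 1) * H) :=
        add_le_add le_rfl (mul_le_mul h4 h6 hH (h5.trans h4))
    _ ≤ _ := by nlinarith [h6, hH]

theorem exists_iterate_coordD_le : ∃ c : ℕ, ∃ h : ℝ, 1 ≤ h ∧ ∀ (N : ℕ) (P : Fin r → K[X]) (H : ℝ),
    (∀ i, (P i).natDegree ≤ N) → (∀ i n, house ((P i).coeff n) ≤ H) →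
    ∀ k i, ((coordD T B)^[k] P i).natDegree ≤ N + k * c ∧
      ∀ n, house (((coordD T B)^[k] P i).coeff n) ≤ (h * (N + k * c + 1)) ^ k * H := by
  obtain ⟨c, hc⟩ := exists_natDegree_coordD_le T B
  obtain ⟨h, h1, hh⟩ := exists_house_coordD_le T B
  refine ⟨c, h, h1, fun N P H hN hP k => ?_⟩
  have hdeg : ∀ k i, ((coordD T B)^[k] P i).natDegree ≤ N + k * c := by
    intro k
    induction k with
    | zero => simpa using hN
    | succ k ih =>
      intro i
      rw [Function.iterate_succ_apply']
      refine (hc _ _ ih i).trans (by rw [Nat.succ_mul]; omega)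
  refine fun i => ⟨hdeg k i, fun n => ?_⟩
  have hH : 0 ≤ H := (house_nonneg _).trans (hP i 0)
  induction k generalizing i n with
  | zero => simpa using hP i n
  | succ k ih =>
    rw [Function.iterate_succ_apply']
    refine (hh _ _ _ (hdeg k) ih i n).trans ?_
    rw [← mul_assoc, pow_succ']
    refine mul_le_mul_of_nonneg_right (mul_le_mul ?_ ?_ (by positivity) (by positivity)) hH
    · gcongr
      push_cast
      nlinarith [Nat.cast_nonneg (α := ℝ) c]
    · gcongr
      linarith

theorem isIntegral_coeff_mul {p q : K[X]} (hp : ∀ n, IsIntegral ℤ (p.coeff n))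
    (hq : ∀ n, IsIntegral ℤ (q.coeff n)) (n : ℕ) : IsIntegral ℤ ((p * q).coeff n) := by
  rw [coeff_mul]
  exact IsIntegral.sum _ fun _ _ => (hp _).mul (hq _)

theorem isIntegral_coeff_iterate_coordD (hT : ∀ n, IsIntegral ℤ (T.coeff n))
    (hB : ∀ i j n, IsIntegral ℤ ((B i j).coeff n)) {P : Fin r → K[X]}
    (hP : ∀ i n, IsIntegral ℤ ((P i).coeff n)) (k : ℕ) :
    ∀ i n, IsIntegral ℤ (((coordD T B)^[k] P i).coeff n) := by
  induction k with
  | zero => simpa using hP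
  | succ k ih =>
    intro i n
    rw [Function.iterate_succ_apply', coordD, coeff_add, finsetSum_coeff]
    refine (isIntegral_coeff_mul hT (fun n => ?_) n).add
      (IsIntegral.sum _ fun j _ => isIntegral_coeff_mul (ih j) (hB j i) n)
    rw [coeff_derivative]
    exact (ih i _).mul (by exact_mod_cast isIntegral_natCast (R := ℤ) (B := K) (n + 1))

theorem house_eval_le {p : K[X]} {N : ℕ} {H : ℝ} (hN : p.natDegree ≤ N)
    (hH : ∀ n, house (p.coeff n) ≤ H) (a : K) {A : ℝ} (h1 : 1 ≤ A) (hA : house a ≤ A) :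
    house (p.eval a) ≤ (N + 1) * (H * A ^ N) := by
  have h0 : 0 ≤ H := (house_nonneg _).trans (hH 0)
  rw [eval_eq_sum_range' (Nat.lt_succ_of_le hN)]
  refine (house_sum_le_sum_house _ _).trans ((Finset.sum_le_card_nsmul _ _ (H * A ^ N) ?_).trans ?_)
  · intro j hj
    refine (house_mul_le _ _).trans (mul_le_mul (hH _) ?_ (house_nonneg _) h0)
    refine (house_pow_le _ _).trans ((pow_le_pow_left₀ (house_nonneg _) hA _).trans
      (pow_le_pow_right₀ h1 (Nat.lt_succ_iff.1 (Finset.mem_range.1 hj))))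
  · simp

theorem isIntegral_pow_mul_eval {p : K[X]} {N : ℕ} (hN : p.natDegree ≤ N)
    (hp : ∀ n, IsIntegral ℤ (p.coeff n)) {a : K} {δ : ℕ} (ha : IsIntegral ℤ ((δ : K) * a)) :
    IsIntegral ℤ ((δ : K) ^ N * p.eval a) := by
  rw [eval_eq_sum_range' (Nat.lt_succ_of_le hN), Finset.mul_sum]
  refine IsIntegral.sum _ fun j hj => ?_
  have hj' : j ≤ N := Nat.lt_succ_iff.1 (Finset.mem_range.1 hj)
  have : (δ : K) ^ N * (p.coeff j * a ^ j) = p.coeff j * (δ : K) ^ (N - j) * (δ * a) ^ j := by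
    rw [mul_pow]
    nth_rewrite 1 [← Nat.sub_add_cancel hj']
    rw [pow_add]
    ring
  rw [this]
  exact ((hp j).mul ((isIntegral_natCast (R := ℤ) (B := K) δ).pow _)).mul (ha.pow j)

end House

section ESequence

open NumberField

variable {K : Type*} [Field K] [NumberField K]

/-- Sequences in a number field whose houses and common denominators grow at most
geometrically. -/
def IsESequence (a : ℕ → K) : Prop :=
  (∃ C : ℝ, 1 ≤ C ∧ ∀ n, house (a n) ≤ C ^ (n + 1)) ∧
  ∃ D : ℝ, 1 ≤ D ∧ ∃ d : ℕ → ℕ, ∀ n, d n ≠ 0 ∧ (d n : ℝ) ≤ D ^ (n + 1) ∧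
    ∀ m ≤ n, IsIntegral ℤ ((d n : K) * a m)

theorem IsESequence.add {a b : ℕ → K} (ha : IsESequence a) (hb : IsESequence b) :
    IsESequence fun n => a n + b n := by
  obtain ⟨⟨C, hC, hCa⟩, D, hD, d, hd⟩ := ha
  obtain ⟨⟨C', hC', hCb⟩, D', hD', d', hd'⟩ := hb
  refine ⟨⟨C + C', by linarith, fun n => (house_add_le _ _).trans
    ((add_le_add (hCa n) (hCb n)).trans ?_)⟩, D * D', one_le_mul_of_one_le_of_one_le hD hD',
    fun n => d n * d' n, fun n => ⟨mul_ne_zero (hd n).1 (hd' n).1, ?_, fun m hm => ?_⟩⟩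
  · exact pow_add_pow_le (by linarith) (by linarith) (by omega)
  · push_cast
    rw [mul_pow]
    exact mul_le_mul (hd n).2.1 (hd' n).2.1 (by positivity) (by positivity)
  · have : ((d n * d' n : ℕ) : K) * (a m + b m) =
        (d' n : K) * (d n * a m) + (d n : K) * (d' n * b m) := by push_cast; ring
    rw [this]
    exact ((isIntegral_natCast _).mul ((hd n).2.2 m hm)).add
      ((isIntegral_natCast _).mul ((hd' n).2.2 m hm))

theorem IsESequence.binomialConv {a b : ℕ → K} (ha : IsESequence a) (hb : IsESequence b) :
    IsESequence fun n => ∑ x ∈ Finset.HasAntidiagonal.antidiagonal n, (n.choose x.1 : K) * (a x.1 * b x.2) := by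
  obtain ⟨⟨C, hC, hCa⟩, D, hD, d, hd⟩ := ha
  obtain ⟨⟨C', hC', hCb⟩, D', hD', d', hd'⟩ := hb
  have hCC : 1 ≤ C * C' := one_le_mul_of_one_le_of_one_le hC hC'
  refine ⟨⟨2 * (C * C'), by linarith, fun n => ?_⟩, D * D', one_le_mul_of_one_le_of_one_le hD hD',
    fun n => d n * d' n, fun n => ⟨mul_ne_zero (hd n).1 (hd' n).1, ?_, fun m hm => ?_⟩⟩
  · calc _ ≤ ∑ x ∈ Finset.HasAntidiagonal.antidiagonal n, (n.choose x.1 : ℝ) * (C * C') ^ (n + 1) := by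
          refine (house_sum_le_sum_house _ _).trans (Finset.sum_le_sum fun x hx => ?_)
          have hx' := Finset.HasAntidiagonal.mem_antidiagonal.1 hx
          rw [house_nat_mul]
          refine mul_le_mul_of_nonneg_left ((house_mul_le _ _).trans ?_) (by positivity)
          rw [mul_pow]
          exact mul_le_mul ((hCa _).trans (pow_le_pow_right₀ hC (by omega)))
            ((hCb _).trans (pow_le_pow_right₀ hC' (by omega))) (house_nonneg _) (by positivity)
      _ = 2 ^ n * (C * C') ^ (n + 1) := by
          rw [← Finset.sum_mul, Finset.Nat.sum_antidiagonal_eq_sum_range_succ_mk]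
          congr 1
          exact_mod_cast Nat.sum_range_choose n
      _ ≤ _ := by
          rw [mul_pow 2]
          exact mul_le_mul_of_nonneg_right (pow_le_pow_right₀ (one_le_two (α := ℝ)) n.le_succ) (by positivity)
  · push_cast
    rw [mul_pow]
    exact mul_le_mul (hd n).2.1 (hd' n).2.1 (by positivity) (by positivity)
  · rw [Finset.mul_sum]
    refine IsIntegral.sum _ fun x hx => ?_
    have hx' := Finset.HasAntidiagonal.mem_antidiagonal.1 hx
    have : ((d n * d' n : ℕ) : K) * ((m.choose x.1 : K) * (a x.1 * b x.2)) =
        (m.choose x.1 : K) * ((d n * a x.1) * (d' n * b x.2)) := by push_cast; ring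
    rw [this]
    exact (isIntegral_natCast _).mul (((hd n).2.2 _ (by omega)).mul ((hd' n).2.2 _ (by omega)))

theorem isESequence_coeff (p : K[X]) : IsESequence fun n => (n.factorial : K) * p.coeff n := by
  classical
  obtain ⟨δ, hδ, hδp⟩ := exists_common_denominator (p.support.image p.coeff)
  have hp := polyHouse_nonneg p
  have h1 : (1 : ℝ) ≤ 1 + p.natDegree.factorial * polyHouse p := by
    have : (0 : ℝ) ≤ p.natDegree.factorial * polyHouse p := by positivity
    linarith
  have hδ1 : (1 : ℝ) ≤ δ := by exact_mod_cast Nat.one_le_iff_ne_zero.2 hδ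
  refine ⟨⟨1 + p.natDegree.factorial * polyHouse p, h1, fun n => ?_⟩, δ, hδ1, fun _ => δ,
    fun n => ⟨hδ, ?_, fun m _ => ?_⟩⟩
  · show house ((n.factorial : K) * p.coeff n) ≤ _
    refine le_trans ?_ (le_self_pow₀ h1 (by omega : n + 1 ≠ 0))
    by_cases hn : p.coeff n = 0
    · rw [hn, mul_zero, house_zero]
      linarith
    · rw [house_nat_mul]
      have h2 : (n.factorial : ℝ) ≤ p.natDegree.factorial := by
        exact_mod_cast Nat.factorial_le (le_natDegree_of_ne_zero hn)
      have h3 : house (p.coeff n) ≤ polyHouse p :=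
        Finset.single_le_sum (f := fun j => house (p.coeff j)) (fun _ _ => house_nonneg _)
          (mem_support_iff.2 hn)
      have := mul_le_mul h2 h3 (house_nonneg _) (by positivity)
      linarith
  · exact le_self_pow₀ hδ1 (by omega)
  · by_cases hm : p.coeff m = 0
    · simpa [hm] using isIntegral_zero
    · rw [mul_left_comm]
      exact (isIntegral_natCast _).mul
        (hδp _ (Finset.mem_image_of_mem _ (mem_support_iff.2 hm)))

variable [Algebra K ℂ]

namespace Entire

/-- Entire functions of exponential type whose Taylor coefficients at `0` satisfy the
arithmetic conditions for an E-function with coefficients in the number field `K`. -/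
def IsEType (K : Type*) [Field K] [NumberField K] [Algebra K ℂ] (f : Entire) : Prop :=
  ∃ a : ℕ → K, IsESequence a ∧
    ∀ n, PowerSeries.coeff n (taylor f) = algebraMap K ℂ (a n) / n.factorial

theorem IsEType.add {f g : Entire} (hf : IsEType K f) (hg : IsEType K g) : IsEType K (f + g) := by
  obtain ⟨a, ha, haf⟩ := hf
  obtain ⟨b, hb, hbg⟩ := hg
  refine ⟨_, ha.add hb, fun n => ?_⟩
  rw [map_add, map_add, haf, hbg, map_add, add_div]

theorem IsEType.mul {f g : Entire} (hf : IsEType K f) (hg : IsEType K g) : IsEType K (f * g) := by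
  obtain ⟨a, ha, haf⟩ := hf
  obtain ⟨b, hb, hbg⟩ := hg
  refine ⟨_, ha.binomialConv hb, fun n => ?_⟩
  rw [map_mul, PowerSeries.coeff_mul, map_sum, Finset.sum_div]
  refine Finset.sum_congr rfl fun x hx => ?_
  obtain ⟨i, j⟩ := x
  have hx' : i + j = n := Finset.HasAntidiagonal.mem_antidiagonal.1 hx
  subst hx'
  have h1 : ((i + j).choose i : ℂ) * (i.factorial * j.factorial) = (i + j).factorial := by
    have := Nat.add_choose_mul_factorial_mul_factorial i j
    rw [← mul_assoc, Nat.choose_symm_add]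
    exact_mod_cast this
  have hi : (i.factorial : ℂ) ≠ 0 := by exact_mod_cast i.factorial_ne_zero
  have hj : (j.factorial : ℂ) ≠ 0 := by exact_mod_cast j.factorial_ne_zero
  have hij : ((i + j).factorial : ℂ) ≠ 0 := by exact_mod_cast (i + j).factorial_ne_zero
  simp only [haf, hbg, map_mul, map_natCast]
  rw [div_mul_div_comm, div_eq_div_iff (mul_ne_zero hi hj) hij, ← h1]
  ring

theorem isEType_algebraMap (p : K[X]) : IsEType K (algebraMap K[X] Entire p) := by
  refine ⟨_, isESequence_coeff p, fun n => ?_⟩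
  have hn : (n.factorial : ℂ) ≠ 0 := by exact_mod_cast n.factorial_ne_zero
  rw [taylor_algebraMap, map_mul, map_natCast, mul_div_cancel_left₀ _ hn]
  simp

variable (K) in
/-- The algebra of entire functions satisfying `IsEType`. -/
def eType : Subalgebra K[X] Entire where
  carrier := {f | IsEType K f}
  mul_mem' := IsEType.mul
  add_mem' := IsEType.add
  algebraMap_mem' := isEType_algebraMap

theorem IsEType.exists_norm_le {f : Entire} (hf : IsEType K f) :
    ∃ C : ℝ, 1 ≤ C ∧ ∀ z, ‖f z‖ ≤ C * Real.exp (C * ‖z‖) := by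
  obtain ⟨a, ⟨⟨C, hC, hCa⟩, -⟩, haf⟩ := hf
  refine ⟨C, hC, fun z => ?_⟩
  have h1 := hasSum_taylor f z
  have h2 : HasSum (fun n : ℕ => C * ((C * ‖z‖) ^ n / n.factorial)) (C * Real.exp (C * ‖z‖)) := by
    rw [Real.exp_eq_exp_ℝ]
    exact (NormedSpace.expSeries_div_hasSum_exp (C * ‖z‖)).mul_left C
  refine h1.norm_le_of_bounded h2 fun n => ?_
  have h3 : ‖algebraMap K ℂ (a n)‖ ≤ C ^ (n + 1) :=
    (norm_embedding_le_house (a n) (algebraMap K ℂ)).trans (hCa n)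
  rw [haf, norm_mul, norm_div, norm_pow, Complex.norm_natCast]
  calc _ ≤ C ^ (n + 1) / n.factorial * ‖z‖ ^ n := by gcongr
    _ = _ := by ring

end Entire

end ESequence

namespace Entire

variable {K : Type*} [Field K] [Algebra K ℂ]

theorem exists_eq_X_sub_C_smul {f : Entire} {a : K} (h : f (algebraMap K ℂ a) = 0) :
    ∃ g : Entire, f = (X - C a : K[X]) • g := by
  obtain ⟨g, hg⟩ := exists_eq_mul_of_apply_eq_zero f _ h
  exact ⟨g, ext fun z => by rw [smul_poly_apply, hg]; simp⟩

theorem smul_left_cancel {p : K[X]} (hp : p ≠ 0) {f g : Entire} (h : p • f = p • g) : f = g := by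
  rw [Algebra.smul_def, Algebra.smul_def] at h
  exact mul_left_cancel₀
    ((map_ne_zero_iff _ (algebraMap_poly_injective (K := K))).2 hp) h

theorem apply_eq_zero_of_smul_D_eq [CharZero K] {T : K[X]} {a : K} (hT : T.eval a ≠ 0) {M : ℕ}
    {G H : Entire} (h0 : ((X - C a) ^ M • G) (algebraMap K ℂ a) = 0)
    (h : T • D ((X - C a) ^ M • G) = (X - C a) ^ M • H) : G (algebraMap K ℂ a) = 0 := by
  cases M with
  | zero => simpa using h0
  | succ m =>
    have hX : ((X - C a) ^ m : K[X]) ≠ 0 := pow_ne_zero _ (X_sub_C_ne_zero a)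
    have key : (T * C ((m : K) + 1)) • G + ((X - C a) * T) • D G = (X - C a) • H := by
      refine smul_left_cancel hX ?_
      rw [smul_smul, ← pow_succ, ← h, D_poly_smul, derivative_X_sub_C_pow, smul_add, smul_add,
        smul_smul, smul_smul, smul_smul, smul_smul]
      congr 2
      · push_cast
        simp only [map_add, map_natCast, map_one]
        ring
      · ring
    have h2 := congrArg (fun u : Entire => u (algebraMap K ℂ a)) key
    simp only [smul_poly_apply, Subalgebra.coe_add, Pi.add_apply] at h2
    simp only [map_mul, map_sub, aeval_X, aeval_C, sub_self, zero_mul, add_zero,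
      aeval_algebraMap_apply, coe_aeval_eq_eval] at h2
    refine (mul_eq_zero.1 h2).resolve_left (mul_ne_zero ?_ ?_)
    · exact (_root_.map_ne_zero _).2 hT
    · exact (_root_.map_ne_zero _).2 (by exact_mod_cast m.succ_ne_zero)

theorem exists_eq_X_sub_C_pow_smul [CharZero K] {T : K[X]} {a : K} (hT : T.eval a ≠ 0) (M : ℕ) :
    ∀ R : Entire, (∀ k < M, ((fun f : Entire => T • D f)^[k] R) (algebraMap K ℂ a) = 0) →
      ∃ G : Entire, R = (X - C a : K[X]) ^ M • G := by
  induction M with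
  | zero => exact fun R _ => ⟨R, by simp⟩
  | succ M ih =>
    intro R hR
    obtain ⟨G, hG⟩ := ih R fun k hk => hR k (by omega)
    obtain ⟨H, hH⟩ := ih (T • D R) fun k hk => by
      have := hR (k + 1) (by omega)
      rwa [Function.iterate_succ_apply] at this
    have h0 := hR 0 (by omega)
    rw [Function.iterate_zero_apply, hG] at h0
    rw [hG] at hH
    obtain ⟨G', hG'⟩ := exists_eq_X_sub_C_smul (apply_eq_zero_of_smul_D_eq hT h0 hH)
    exact ⟨G', by rw [hG, hG', smul_smul, pow_succ]⟩

theorem D_iterate_X_sub_C_pow_smul_apply (a : K) (k : ℕ) : ∀ (M : ℕ) (_ : k < M) (G : Entire),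
    (D^[k] ((X - C a : K[X]) ^ M • G)) (algebraMap K ℂ a) = 0 := by
  induction k with
  | zero =>
    intro M hM G
    rw [Function.iterate_zero_apply, smul_poly_apply, map_pow]
    simp [hM.ne']
  | succ k ih =>
    intro M hM G
    obtain ⟨m, rfl⟩ : ∃ m, M = m + 1 := ⟨M - 1, by omega⟩
    have : D ((X - C a : K[X]) ^ (m + 1) • G) =
        (X - C a : K[X]) ^ m • (C ((m : K) + 1) • G + (X - C a : K[X]) • D G) := by
      rw [D_poly_smul, derivative_X_sub_C_pow, smul_add, smul_smul, smul_smul, pow_succ]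
      congr 2
      push_cast
      simp only [map_add, map_natCast, map_one]
      ring
    rw [Function.iterate_succ_apply, this]
    exact ih m (by omega) _

theorem eq_zero_of_forall_X_sub_C_pow_smul {f : Entire} {a : K}
    (h : ∀ M : ℕ, ∃ G : Entire, f = (X - C a : K[X]) ^ M • G) : f = 0 := by
  have hd : ∀ n, iteratedDeriv n f (algebraMap K ℂ a) = 0 := fun n => by
    obtain ⟨G, hG⟩ := h (n + 1)
    rw [← D_iterate_apply, hG]
    exact D_iterate_X_sub_C_pow_smul_apply a n _ n.lt_succ_self G
  refine ext fun z => ?_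
  have h1 := Complex.hasSum_taylorSeries_of_entire f.2 (algebraMap K ℂ a) z
  have h2 : (fun n : ℕ => ((n.factorial : ℂ)⁻¹ • (z - algebraMap K ℂ a) ^ n •
      iteratedDeriv n f.1 (algebraMap K ℂ a))) = fun _ => 0 := by
    funext n
    rw [show iteratedDeriv n f.1 (algebraMap K ℂ a) = 0 from hd n, smul_zero, smul_zero]
  rw [h2] at h1
  exact h1.unique hasSum_zero

section System

variable {r : ℕ} (g : Fin r → Entire) (T : K[X]) (B : Matrix (Fin r) (Fin r) K[X])

theorem smul_D_sum_eq_coordD (hsys : ∀ i, T • D (g i) = ∑ j, B i j • g j) (P : Fin r → K[X]) :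
    T • D (∑ i, P i • g i) = ∑ i, coordD T B P i • g i := by
  rw [smul_D_sum]
  simp only [hsys, coordD, add_smul, Finset.sum_add_distrib, Finset.sum_smul, Finset.smul_sum,
    mul_smul]
  congr 1
  exact Finset.sum_comm

theorem iterate_smul_D_sum (hsys : ∀ i, T • D (g i) = ∑ j, B i j • g j) (P : Fin r → K[X])
    (k : ℕ) : (fun f : Entire => T • D f)^[k] (∑ i, P i • g i) =
      ∑ i, ((coordD T B)^[k] P) i • g i := by
  induction k with
  | zero => rfl
  | succ k ih =>
    rw [Function.iterate_succ_apply', Function.iterate_succ_apply', ih]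
    exact smul_D_sum_eq_coordD g T B hsys _

theorem sum_smul_apply (P : Fin r → K[X]) (z : ℂ) :
    (∑ i, P i • g i : Entire) z = ∑ i, aeval z (P i) * g i z := by
  rw [AddSubmonoidClass.coe_finsetSum, Finset.sum_apply]
  exact Finset.sum_congr rfl fun i _ => smul_poly_apply _ _ _

theorem eq_zero_of_forall_apply_eq_zero [CharZero K] (hsys : ∀ i, T • D (g i) = ∑ j, B i j • g j)
    {a : K} (hT : T.eval a ≠ 0) (h : ∀ i, g i (algebraMap K ℂ a) = 0) (i : Fin r) : g i = 0 := by
  classical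
  have hi : g i = ∑ j, (Pi.single i 1 : Fin r → K[X]) j • g j := by
    rw [Finset.sum_eq_single i] <;> simp +contextual [Pi.single_eq_of_ne]
  refine eq_zero_of_forall_X_sub_C_pow_smul (a := a) fun M =>
    exists_eq_X_sub_C_pow_smul hT M _ fun k _ => ?_
  rw [hi, iterate_smul_D_sum g T B hsys, sum_smul_apply]
  exact Finset.sum_eq_zero fun j _ => by rw [h, mul_zero]

theorem taylor_sum_smul (P : Fin r → K[X]) :
    taylor (∑ i, P i • g i) = seriesForm (fun i => taylor (g i)) P := by
  rw [map_sum, seriesForm_apply]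
  exact Finset.sum_congr rfl fun i _ => by rw [taylor_smul_poly, polySeries_apply]

theorem exists_order_le [CharZero K] (hsys : ∀ i, T • D (g i) = ∑ j, B i j • g j) (hT : T ≠ 0)
    (hli : LinearIndependent K[X] g) :
    ∃ c, ∀ N (P : Fin r → K[X]), P ≠ 0 → (∀ i, (P i).natDegree ≤ N) →
      ∀ m, PowerSeries.X ^ m ∣ taylor (∑ i, P i • g i) → m ≤ c * (N + 1) := by
  obtain ⟨c, hc⟩ := exists_zero_estimate (L := ℂ) T hT B (fun i => taylor (g i)) (fun i => by
    have := congrArg taylor (hsys i)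
    rw [taylor_smul_poly, taylor_D, taylor_sum_smul] at this
    exact this) fun P hP => by
      rw [← taylor_sum_smul, map_eq_zero_iff _ taylor_injective] at hP
      exact funext (Fintype.linearIndependent_iff.1 hli P hP)
  exact ⟨c, fun N P hP hN m hm => hc N P hP hN m (by rwa [← taylor_sum_smul])⟩

end System

/-- An entire function vanishing to order `m` at the origin and `M` at `a ≠ 0` is divisible by the
corresponding polynomial. -/
theorem exists_eq_X_pow_mul_smul [CharZero K] {R : Entire} {a : K} (ha : a ≠ 0) {m M : ℕ}
    (h0 : PowerSeries.X ^ m ∣ taylor R) (h : ∃ G : Entire, R = (X - C a : K[X]) ^ M • G) :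
    ∃ G : Entire, R = (X ^ m * (X - C a : K[X]) ^ M) • G := by
  have h1 : ∃ G : Entire, R = (X - C 0 : K[X]) ^ m • G := by
    refine exists_eq_X_sub_C_pow_smul (T := (1 : K[X])) (by simp) m R fun k hk => ?_
    have : (fun f : Entire => (1 : K[X]) • D f) = D := funext fun f => one_smul _ _
    rw [this, map_zero, D_iterate_apply]
    have h2 := PowerSeries.X_pow_dvd_iff.1 h0 k hk
    rw [coeff_taylor, div_eq_zero_iff] at h2
    exact h2.resolve_right (by exact_mod_cast k.factorial_ne_zero)
  obtain ⟨G₁, hG₁⟩ := h1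
  obtain ⟨G₂, hG₂⟩ := h
  have hcop : IsCoprime (algebraMap K[X] Entire ((X - C 0) ^ m))
      (algebraMap K[X] Entire ((X - C a) ^ M)) :=
    ((isCoprime_X_sub_C_of_isUnit_sub
      (by simpa using ha)).pow).map (algebraMap K[X] Entire)
  obtain ⟨G, hG⟩ := hcop.mul_dvd (z := R) ⟨G₁, by rw [hG₁, Algebra.smul_def]⟩
    ⟨G₂, by rw [hG₂, Algebra.smul_def]⟩
  exact ⟨G, by rw [hG, Algebra.smul_def, map_mul, C_0, sub_zero]⟩

end Entire

/-- `u N = O(C ^ N * N ^ (k * N))` for some `C`. -/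
def SuperGeometric (k : ℕ) (u : ℕ → ℝ) : Prop :=
  ∃ C : ℝ, 1 ≤ C ∧ ∀ N : ℕ, 1 ≤ N → u N ≤ C ^ N * (N : ℝ) ^ (k * N)

namespace SuperGeometric

theorem mul {k l : ℕ} {u v : ℕ → ℝ} (hu : SuperGeometric k u) (hv : SuperGeometric l v)
    (h0 : ∀ N, 0 ≤ v N) : SuperGeometric (k + l) fun N => u N * v N := by
  obtain ⟨C, hC, h⟩ := hu
  obtain ⟨C', hC', h'⟩ := hv
  refine ⟨C * C', one_le_mul_of_one_le_of_one_le hC hC', fun N hN => ?_⟩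
  calc u N * v N ≤ (C ^ N * (N : ℝ) ^ (k * N)) * (C' ^ N * (N : ℝ) ^ (l * N)) :=
        mul_le_mul (h N hN) (h' N hN) (h0 N) (by positivity)
    _ = _ := by rw [mul_pow, add_mul, pow_add]; ring

theorem const (c : ℝ) : SuperGeometric 0 fun _ => c := by
  refine ⟨max c 1, le_max_right _ _, fun N hN => ?_⟩
  rw [zero_mul, pow_zero, mul_one]
  exact (le_max_left c 1).trans (le_self_pow₀ (le_max_right _ _) (by omega))

theorem pow_const {k : ℕ} {u : ℕ → ℝ} (hu : SuperGeometric k u) (h0 : ∀ N, 0 ≤ u N) (n : ℕ) :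
    SuperGeometric (k * n) fun N => u N ^ n := by
  induction n with
  | zero => simpa using const 1
  | succ n ih =>
    have := ih.mul hu h0
    simpa only [pow_succ, Nat.mul_succ] using this

theorem const_pow {c : ℝ} (hc : 1 ≤ c) {l : ℕ → ℕ} {e : ℕ} (hl : ∀ N, 1 ≤ N → l N ≤ e * N) :
    SuperGeometric 0 fun N => c ^ l N := by
  refine ⟨c ^ e, one_le_pow₀ hc, fun N hN => ?_⟩
  rw [zero_mul, pow_zero, mul_one, ← pow_mul]
  exact pow_le_pow_right₀ hc (hl N hN)

theorem linear_pow {l : ℕ → ℕ} {e : ℕ} (hl : ∀ N, 1 ≤ N → l N ≤ e * N) (k : ℕ) :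
    SuperGeometric k fun N => (l N : ℝ) ^ (k * N) := by
  refine ⟨(max e 1 : ℝ) ^ k, one_le_pow₀ (le_max_right _ _), fun N hN => ?_⟩
  rw [← pow_mul, ← mul_pow]
  refine pow_le_pow_left₀ (by positivity) ?_ _
  calc (l N : ℝ) ≤ e * N := by exact_mod_cast hl N hN
    _ ≤ _ := by gcongr; exact le_max_left _ _

theorem linear {l : ℕ → ℕ} {e : ℕ} (hl : ∀ N, 1 ≤ N → l N ≤ e * N) :
    SuperGeometric 0 fun N => (l N : ℝ) := by
  have h1 : SuperGeometric 0 fun N : ℕ => (N : ℝ) := by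
    refine ⟨2, one_le_two, fun N _ => ?_⟩
    rw [zero_mul, pow_zero, mul_one]
    show (N : ℝ) ≤ 2 ^ N
    exact_mod_cast N.lt_two_pow_self.le
  obtain ⟨C, hC, h⟩ := (const (e : ℝ)).mul h1 fun N => N.cast_nonneg
  exact ⟨C, hC, fun N hN => le_trans
    (show (l N : ℝ) ≤ e * N by exact_mod_cast hl N hN) (h N hN)⟩

end SuperGeometric

section Auxiliary

set_option linter.unusedSectionVars false

open NumberField

variable {K : Type} [Field K] [NumberField K] {r : ℕ} (T : K[X]) (B : Matrix (Fin r) (Fin r) K[X])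

/-- `coordD` as a linear map. -/
def coordDLin : Module.End K (Fin r → K[X]) where
  toFun := coordD T B
  map_add' P Q := by
    funext j
    simp only [coordD, Pi.add_apply, derivative_add, mul_add, add_mul, Finset.sum_add_distrib]
    ring
  map_smul' a P := by
    funext j
    simp only [coordD, Pi.smul_apply, derivative_smul, mul_smul_comm, smul_mul_assoc,
      RingHom.id_apply, smul_add, Finset.smul_sum]

theorem coordDLin_pow_apply (k : ℕ) (P : Fin r → K[X]) :
    (coordDLin T B ^ k) P = (coordD T B)^[k] P := by
  rw [Module.End.pow_apply]; rfl

/-- The vector of polynomials with given coefficients. -/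
def polyVec {N : ℕ} (ξ : Fin r × Fin (N + 1) → K) (i : Fin r) : K[X] :=
  ∑ j : Fin (N + 1), monomial (j : ℕ) (ξ (i, j))

theorem coeff_polyVec {N : ℕ} (ξ : Fin r × Fin (N + 1) → K) (i : Fin r) (n : ℕ) :
    (polyVec ξ i).coeff n = if h : n < N + 1 then ξ (i, ⟨n, h⟩) else 0 := by
  rw [polyVec, finsetSum_coeff]
  simp only [coeff_monomial]
  split_ifs with h
  · rw [Finset.sum_eq_single ⟨n, h⟩]
    · simp
    · intro j _ hj
      rw [if_neg fun e => hj (Fin.ext e)]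
    · simp
  · exact Finset.sum_eq_zero fun j _ => if_neg fun e => h (by omega)

theorem natDegree_polyVec_le {N : ℕ} (ξ : Fin r × Fin (N + 1) → K) (i : Fin r) :
    (polyVec ξ i).natDegree ≤ N := by
  rw [natDegree_le_iff_coeff_eq_zero]
  intro n hn
  rw [coeff_polyVec, dif_neg (by omega)]

theorem polyVec_eq_sum {N : ℕ} (ξ : Fin r × Fin (N + 1) → K) :
    polyVec ξ = ∑ x, ξ x • (Pi.single x.1 (X ^ (x.2 : ℕ)) : Fin r → K[X]) := by
  funext i
  rw [Finset.sum_apply, Fintype.sum_prod_type, Finset.sum_eq_single i]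
  · refine Finset.sum_congr rfl fun j _ => ?_
    rw [Pi.smul_apply, Pi.single_eq_same, smul_eq_C_mul, C_mul_X_pow_eq_monomial]
  · intro i' _ hi'
    exact Finset.sum_eq_zero fun j _ => by
      rw [Pi.smul_apply, Pi.single_eq_of_ne (Ne.symm hi'), smul_zero]
  · simp

/-- The entry of the system of linear equations for the coefficients of an auxiliary form. -/
def formEntry {s : ℕ} (α : K) (μ : Fin r → Fin s → K) (k : ℕ) (q : Fin s) (P : Fin r → K[X]) : K :=
  ∑ l, ((coordD T B)^[k] P l).eval α * μ l q

theorem formEntry_polyVec {s : ℕ} (α : K) (μ : Fin r → Fin s → K) (k : ℕ) (q : Fin s) {N : ℕ}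
    (ξ : Fin r × Fin (N + 1) → K) : formEntry T B α μ k q (polyVec ξ) =
      ∑ x, formEntry T B α μ k q (Pi.single x.1 (X ^ (x.2 : ℕ))) * ξ x := by
  rw [polyVec_eq_sum, formEntry, ← coordDLin_pow_apply, map_sum]
  simp only [formEntry, map_smul, coordDLin_pow_apply, Finset.sum_apply, Pi.smul_apply,
    eval_finsetSum, eval_smul, Finset.sum_mul, smul_eq_mul]
  rw [Finset.sum_comm]
  refine Finset.sum_congr rfl fun x _ => Finset.sum_congr rfl fun l _ => by ring

theorem coeff_single_X_pow (i i' : Fin r) (j n : ℕ) :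
    ((Pi.single i (X ^ j) : Fin r → K[X]) i').coeff n = if i' = i ∧ n = j then 1 else 0 := by
  by_cases h : i' = i
  · subst h
    simp [coeff_X_pow]
  · simp [h]

theorem exists_auxiliary {s : ℕ} (hs : 1 ≤ s) (α : K) (μ : Fin r → Fin s → K) (b : ℕ) (hb : 1 ≤ b)
    (hr : (b + 1) * (b * s) ≤ r) (hT : ∀ n, IsIntegral ℤ (T.coeff n))
    (hB : ∀ i j n, IsIntegral ℤ ((B i j).coeff n)) :
    ∃ Y : ℕ → ℝ, SuperGeometric 1 Y ∧ (∀ N, 0 ≤ Y N) ∧ ∀ N, 1 ≤ N → ∃ P : Fin r → K[X], P ≠ 0 ∧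
      (∀ i, (P i).natDegree ≤ N) ∧ (∀ i n, IsIntegral ℤ ((P i).coeff n)) ∧
      (∀ i n, house ((P i).coeff n) ≤ Y N) ∧ ∀ k < b * N, ∀ q, formEntry T B α μ k q P = 0 := by
  classical
  obtain ⟨δ, hδ0, hδ⟩ := exists_common_denominator
    (insert α (Finset.univ.image fun x : Fin r × Fin s => μ x.1 x.2))
  have hδα : IsIntegral ℤ ((δ : K) * α) := hδ α (Finset.mem_insert_self _ _)
  have hδμ : ∀ l q, IsIntegral ℤ ((δ : K) * μ l q) := fun l q => hδ _
    (Finset.mem_insert_of_mem (Finset.mem_image.2 ⟨(l, q), Finset.mem_univ _, rfl⟩))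
  obtain ⟨c, h, h1, hch⟩ := exists_iterate_coordD_le T B
  obtain ⟨cS, hcS, hS⟩ := exists_siegel K b hb
  set A : ℝ := max 1 (house α) with hA
  set m : ℝ := ∑ l, ∑ q, house (μ l q) with hm
  have hm0 : 0 ≤ m := Finset.sum_nonneg fun _ _ => Finset.sum_nonneg fun _ _ => house_nonneg _
  have hμm : ∀ l q, house (μ l q) ≤ m := fun l q =>
    (Finset.single_le_sum (f := fun q => house (μ l q)) (fun _ _ => house_nonneg _)
      (Finset.mem_univ q)).trans (Finset.single_le_sum (f := fun l => ∑ q, house (μ l q))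
        (fun _ _ => Finset.sum_nonneg fun _ _ => house_nonneg _) (Finset.mem_univ l))
  have hA1 : 1 ≤ A := le_max_left _ _
  have hδ1 : (1 : ℝ) ≤ δ := by exact_mod_cast Nat.one_le_iff_ne_zero.2 hδ0
  let E : ℕ → ℕ := fun N => N + b * N * c
  have hE : ∀ N, 1 ≤ N → E N + 1 ≤ (b * c + 2) * N := fun N hN => by
    simp only [E]; nlinarith
  let Z : ℕ → ℝ := fun N => (cS * (r * (N + 1 : ℕ))) * (δ ^ (E N + 1) * (r * (((E N + 1 : ℕ) : ℝ) *
    (h ^ (b * N) * ((E N + 1 : ℕ) : ℝ) ^ (b * N) * A ^ E N) * m)))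
  have hZ : SuperGeometric b Z := by
    have e1 : SuperGeometric 0 fun N : ℕ => cS * (r * (N + 1 : ℕ)) := by
      have := (SuperGeometric.const cS).mul ((SuperGeometric.const (r : ℝ)).mul
        (SuperGeometric.linear (l := fun N => N + 1) (e := 2) fun N hN => by omega)
        fun N => by positivity) fun N => by positivity
      simpa using this
    have e2 : SuperGeometric 0 fun N : ℕ => (δ : ℝ) ^ (E N + 1) :=
      SuperGeometric.const_pow hδ1 (l := fun N => E N + 1) hE
    have e3 : SuperGeometric b fun N : ℕ => h ^ (b * N) * ((E N + 1 : ℕ) : ℝ) ^ (b * N) * A ^ E N := by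
      have := ((SuperGeometric.const_pow h1 (l := fun N => b * N) (e := b) fun N _ => le_rfl).mul
        (SuperGeometric.linear_pow (l := fun N => E N + 1) hE b) fun N => by positivity).mul
        (SuperGeometric.const_pow hA1 (l := E) (e := b * c + 2) fun N hN => by
          have := hE N hN; omega) fun N => by positivity
      simpa using this
    have e4 := e1.mul (e2.mul ((SuperGeometric.const (r : ℝ)).mul (((SuperGeometric.linear
      (l := fun N => E N + 1) hE).mul e3 fun N => by positivity).mul (SuperGeometric.const m)
        fun _ => hm0) fun N => by positivity) fun N => by positivity) fun N => by positivity
    simpa only [zero_add, add_zero, Z] using e4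
  obtain ⟨W, hW, hWZ⟩ := hZ
  have hY1 : ∀ N : ℕ, 1 ≤ N → 1 ≤ W ^ N * (N : ℝ) ^ (1 * N) := fun N hN => by
    have hN' : (1 : ℝ) ≤ N := by exact_mod_cast hN
    have h2 : (1 : ℝ) ≤ (N : ℝ) ^ (1 * N) := one_le_pow₀ hN'
    exact one_le_mul_of_one_le_of_one_le (one_le_pow₀ hW) h2
  refine ⟨fun N => cS * (W ^ N * (N : ℝ) ^ (1 * N)), ?_, fun N => by positivity, fun N hN => ?_⟩
  · have := (SuperGeometric.const cS).mul (l := 1) ⟨W, hW, fun N _ => le_rfl⟩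
      fun N => by positivity
    simpa using this
  have hY := hY1 N hN
  set Y : ℝ := W ^ N * (N : ℝ) ^ (1 * N) with hYdef
  have hZY : Z N ≤ Y ^ b := by
    refine (hWZ N hN).trans ?_
    rw [hYdef, mul_pow, ← pow_mul, ← pow_mul, one_mul, mul_comm b N]
    exact mul_le_mul_of_nonneg_right (pow_le_pow_right₀ hW (Nat.le_mul_of_pos_right _ (by omega)))
      (by positivity)
  have hsingle : ∀ x : Fin r × Fin (N + 1), ∀ k < b * N, ∀ l,
      ((coordD T B)^[k] (Pi.single x.1 (X ^ (x.2 : ℕ))) l).natDegree ≤ E N ∧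
      ∀ n, house (((coordD T B)^[k] (Pi.single x.1 (X ^ (x.2 : ℕ))) l).coeff n) ≤
        h ^ (b * N) * ((E N + 1 : ℕ) : ℝ) ^ (b * N) := by
    intro x k hk l
    have hx := hch N (Pi.single x.1 (X ^ (x.2 : ℕ))) 1 (fun i => by
      rw [natDegree_le_iff_coeff_eq_zero]
      intro n hn
      rw [coeff_single_X_pow, if_neg (by have := x.2.2; omega)]) (fun i n => by
      rw [coeff_single_X_pow]
      split_ifs
      · exact house_one.le
      · rw [house_zero]; exact zero_le_one) k l
    have hkE : N + k * c ≤ E N := by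
      simp only [E]
      exact Nat.add_le_add_left (Nat.mul_le_mul_right c hk.le) N
    refine ⟨hx.1.trans hkE, fun n => (hx.2 n).trans ?_⟩
    have hkE' : (N : ℝ) + k * c + 1 ≤ ((E N + 1 : ℕ) : ℝ) := by exact_mod_cast Nat.succ_le_succ hkE
    have hE1 : (1 : ℝ) ≤ ((E N + 1 : ℕ) : ℝ) := by exact_mod_cast Nat.succ_le_succ (Nat.zero_le _)
    rw [mul_one, ← mul_pow]
    calc (h * (N + k * c + 1)) ^ k ≤ (h * ((E N + 1 : ℕ) : ℝ)) ^ k := by gcongr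
      _ ≤ _ := pow_le_pow_right₀ (one_le_mul_of_one_le_of_one_le h1 hE1) hk.le
  have hintegral : ∀ (x : Fin r × Fin (N + 1)) (y : Fin (b * N) × Fin s), IsIntegral ℤ
      ((δ : K) ^ (E N + 1) * formEntry T B α μ y.1 y.2 (Pi.single x.1 (X ^ (x.2 : ℕ)))) := by
    intro x y
    rw [formEntry, Finset.mul_sum]
    refine IsIntegral.sum _ fun l _ => ?_
    rw [pow_succ, mul_mul_mul_comm]
    refine (isIntegral_pow_mul_eval (hsingle x y.1 y.1.2 l).1 ?_ hδα).mul (hδμ _ _)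
    refine isIntegral_coeff_iterate_coordD T B hT hB (fun i n => ?_) y.1 l
    rw [coeff_single_X_pow]
    split_ifs
    · exact isIntegral_one
    · exact isIntegral_zero
  let a : Matrix (Fin (b * N) × Fin s) (Fin r × Fin (N + 1)) (𝓞 K) := fun y x => ⟨_, hintegral x y⟩
  have ha : ∀ y x, algebraMap (𝓞 K) K (a y x) =
      (δ : K) ^ (E N + 1) * formEntry T B α μ y.1 y.2 (Pi.single x.1 (X ^ (x.2 : ℕ))) :=
    fun _ _ => rfl
  obtain ⟨ξ, hξ0, hξ, hξh⟩ := hS a Y hY (by simp; exact ⟨⟨by omega, by omega⟩, by omega⟩)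
    (by
      simp only [Fintype.card_prod, Fintype.card_fin]
      nlinarith [Nat.mul_le_mul_right N hr])
    fun y x => by
      refine le_trans ?_ hZY
      simp only [Fintype.card_prod, Fintype.card_fin, Z]
      rw [ha]
      push_cast
      refine mul_le_mul_of_nonneg_left ?_ (by positivity)
      have hnat : house ((δ : K) ^ (E N + 1) *
          formEntry T B α μ y.1 y.2 (Pi.single x.1 (X ^ (x.2 : ℕ)))) = (δ : ℝ) ^ (E N + 1) *
          house (formEntry T B α μ y.1 y.2 (Pi.single x.1 (X ^ (x.2 : ℕ)))) := by
        have := house_nat_mul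
          (formEntry T B α μ y.1 y.2 (Pi.single x.1 (X ^ (x.2 : ℕ)))) (δ ^ (E N + 1))
        push_cast at this
        exact this
      rw [hnat]
      refine mul_le_mul_of_nonneg_left ?_ (by positivity)
      refine (house_sum_le_sum_house _ _).trans ((Finset.sum_le_card_nsmul _ _ _ fun l _ =>
        (house_mul_le _ _).trans (mul_le_mul (house_eval_le (hsingle x y.1 y.1.2 l).1
          (hsingle x y.1 y.1.2 l).2 α hA1 (le_max_right _ _)) (hμm _ _) (house_nonneg _)
            (by positivity))).trans ?_)
      rw [Finset.card_univ, Fintype.card_fin, nsmul_eq_mul]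
      push_cast
      exact le_rfl
  refine ⟨polyVec fun x => algebraMap (𝓞 K) K (ξ x), ?_, natDegree_polyVec_le _, fun i n => ?_,
    fun i n => ?_, fun k hk q => ?_⟩
  · intro h0
    apply hξ0
    funext x
    have := congrArg (fun p : K[X] => p.coeff x.2) (congrFun h0 x.1)
    simp only [coeff_polyVec, x.2.2, dif_pos, Pi.zero_apply, coeff_zero] at this
    simpa using this
  · rw [coeff_polyVec]
    split_ifs
    · exact (ξ _).isIntegral_coe
    · exact isIntegral_zero
  · rw [coeff_polyVec]
    split_ifs
    · exact hξh _
    · rw [house_zero]; positivity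
  · have h2 := congrArg (algebraMap (𝓞 K) K) (congrFun hξ (⟨k, hk⟩, q))
    rw [Matrix.mulVec, dotProduct, Pi.zero_apply, map_zero, map_sum] at h2
    rw [formEntry_polyVec]
    have hδK : (δ : K) ^ (E N + 1) ≠ 0 := pow_ne_zero _ (by exact_mod_cast hδ0)
    refine (mul_eq_zero.1 ?_).resolve_left hδK
    rw [Finset.mul_sum, ← h2]
    exact Finset.sum_congr rfl fun x _ => by rw [map_mul, ha, mul_assoc]

end Auxiliary

section Uniform

open NumberField

variable {K : Type*} [Field K] [NumberField K]

theorem exists_uniform_bounds {r : ℕ} {a : Fin r → ℕ → K} (ha : ∀ i, IsESequence (a i)) :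
    ∃ C : ℝ, 1 ≤ C ∧ (∀ i n, house (a i n) ≤ C ^ (n + 1)) ∧
      ∃ D : ℝ, 1 ≤ D ∧ ∃ d : ℕ → ℕ, ∀ n, d n ≠ 0 ∧ (d n : ℝ) ≤ D ^ (n + 1) ∧
        ∀ i, ∀ m ≤ n, IsIntegral ℤ ((d n : K) * a i m) := by
  choose h1 D hD d hd using ha
  choose C hC hCa using h1
  have hle : ∀ i, C i ≤ 1 + ∑ i, C i := fun i => by
    have := Finset.single_le_sum (fun j _ => zero_le_one.trans (hC j)) (Finset.mem_univ i)
    linarith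
  refine ⟨1 + ∑ i, C i, ?_, fun i n => (hCa i n).trans ?_, ∏ i, D i, ?_, fun n => ∏ i, d i n,
    fun n => ⟨?_, ?_, fun i m hm => ?_⟩⟩
  · have := Finset.sum_nonneg (s := Finset.univ) fun j _ => zero_le_one.trans (hC j)
    linarith
  · exact pow_le_pow_left₀ (zero_le_one.trans (hC i)) (hle i) _
  · exact Finset.one_le_prod fun i _ => hD i
  · exact Finset.prod_ne_zero_iff.2 fun i _ => (hd i n).1
  · push_cast
    rw [← Finset.prod_pow]
    exact Finset.prod_le_prod (fun i _ => by positivity) fun i _ => (hd i n).2.1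
  · push_cast
    rw [← Finset.prod_erase_mul _ _ (Finset.mem_univ i), mul_assoc]
    refine IsIntegral.mul (IsIntegral.prod _ fun j _ => ?_) ((hd i n).2.2 m hm)
    exact isIntegral_natCast (R := ℤ) (B := K) _

theorem house_natCast_le (n : ℕ) : house (n : K) ≤ n := by
  have := house_nat_mul (1 : K) n
  rw [mul_one, house_one, mul_one] at this
  exact this.le

end Uniform

namespace Entire

section

variable {K : Type*} [Field K] [Algebra K ℂ]

theorem norm_apply_zero_mul_le {R G : Entire} {a : K} {m M : ℕ}
    (h : R = (X ^ m * (X - C a : K[X]) ^ M) • G) {ρ S : ℝ} (hρ : 0 < ρ)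
    (ha : 2 * ‖algebraMap K ℂ a‖ ≤ ρ) (hS : ∀ z : ℂ, ‖z‖ = ρ → ‖R z‖ ≤ S) :
    ‖G 0‖ * (ρ ^ m * (ρ / 2) ^ M) ≤ S := by
  have hpos : 0 < ρ ^ m * (ρ / 2) ^ M := by positivity
  rw [← le_div_iff₀ hpos]
  refine Complex.norm_le_of_forall_mem_frontier_norm_le (U := Metric.ball (0 : ℂ) ρ)
    Metric.isBounded_ball G.2.diffContOnCl (fun z hz => ?_)
    (subset_closure (Metric.mem_ball_self hρ))
  rw [frontier_ball _ hρ.ne', mem_sphere_zero_iff_norm] at hz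
  have h1 := hS z hz
  rw [h, smul_poly_apply, norm_mul] at h1
  rw [le_div_iff₀ hpos, mul_comm]
  refine le_trans (mul_le_mul_of_nonneg_right ?_ (norm_nonneg _)) h1
  simp only [map_mul, map_pow, aeval_X, map_sub, aeval_C, norm_mul, norm_pow, hz]
  refine mul_le_mul_of_nonneg_left (pow_le_pow_left₀ (by positivity) ?_ _) (by positivity)
  have := norm_sub_norm_le z (algebraMap K ℂ a)
  rw [hz] at this
  linarith

theorem coeff_taylor_eq {R G : Entire} {a : K} {m M : ℕ}
    (h : R = (X ^ m * (X - C a : K[X]) ^ M) • G) :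
    PowerSeries.coeff m (taylor R) = (-algebraMap K ℂ a) ^ M * G 0 := by
  have h0 : PowerSeries.constantCoeff (taylor G) = G 0 := by
    rw [← PowerSeries.coeff_zero_eq_constantCoeff_apply, coeff_taylor]
    simp
  rw [h, taylor_smul_poly, Polynomial.coe_mul, Polynomial.coe_pow, Polynomial.coe_X,
    RingHom.map_mul, RingHom.map_pow, PowerSeries.map_X, mul_assoc, PowerSeries.coeff_X_pow_mul', if_pos le_rfl,
    Nat.sub_self, PowerSeries.coeff_zero_eq_constantCoeff_apply, RingHom.map_mul, h0]
  simp

theorem factorial_mul_coeff_taylor_sum_smul {r : ℕ} {g : Fin r → Entire} {a : Fin r → ℕ → K}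
    (ha : ∀ i n, PowerSeries.coeff n (taylor (g i)) = algebraMap K ℂ (a i n) / n.factorial)
    (P : Fin r → K[X]) (m : ℕ) :
    m.factorial * PowerSeries.coeff m (taylor (∑ i, P i • g i)) =
      algebraMap K ℂ (∑ i, ∑ x ∈ Finset.HasAntidiagonal.antidiagonal m,
        (m.descFactorial x.1 : K) * ((P i).coeff x.1 * a i x.2)) := by
  rw [map_sum, map_sum, map_sum, Finset.mul_sum]
  refine Finset.sum_congr rfl fun i _ => ?_
  rw [taylor_smul_poly, PowerSeries.coeff_mul, map_sum, Finset.mul_sum]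
  refine Finset.sum_congr rfl fun x hx => ?_
  have hx' : x.1 + x.2 = m := Finset.HasAntidiagonal.mem_antidiagonal.1 hx
  have h1 : (x.2.factorial : ℂ) * m.descFactorial x.1 = m.factorial := by
    have := Nat.factorial_mul_descFactorial (n := m) (k := x.1) (by omega)
    rw [show m - x.1 = x.2 by omega] at this
    exact_mod_cast this
  have h2 : (x.2.factorial : ℂ) ≠ 0 := by exact_mod_cast x.2.factorial_ne_zero
  rw [ha, PowerSeries.coeff_map, Polynomial.coeff_coe, map_mul, map_mul, map_natCast, ← h1]
  field_simp

end

section Bounds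

set_option linter.unusedSectionVars false

open NumberField

variable {K : Type*} [Field K] [NumberField K] [Algebra K ℂ]

theorem norm_aeval_le {N : ℕ} {p : K[X]} (hp : p.natDegree ≤ N) {Y ρ : ℝ}
    (hY : ∀ n, house (p.coeff n) ≤ Y) (hρ : 1 ≤ ρ) {z : ℂ} (hz : ‖z‖ = ρ) :
    ‖aeval z p‖ ≤ (N + 1 : ℕ) * (Y * ρ ^ N) := by
  have hY0 : 0 ≤ Y := (house_nonneg _).trans (hY 0)
  rw [aeval_eq_sum_range' (n := N + 1) (by omega)]
  refine (norm_sum_le _ _).trans ((Finset.sum_le_card_nsmul _ _ (Y * ρ ^ N) fun n hn => ?_).trans ?_)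
  · rw [Algebra.smul_def, norm_mul, norm_pow, hz]
    exact mul_le_mul ((norm_embedding_le_house _ _).trans (hY n))
      (pow_le_pow_right₀ hρ (by have := Finset.mem_range.1 hn; omega)) (by positivity) hY0
  · rw [Finset.card_range, nsmul_eq_mul]

theorem norm_sum_smul_apply_le {r N : ℕ} {g : Fin r → Entire} {A : ℝ}
    (hA : ∀ i z, ‖g i z‖ ≤ A * Real.exp (A * ‖z‖)) {P : Fin r → K[X]} {Y : ℝ}
    (hP : ∀ i, (P i).natDegree ≤ N) (hY : ∀ i n, house ((P i).coeff n) ≤ Y) (hN : 1 ≤ N) {z : ℂ}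
    (hz : ‖z‖ = N) : ‖(∑ i, P i • g i : Entire) z‖ ≤
      r * (((N + 1 : ℕ) * (Y * (N : ℝ) ^ (1 * N))) * (A * Real.exp A ^ N)) := by
  rw [sum_smul_apply]
  refine (norm_sum_le _ _).trans ((Finset.sum_le_card_nsmul _ _
    (((N + 1 : ℕ) * (Y * (N : ℝ) ^ (1 * N))) * (A * Real.exp A ^ N)) fun i _ => ?_).trans ?_)
  · rw [norm_mul]
    have h1 := norm_aeval_le (hP i) (hY i) (show (1 : ℝ) ≤ N by exact_mod_cast hN) hz
    have h2 := hA i z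
    rw [hz, mul_comm A (N : ℝ), Real.exp_nat_mul] at h2
    rw [one_mul]
    exact mul_le_mul h1 h2 (norm_nonneg _) ((norm_nonneg _).trans h1)
  · rw [Finset.card_univ, Fintype.card_fin, nsmul_eq_mul]

theorem house_sum_antidiagonal_le {r N m L : ℕ} {a : Fin r → ℕ → K} {A : ℝ} (hA1 : 1 ≤ A)
    (hA : ∀ i n, house (a i n) ≤ A ^ (n + 1)) {P : Fin r → K[X]} {Y : ℝ} (hY0 : 0 ≤ Y)
    (hP : ∀ i, (P i).natDegree ≤ N) (hY : ∀ i n, house ((P i).coeff n) ≤ Y) (hm : m + 1 ≤ L) :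
    house (∑ i, ∑ x ∈ Finset.HasAntidiagonal.antidiagonal m,
        (m.descFactorial x.1 : K) * ((P i).coeff x.1 * a i x.2)) ≤
      r * (L * ((L : ℝ) ^ (1 * N) * (Y * A ^ L))) := by
  have hL : (1 : ℝ) ≤ L := by exact_mod_cast (by omega : 1 ≤ L)
  have hb : 0 ≤ (L : ℝ) ^ (1 * N) * (Y * A ^ L) := by positivity
  refine (house_sum_le_sum_house _ _).trans ((Finset.sum_le_card_nsmul _ _
    (L * ((L : ℝ) ^ (1 * N) * (Y * A ^ L))) fun i _ => ?_).trans ?_)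
  · refine (house_sum_le_sum_house _ _).trans ((Finset.sum_le_card_nsmul _ _
      ((L : ℝ) ^ (1 * N) * (Y * A ^ L)) fun x hx => ?_).trans ?_)
    · have hx' : x.1 + x.2 = m := Finset.HasAntidiagonal.mem_antidiagonal.1 hx
      by_cases hxN : x.1 ≤ N
      · refine (house_mul_le _ _).trans (mul_le_mul ?_ ((house_mul_le _ _).trans
          (mul_le_mul (hY i _) ((hA i _).trans (pow_le_pow_right₀ hA1 (by omega)))
            (house_nonneg _) hY0)) (house_nonneg _) (by positivity))
        refine (house_natCast_le _).trans ?_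
        rw [one_mul]
        calc ((m.descFactorial x.1 : ℕ) : ℝ) ≤ ((m ^ x.1 : ℕ) : ℝ) := by
              exact_mod_cast Nat.descFactorial_le_pow m x.1
          _ ≤ (L : ℝ) ^ x.1 := by
              push_cast
              exact pow_le_pow_left₀ (by positivity) (by exact_mod_cast (by omega : m ≤ L)) _
          _ ≤ _ := pow_le_pow_right₀ hL hxN
      · rw [coeff_eq_zero_of_natDegree_lt (lt_of_le_of_lt (hP i) (by omega)), zero_mul, mul_zero,
          house_zero]
        exact hb
    · rw [Finset.Nat.card_antidiagonal, nsmul_eq_mul]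
      exact mul_le_mul_of_nonneg_right (by exact_mod_cast hm) hb
  · rw [Finset.card_univ, Fintype.card_fin, nsmul_eq_mul]

end Bounds

end Entire

namespace Entire

open NumberField

section SiegelShidlovskii

variable {K : Type} [Field K] [NumberField K] [Algebra K ℂ] {r : ℕ}

theorem exists_uniform_norm_le {g : Fin r → Entire} (hg : ∀ i, IsEType K (g i)) :
    ∃ A : ℝ, 1 ≤ A ∧ ∀ i z, ‖g i z‖ ≤ A * Real.exp (A * ‖z‖) := by
  choose A hA hgA using fun i => (hg i).exists_norm_le
  have h0 : ∀ i, 0 ≤ A i := fun i => zero_le_one.trans (hA i)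
  have hle : ∀ i, A i ≤ 1 + ∑ i, A i := fun i => by
    have := Finset.single_le_sum (fun j _ => h0 j) (Finset.mem_univ i)
    linarith
  refine ⟨1 + ∑ i, A i, ?_, fun i z => (hgA i z).trans ?_⟩
  · have := Finset.sum_nonneg (s := Finset.univ) fun j _ => h0 j
    linarith
  · have := hle i
    have := h0 i
    gcongr
    exact (h0 i).trans (hle i)

theorem exists_pow_gt {k : ℕ} {u : ℕ → ℝ} {N₀ : ℕ}
    (hu : SuperGeometric k u) (h : ∀ N, N₀ ≤ N → 1 ≤ N → (N : ℝ) ^ ((k + 1) * N) ≤ u N) : False := by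
  obtain ⟨W, hW, hWu⟩ := hu
  obtain ⟨N₁, hN₁⟩ := exists_nat_gt W
  let N := max (max N₀ N₁) 1
  have hN1 : 1 ≤ N := le_max_right _ _
  have hNW : W < N := hN₁.trans_le (by
    exact_mod_cast (le_max_right N₀ N₁).trans (le_max_left _ _))
  have h2 := (h N ((le_max_left _ _).trans (le_max_left _ _)) hN1).trans (hWu N hN1)
  rw [add_mul, pow_add, one_mul, mul_comm] at h2
  have hpos : (0 : ℝ) < (N : ℝ) ^ (k * N) := by positivity
  have h3 := le_of_mul_le_mul_right h2 hpos
  exact absurd h3 (not_le.2 (pow_lt_pow_left₀ hNW (by linarith) (by omega)))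

theorem card_lt_of_linearIndependent_of_isIntegral {g : Fin r → Entire} {T : K[X]}
    {B : Matrix (Fin r) (Fin r) K[X]} (hsys : ∀ i, T • D (g i) = ∑ j, B i j • g j) {α : K}
    (hα : α ≠ 0) (hT : T.eval α ≠ 0) (hg : ∀ i, IsEType K (g i)) (hli : LinearIndependent K[X] g)
    (hTint : ∀ n, IsIntegral ℤ (T.coeff n)) (hBint : ∀ i j n, IsIntegral ℤ ((B i j).coeff n))
    {s : ℕ} (hs : 1 ≤ s) {w : Fin s → ℂ} {μ : Fin r → Fin s → K}
    (hμ : ∀ l, g l (algebraMap K ℂ α) = ∑ q, algebraMap K ℂ (μ l q) * w q) :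
    r < (2 * Module.finrank ℚ K + 2) * ((2 * Module.finrank ℚ K + 1) * s) := by
  by_contra hr
  push Not at hr
  have hK : 1 ≤ Module.finrank ℚ K := Module.finrank_pos
  set b := 2 * Module.finrank ℚ K + 1 with hb
  obtain ⟨Y, hY, hY0, haux⟩ := exists_auxiliary T B hs α μ b (by omega) hr hTint hBint
  have hT0 : T ≠ 0 := by rintro rfl; simp at hT
  obtain ⟨c, hc⟩ := exists_order_le g T B hsys hT0 hli
  choose a ha hga using hg
  obtain ⟨A, hA1, hA⟩ := exists_uniform_norm_le fun i => (⟨a i, ha i, hga i⟩ : IsEType K (g i))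
  obtain ⟨C, hC1, hC, Δ, hΔ1, δ, hδ⟩ := exists_uniform_bounds ha
  set ε : ℝ := max 1 (2 * ‖algebraMap K ℂ α‖) with hε
  have hε1 : 1 ≤ ε := le_max_left _ _
  let e := 2 * c + 1
  have he1 : (1 : ℝ) ≤ e := by exact_mod_cast (by omega : 1 ≤ e)
  let L : ℕ → ℕ := fun N => e * N
  let V : ℕ → ℝ := fun N => Δ ^ L N * (r * (L N * ((L N : ℝ) ^ (1 * N) * (Y N * C ^ L N))))
  let U : ℕ → ℝ := fun N => (e : ℝ) ^ L N * (Δ ^ L N * (ε ^ (b * N) *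
    (r * (((N + 1 : ℕ) * (Y N * (N : ℝ) ^ (1 * N))) * (A * Real.exp A ^ N)))))
  have hL : ∀ N, 1 ≤ N → L N ≤ e * N := fun _ _ => le_rfl
  have hV0 : ∀ N, 0 ≤ V N := fun N => by have := hY0 N; positivity
  have hV : SuperGeometric 2 V := by
    have := (SuperGeometric.const_pow hΔ1 hL).mul ((SuperGeometric.const (r : ℝ)).mul
      ((SuperGeometric.linear hL).mul ((SuperGeometric.linear_pow hL 1).mul (hY.mul
        (SuperGeometric.const_pow hC1 hL) fun N => by positivity) fun N => by
          have := hY0 N; positivity) fun N => by have := hY0 N; positivity) fun N => by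
          have := hY0 N; positivity) fun N => by have := hY0 N; positivity
    simpa only [zero_add, add_zero, one_add_one_eq_two] using this
  have hU : SuperGeometric 2 U := by
    have h1 : SuperGeometric 2 fun N : ℕ => r * (((N + 1 : ℕ) * (Y N * (N : ℝ) ^ (1 * N))) *
        (A * Real.exp A ^ N)) := by
      have := (SuperGeometric.const (r : ℝ)).mul (((SuperGeometric.linear (l := fun N => N + 1)
        (e := 2) fun N hN => by omega).mul (hY.mul (SuperGeometric.linear_pow (l := fun N => N)
          (e := 1) (fun N _ => by omega) 1) fun N => by positivity) fun N => by
            have := hY0 N; positivity).mul ((SuperGeometric.const A).mul (SuperGeometric.const_pow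
            (Real.one_le_exp (zero_le_one.trans hA1)) (l := fun N => N) (e := 1) fun N _ => by omega)
              fun N => by positivity) fun N => by positivity) fun N => by
                have := hY0 N; positivity
      simpa only [zero_add, add_zero, one_add_one_eq_two] using this
    have := (SuperGeometric.const_pow he1 hL).mul ((SuperGeometric.const_pow hΔ1 hL).mul
      ((SuperGeometric.const_pow hε1 (l := fun N => b * N) (e := b) fun _ _ => le_rfl).mul h1
        fun N => by have := hY0 N; positivity) fun N => by have := hY0 N; positivity) fun N => by
          have := hY0 N; positivity
    simpa only [zero_add, add_zero] using this
  obtain ⟨N₀, hN₀⟩ := exists_nat_gt (2 * ‖algebraMap K ℂ α‖)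
  have hUV := hU.mul (hV.pow_const hV0 (Module.finrank ℚ K - 1)) fun N => pow_nonneg (hV0 N) _
  refine exists_pow_gt (N₀ := N₀) hUV fun N hN hN1 => ?_
  rw [show 2 + 2 * (Module.finrank ℚ K - 1) + 1 = b by omega]
  have hNR : (1 : ℝ) ≤ N := by exact_mod_cast hN1
  obtain ⟨P, hP0, hPdeg, hPint, hPY, hform⟩ := haux N hN1
  set R : Entire := ∑ i, P i • g i with hR
  have hR0 : R ≠ 0 := by
    intro h0
    exact hP0 (funext fun i => Fintype.linearIndependent_iff.1 hli P (hR.symm.trans h0) i)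
  have hvan : ∃ G : Entire, R = (X - Polynomial.C α : K[X]) ^ (b * N) • G := by
    refine exists_eq_X_sub_C_pow_smul hT _ _ fun k hk => ?_
    rw [hR, iterate_smul_D_sum g T B hsys, sum_smul_apply]
    simp only [hμ, Finset.mul_sum, aeval_algebraMap_apply, coe_aeval_eq_eval]
    rw [Finset.sum_comm]
    refine Finset.sum_eq_zero fun q _ => ?_
    have := congrArg (algebraMap K ℂ) (hform k hk q)
    rw [formEntry, map_sum, map_zero] at this
    simp only [map_mul] at this
    simp only [← mul_assoc, ← Finset.sum_mul, this, zero_mul]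
  have htR : taylor R ≠ 0 := fun h => hR0 (taylor_injective (h.trans (map_zero _).symm))
  set m := (taylor R).order.toNat with hm
  have hXm : PowerSeries.X ^ m ∣ taylor R := PowerSeries.X_pow_order_dvd
  have hmc : PowerSeries.coeff m (taylor R) ≠ 0 := PowerSeries.coeff_order htR
  have hmL : m + 1 ≤ L N := by
    have := hc N P hP0 hPdeg m hXm
    simp only [L, e]
    nlinarith
  obtain ⟨G, hG⟩ := exists_eq_X_pow_mul_smul hα hXm hvan
  have hcoeff := coeff_taylor_eq hG
  have hαN : 2 * ‖algebraMap K ℂ α‖ ≤ N := hN₀.le.trans (by exact_mod_cast hN)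
  have hmax := norm_apply_zero_mul_le hG (ρ := N) (by positivity) hαN
    fun z hz => norm_sum_smul_apply_le hA hPdeg hPY hN1 hz
  set S : ℝ := r * (((N + 1 : ℕ) * (Y N * (N : ℝ) ^ (1 * N))) * (A * Real.exp A ^ N)) with hS
  have hfac := factorial_mul_coeff_taylor_sum_smul hga P m
  set ξ : K := ∑ i, ∑ x ∈ Finset.HasAntidiagonal.antidiagonal m,
        (m.descFactorial x.1 : K) * ((P i).coeff x.1 * a i x.2) with hξ
  have hδm : (δ m : ℝ) ≤ Δ ^ L N := (hδ m).2.1.trans (pow_le_pow_right₀ hΔ1 hmL)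
  have hintegral : IsIntegral ℤ ((δ m : K) * ξ) := by
    rw [hξ, Finset.mul_sum]
    refine IsIntegral.sum _ fun i _ => ?_
    rw [Finset.mul_sum]
    refine IsIntegral.sum _ fun x hx => ?_
    have hx' : x.1 + x.2 = m := Finset.HasAntidiagonal.mem_antidiagonal.1 hx
    rw [mul_left_comm, mul_left_comm (δ m : K)]
    exact (isIntegral_natCast (R := ℤ) (B := K) _).mul ((hPint i _).mul ((hδ m).2.2 i _ (by omega)))
  have hhouse : house ((δ m : K) * ξ) ≤ V N := by
    rw [house_nat_mul]
    exact mul_le_mul hδm (house_sum_antidiagonal_le hC1 hC (hY0 N) hPdeg hPY hmL)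
      (house_nonneg _) (by positivity)
  have hξ0 : (δ m : K) * ξ ≠ 0 := by
    refine mul_ne_zero (by exact_mod_cast (hδ m).1) fun h0 => ?_
    rw [h0, map_zero] at hfac
    exact (mul_ne_zero (by exact_mod_cast m.factorial_ne_zero) hmc) hfac
  have hnorm : ‖algebraMap K ℂ ((δ m : K) * ξ)‖ * (N : ℝ) ^ (b * N) ≤ U N := by
    have h1 : ‖algebraMap K ℂ ((δ m : K) * ξ)‖ =
        δ m * (m.factorial * (‖algebraMap K ℂ α‖ ^ (b * N) * ‖G 0‖)) := by
      rw [map_mul, ← hfac, hcoeff, map_natCast]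
      simp [norm_pow]
    have h2 : (m.factorial : ℝ) ≤ (e : ℝ) ^ L N * (N : ℝ) ^ m := by
      calc (m.factorial : ℝ) ≤ (m : ℝ) ^ m := by exact_mod_cast Nat.factorial_le_pow m
        _ ≤ ((e : ℝ) * N) ^ m := by
            refine pow_le_pow_left₀ (by positivity) ?_ _
            exact_mod_cast (by simp only [L] at hmL; omega : m ≤ e * N)
        _ ≤ _ := by
            rw [mul_pow]
            exact mul_le_mul_of_nonneg_right (pow_le_pow_right₀ he1 (by omega)) (by positivity)
    have h3 : ‖algebraMap K ℂ α‖ ^ (b * N) * (N : ℝ) ^ (b * N) ≤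
        ε ^ (b * N) * ((N : ℝ) / 2) ^ (b * N) := by
      rw [← mul_pow, ← mul_pow]
      refine pow_le_pow_left₀ (by positivity) ?_ _
      have := le_max_right 1 (2 * ‖algebraMap K ℂ α‖)
      nlinarith
    rw [h1]
    calc _ = δ m * (m.factorial * ((‖algebraMap K ℂ α‖ ^ (b * N) * (N : ℝ) ^ (b * N)) * ‖G 0‖)) := by
          ring
      _ ≤ Δ ^ L N * (((e : ℝ) ^ L N * (N : ℝ) ^ m) *
          ((ε ^ (b * N) * ((N : ℝ) / 2) ^ (b * N)) * ‖G 0‖)) := by gcongr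
      _ = (e : ℝ) ^ L N * (Δ ^ L N * (ε ^ (b * N) *
          (‖G 0‖ * ((N : ℝ) ^ m * ((N : ℝ) / 2) ^ (b * N))))) := by ring
      _ ≤ U N := by
          simp only [U]
          gcongr
  have hone := one_le_norm_mul_house_pow hintegral hξ0 (algebraMap K ℂ)
  calc (N : ℝ) ^ (b * N) ≤ (N : ℝ) ^ (b * N) * (‖algebraMap K ℂ ((δ m : K) * ξ)‖ *
        house ((δ m : K) * ξ) ^ (Module.finrank ℚ K - 1)) := le_mul_of_one_le_right (by positivity) hone
    _ = (‖algebraMap K ℂ ((δ m : K) * ξ)‖ * (N : ℝ) ^ (b * N)) *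
        house ((δ m : K) * ξ) ^ (Module.finrank ℚ K - 1) := by ring
    _ ≤ U N * V N ^ (Module.finrank ℚ K - 1) :=
        mul_le_mul hnorm (pow_le_pow_left₀ (house_nonneg _) hhouse _)
          (pow_nonneg (house_nonneg _) _) ((by positivity : (0 : ℝ) ≤ _).trans hnorm)

theorem card_lt_of_linearIndependent {g : Fin r → Entire} {T : K[X]}
    {B : Matrix (Fin r) (Fin r) K[X]} (hsys : ∀ i, T • D (g i) = ∑ j, B i j • g j) {α : K}
    (hα : α ≠ 0) (hT : T.eval α ≠ 0) (hg : ∀ i, IsEType K (g i)) (hli : LinearIndependent K[X] g)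
    {s : ℕ} (hs : 1 ≤ s) {w : Fin s → ℂ} {μ : Fin r → Fin s → K}
    (hμ : ∀ l, g l (algebraMap K ℂ α) = ∑ q, algebraMap K ℂ (μ l q) * w q) :
    r < (2 * Module.finrank ℚ K + 2) * ((2 * Module.finrank ℚ K + 1) * s) := by
  classical
  obtain ⟨δ, hδ0, hδ⟩ := exists_common_denominator ((T.support.image T.coeff) ∪
    Finset.univ.biUnion fun x : Fin r × Fin r => (B x.1 x.2).support.image (B x.1 x.2).coeff)
  have key : ∀ (p : K[X]) (n : ℕ), (∀ k ∈ p.support, IsIntegral ℤ ((δ : K) * p.coeff k)) →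
      IsIntegral ℤ ((C (δ : K) * p).coeff n) := by
    intro p n h
    rw [coeff_C_mul]
    by_cases hn : n ∈ p.support
    · exact h n hn
    · rw [notMem_support_iff.1 hn, mul_zero]
      exact isIntegral_zero
  refine card_lt_of_linearIndependent_of_isIntegral (T := C (δ : K) * T)
    (B := fun i j => C (δ : K) * B i j) (fun i => ?_) hα ?_ hg hli (fun n => key _ _ fun k hk => ?_)
    (fun i j n => key _ _ fun k hk => ?_) hs hμ
  · simp only [mul_smul, hsys, Finset.smul_sum]
  · rw [eval_mul, eval_C]
    exact mul_ne_zero (by exact_mod_cast hδ0) hT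
  · exact hδ _ (Finset.mem_union_left _ (Finset.mem_image_of_mem _ hk))
  · exact hδ _ (Finset.mem_union_right _ (Finset.mem_biUnion.2
      ⟨(i, j), Finset.mem_univ _, Finset.mem_image_of_mem _ hk⟩))

end SiegelShidlovskii

end Entire

namespace Entire

section Values

set_option linter.unusedSectionVars false

variable {K : Type} [Field K] [NumberField K] [Algebra K ℂ] {r : ℕ}

/-- The linear forms in the values of `g` at `a`. -/
def valueMap (g : Fin r → Entire) (a : K) : (Fin r → K) →ₗ[K] ℂ :=
  Fintype.linearCombination K fun i => g i (algebraMap K ℂ a)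

theorem valueMap_apply (g : Fin r → Entire) (a : K) (c : Fin r → K) :
    valueMap g a c = ∑ i, algebraMap K ℂ (c i) * g i (algebraMap K ℂ a) := by
  simp [valueMap, Fintype.linearCombination_apply, Algebra.smul_def]

theorem valueMap_eval (g : Fin r → Entire) (a : K) (p : Fin r → K[X]) :
    valueMap g a (fun i => (p i).eval a) = (∑ i, p i • g i : Entire) (algebraMap K ℂ a) := by
  rw [valueMap_apply, sum_smul_apply]
  simp only [aeval_algebraMap_apply, coe_aeval_eq_eval]

theorem card_le_mul_finrank_range_valueMap {g : Fin r → Entire} {T : K[X]}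
    (hsys : ∀ i, T • D (g i) ∈ Submodule.span K[X] (Set.range g)) {a : K} (ha : a ≠ 0)
    (hT : T.eval a ≠ 0) (hg : ∀ i, IsEType K (g i)) (hli : LinearIndependent K[X] g) :
    r ≤ (2 * Module.finrank ℚ K + 2) * (2 * Module.finrank ℚ K + 1) *
      Module.finrank K (valueMap g a).range := by
  choose B hB using fun i => (Submodule.mem_span_range_iff_exists_fun K[X]).1 (hsys i)
  rcases Nat.eq_zero_or_pos r with rfl | hr
  · exact Nat.zero_le _
  have hmem : ∀ i, g i (algebraMap K ℂ a) ∈ (valueMap g a).range := fun i =>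
    ⟨Pi.single i 1, by
      rw [valueMap_apply, Finset.sum_eq_single i] <;> simp +contextual [Pi.single_eq_of_ne]⟩
  have hsys' : ∀ i, T • D (g i) = ∑ j, Matrix.of B i j • g j := fun i => (hB i).symm
  have hs : 1 ≤ Module.finrank K (valueMap g a).range := by
    by_contra h
    have h0 : (valueMap g a).range = ⊥ := Submodule.finrank_eq_zero.1 (by omega)
    refine hli.ne_zero ⟨0, hr⟩ (eq_zero_of_forall_apply_eq_zero g T _ hsys' hT (fun i => ?_) _)
    have := hmem i
    rwa [h0, Submodule.mem_bot] at this
  let b := Module.finBasis K (valueMap g a).range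
  have := card_lt_of_linearIndependent hsys' ha hT hg hli hs (w := fun q => (b q : ℂ))
    (μ := fun l q => b.repr ⟨_, hmem l⟩ q) fun l => by
      have := congrArg Subtype.val (b.sum_repr ⟨_, hmem l⟩)
      rw [AddSubmonoidClass.coe_finsetSum] at this
      exact this.symm.trans (Finset.sum_congr rfl fun q _ => Algebra.smul_def _ _)
  rw [mul_assoc]
  exact this.le

end Values

section Lifting

set_option linter.unusedSectionVars false

variable {K : Type} [Field K] [NumberField K] [Algebra K ℂ] {n : ℕ} {f : Fin n → Entire}

theorem exists_homSpan_basis (f : Fin n → Entire) (N : ℕ) :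
    ∃ r : ℕ, ∃ g : Fin r → Entire, r ≤ (N + 1) ^ n ∧ LinearIndependent K[X] g ∧
      Submodule.span K[X] (Set.range g) = homSpan K f N := by
  classical
  obtain ⟨r, g, hr, hg, h⟩ :=
    exists_linearIndependent_span_eq (R := K[X]) ((expSet n N).image (mono f))
  refine ⟨r, g, hr.trans (Finset.card_image_le.trans (card_expSet_le n N)), hg, h.trans ?_⟩
  rw [homSpan, Finset.coe_image]

theorem IsEType.mem_rational {g : Entire} (hg : IsEType K g) : g ∈ rational K := by
  obtain ⟨a, -, ha⟩ := hg
  refine ⟨PowerSeries.mk fun n => a n / n.factorial, ?_⟩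
  ext n
  rw [ha, PowerSeries.coeff_map, PowerSeries.coeff_mk, map_div₀, map_natCast]

theorem isEType_of_mem_homSpan (hf : ∀ i, IsEType K (f i)) {N : ℕ} {x : Entire}
    (hx : x ∈ homSpan K f N) : IsEType K x := by
  have h : homSpan K f N ≤ Subalgebra.toSubmodule (eType K) := by
    rw [homSpan, Submodule.span_le]
    rintro _ ⟨m, -, rfl⟩
    exact Subalgebra.prod_mem _ fun i _ => Subalgebra.pow_mem _ (hf i) _
  exact h hx

theorem card_add_finrank_le (hf : ∀ i, IsEType K (f i)) {T : K[X]}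
    (hfD : ∀ i, T • D (f i) ∈ homSpan K f 1) {a : K} (ha : a ≠ 0) (hTa : T.eval a ≠ 0) {d : ℕ}
    {x : Entire} (hx : x ∈ homSpan K f d) (hxa : x (algebraMap K ℂ a) = 0)
    (hne : ¬ ∃ x' ∈ homSpan K f d, x = (X - C a : K[X]) • x') {N r s : ℕ} {g : Fin r → Entire}
    {h : Fin s → Entire} (hg : LinearIndependent K[X] g)
    (hgs : Submodule.span K[X] (Set.range g) = homSpan K f N)
    (hhs : Submodule.span K[X] (Set.range h) = homSpan K f (d + N)) :
    r + Module.finrank K (valueMap h a).range ≤ s := by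
  have hgm : ∀ i, g i ∈ homSpan K f N := fun i => hgs ▸ Submodule.subset_span ⟨i, rfl⟩
  have hhm : ∀ i, h i ∈ homSpan K f (d + N) := fun i => hhs ▸ Submodule.subset_span ⟨i, rfl⟩
  choose q hq using fun i => (Submodule.mem_span_range_iff_exists_fun K[X]).1
    (hhs.symm ▸ mul_mem_homSpan K f hx (hgm i))
  have hcomb : ∀ c : Fin r → K, x * ∑ i, (C (c i) : K[X]) • g i =
      ∑ j, (∑ i, C (c i) * q i j) • h j := by
    intro c
    simp only [Finset.mul_sum, mul_smul_comm, ← hq, Finset.smul_sum, smul_smul, Finset.sum_smul]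
    exact Finset.sum_comm
  let φ : (Fin r → K) →ₗ[K] (Fin s → K) :=
    Fintype.linearCombination K fun i j => (q i j).eval a
  have hφ : ∀ c j, φ c j = (∑ i, C (c i) * q i j).eval a := by
    intro c j
    simp [φ, Fintype.linearCombination_apply, eval_finsetSum]
  have hinj : Function.Injective φ := by
    rw [← LinearMap.ker_eq_bot, LinearMap.ker_eq_bot']
    intro c hc
    have hdvd : ∀ j, ∃ p : K[X], ∑ i, C (c i) * q i j = (X - C a) * p := fun j =>
      dvd_iff_isRoot.2 (by rw [IsRoot, ← hφ, hc, Pi.zero_apply])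
    choose p hp using hdvd
    have hxy : x * ∑ i, (C (c i) : K[X]) • g i = (X - C a : K[X]) • ∑ j, p j • h j := by
      rw [hcomb, Finset.smul_sum]
      exact Finset.sum_congr rfl fun j _ => by rw [hp, mul_smul]
    obtain ⟨y', hy', hy⟩ := (homSpan_prime K f (fun i => (hf i).mem_rational) T hfD ha hTa hx
      (Submodule.sum_mem _ fun i _ => Submodule.smul_mem _ _ (hgm i))
      (Submodule.sum_mem _ fun j _ => Submodule.smul_mem _ _ (hhm j)) hxy).resolve_left hne
    obtain ⟨p', hp'⟩ := (Submodule.mem_span_range_iff_exists_fun K[X]).1 (hgs.symm ▸ hy')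
    have hz : ∑ i, (C (c i) - (X - C a) * p' i) • g i = 0 := by
      have : ∀ i, (C (c i) - (X - C a) * p' i) • g i =
          (C (c i) : K[X]) • g i - (X - C a : K[X]) • (p' i • g i) := fun i =>
        (sub_smul (C (c i) : K[X]) ((X - C a) * p' i) (g i)).trans (by rw [mul_smul])
      rw [Finset.sum_congr rfl fun i _ => this i, Finset.sum_sub_distrib, ← Finset.smul_sum, hp',
        hy, sub_self]
    funext i
    have := congrArg (Polynomial.eval a) (Fintype.linearIndependent_iff.1 hg _ hz i)
    simpa using this
  have hker : φ.range ≤ (valueMap h a).ker := by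
    rintro _ ⟨c, rfl⟩
    rw [LinearMap.mem_ker, funext (hφ c), valueMap_eval, ← hcomb]
    change x _ * _ = 0
    rw [hxa, zero_mul]
  have h1 := (valueMap h a).finrank_range_add_finrank_ker
  have h2 := LinearMap.finrank_range_of_inj hinj
  have h3 := Submodule.finrank_mono hker
  simp only [Module.finrank_fintype_fun_eq_card, Fintype.card_fin] at h1 h2
  omega

theorem not_forall_pow_le {κ : ℕ} (hκ : 2 ≤ κ) (d n : ℕ) :
    ¬ ∀ k : ℕ, κ ^ k ≤ (κ - 1) ^ k * (d * k + 1) ^ n := by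
  intro h
  have hκ1 : (0 : ℝ) < (κ - 1 : ℕ) := by exact_mod_cast (by omega : 0 < κ - 1)
  set ρ : ℝ := κ / (κ - 1 : ℕ) with hρ
  have hρ1 : 1 < ρ := by
    rw [hρ, one_lt_div hκ1]
    exact_mod_cast (by omega : κ - 1 < κ)
  have h1 : Filter.Tendsto (fun k : ℕ => (k : ℝ) ^ n / ρ ^ k) Filter.atTop (nhds 0) :=
    tendsto_pow_const_div_const_pow_of_one_lt n hρ1
  have h2 : ∀ k : ℕ, 1 ≤ k → 1 ≤ ((d + 1 : ℕ) : ℝ) ^ n * ((k : ℝ) ^ n / ρ ^ k) := by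
    intro k hk
    rw [← mul_div_assoc, le_div_iff₀ (by positivity), one_mul, hρ, div_pow,
      div_le_iff₀ (by positivity), ← mul_pow, mul_comm]
    calc (κ : ℝ) ^ k ≤ ((κ - 1 : ℕ) : ℝ) ^ k * ((d * k + 1 : ℕ) : ℝ) ^ n := by exact_mod_cast h k
      _ ≤ _ := by
          gcongr
          exact_mod_cast (by nlinarith : d * k + 1 ≤ (d + 1) * k)
  have h3 := h1.const_mul (((d + 1 : ℕ) : ℝ) ^ n)
  rw [mul_zero] at h3
  have := ge_of_tendsto h3 (Filter.eventually_atTop.2 ⟨1, h2⟩)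
  linarith

theorem exists_mem_homSpan_of_apply_eq_zero (hf : ∀ i, IsEType K (f i)) {T : K[X]}
    (hfD : ∀ i, T • D (f i) ∈ homSpan K f 1) {a : K} (ha : a ≠ 0) (hTa : T.eval a ≠ 0) {d : ℕ}
    {x : Entire} (hx : x ∈ homSpan K f d) (hxa : x (algebraMap K ℂ a) = 0) :
    ∃ x' ∈ homSpan K f d, x = (X - C a : K[X]) • x' := by
  by_contra hne
  choose r g hr hg hgs using exists_homSpan_basis (K := K) f
  set κ := (2 * Module.finrank ℚ K + 2) * (2 * Module.finrank ℚ K + 1) with hκ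
  have hκ2 : 2 ≤ κ := by rw [hκ]; nlinarith
  have hgm : ∀ N i, g N i ∈ homSpan K f N := fun N i => hgs N ▸ Submodule.subset_span ⟨i, rfl⟩
  have hstep : ∀ N, κ * r N ≤ (κ - 1) * r (d + N) := by
    intro N
    have h1 := card_add_finrank_le hf hfD ha hTa hx hxa hne (hg N) (hgs N) (hgs (d + N))
    have h2 := card_le_mul_finrank_range_valueMap (g := g (d + N)) (T := T) (fun i => by
      rw [hgs]
      exact smul_D_mem_homSpan K f T hfD _ _ (hgm _ i)) ha hTa
      (fun i => isEType_of_mem_homSpan hf (hgm _ i)) (hg (d + N))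
    rw [← hκ] at h2
    have h3 := Nat.mul_le_mul_left κ h1
    rw [Nat.sub_mul, one_mul]
    rw [mul_add] at h3
    omega
  have hr0 : 1 ≤ r 0 := by
    by_contra h
    have h1 : (1 : Entire) ∈ homSpan K f 0 := by
      have := mono_mem K f (N := 0) (m := 0) (by simp)
      simpa [mono] using this
    rw [← hgs 0] at h1
    have : IsEmpty (Fin (r 0)) := ⟨fun i => absurd i.2 (by omega)⟩
    rw [Set.range_eq_empty, Submodule.span_empty, Submodule.mem_bot] at h1
    exact one_ne_zero h1
  refine not_forall_pow_le hκ2 d n fun k => ?_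
  have : κ ^ k ≤ (κ - 1) ^ k * r (d * k) := by
    induction k with
    | zero => simpa using hr0
    | succ k ih =>
      calc κ ^ (k + 1) = κ * κ ^ k := pow_succ' _ _
        _ ≤ κ * ((κ - 1) ^ k * r (d * k)) := Nat.mul_le_mul_left _ ih
        _ = (κ - 1) ^ k * (κ * r (d * k)) := by ring
        _ ≤ (κ - 1) ^ k * ((κ - 1) * r (d + d * k)) := Nat.mul_le_mul_left _ (hstep _)
        _ = _ := by rw [pow_succ, mul_assoc, show d + d * k = d * (k + 1) by ring]
  exact this.trans (Nat.mul_le_mul_left _ (hr _))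

end Lifting

end Entire

theorem exists_nat_forall_eval_ne_zero {q : ℂ[X]} (hq : q ≠ 0) :
    ∃ n₀ : ℕ, ∀ n : ℕ, n₀ ≤ n → q.eval (n : ℂ) ≠ 0 := by
  have hfin : {n : ℕ | q.eval (n : ℂ) = 0}.Finite := by
    refine Set.Finite.subset ((q.roots.toFinset.finite_toSet).preimage
      (Nat.cast_injective (R := ℂ)).injOn) fun n hn => ?_
    simpa [hq] using hn
  obtain ⟨b, hb⟩ := hfin.bddAbove
  exact ⟨b + 1, fun n hn h => absurd (hb h) (by omega)⟩

theorem exists_finiteDimensional_of_recurrence {a : ℕ → ℂ} (ha : ∀ n, IsAlgebraic ℚ (a n))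
    {S : Finset (ℕ × ℕ)} (hS : S.Nonempty) {c : ℕ × ℕ → ℂ} (hc : ∀ s ∈ S, c s ≠ 0)
    (hcalg : ∀ s, IsAlgebraic ℚ (c s)) {b : ℕ} (hb : ∀ s ∈ S, s.2 ≤ b)
    (h : ∀ n : ℕ, ∑ s ∈ S, c s * (n + b).descFactorial s.2 * a (n + b + s.1 - s.2) = 0) :
    ∃ K : IntermediateField ℚ ℂ, FiniteDimensional ℚ K ∧ ∀ n, a n ∈ K := by
  classical
  obtain ⟨s₀, hs₀, hmax⟩ := S.exists_max_image (fun s => b + s.1 - s.2) hS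
  set t := b + s₀.1 - s₀.2 with ht
  set R := S.filter fun s => b + s.1 - s.2 = t
  set q : ℂ[X] := ∑ s ∈ R, C (c s) * descPochhammer ℂ s.2 with hq
  have hqe (N : ℕ) : q.eval (N : ℂ) = ∑ s ∈ R, c s * N.descFactorial s.2 := by
    simp [hq, eval_finsetSum, descPochhammer_eval_eq_descFactorial]
  have hs₀R : s₀ ∈ R := Finset.mem_filter.2 ⟨hs₀, rfl⟩
  have hq0 : q ≠ 0 := by
    obtain ⟨s₁, hs₁, hmin⟩ := R.exists_min_image (fun s => s.2) ⟨s₀, hs₀R⟩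
    intro h0
    have h1 := hqe s₁.2
    rw [h0, eval_zero, Finset.sum_eq_single_of_mem s₁ hs₁] at h1
    · rw [Nat.descFactorial_self] at h1
      exact mul_ne_zero (hc _ (Finset.mem_filter.1 hs₁).1)
        (Nat.cast_ne_zero.2 (Nat.factorial_ne_zero _)) h1.symm
    · intro s hs hne
      have h2 := hmin s hs
      have h3 := (Finset.mem_filter.1 hs).2
      have h4 := (Finset.mem_filter.1 hs₁).2
      have h5 := hb s (Finset.mem_filter.1 hs).1
      have h6 := hb s₁ (Finset.mem_filter.1 hs₁).1
      have h7 : s₁.2 < s.2 := by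
        refine lt_of_le_of_ne h2 fun h8 => hne (Prod.ext ?_ h8.symm)
        omega
      rw [Nat.descFactorial_eq_zero_iff_lt.2 h7]
      simp
  obtain ⟨n₀, hn₀⟩ := exists_nat_forall_eval_ne_zero hq0
  let G : Finset ℂ := S.image c ∪ (Finset.range (n₀ + t)).image a
  refine ⟨IntermediateField.adjoin ℚ (G : Set ℂ),
    IntermediateField.finiteDimensional_adjoin fun x hx => ?_, fun n => ?_⟩
  · rcases Finset.mem_union.1 (Finset.mem_coe.1 hx) with hx | hx
    · obtain ⟨s, -, rfl⟩ := Finset.mem_image.1 hx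
      exact (hcalg s).isIntegral
    · obtain ⟨s, -, rfl⟩ := Finset.mem_image.1 hx
      exact (ha s).isIntegral
  set K := IntermediateField.adjoin ℚ (G : Set ℂ)
  have hcK (s) (hs : s ∈ S) : c s ∈ K := IntermediateField.subset_adjoin _ _
    (Finset.mem_coe.2 (Finset.mem_union_left _ (Finset.mem_image_of_mem _ hs)))
  induction n using Nat.strong_induction_on with
  | _ n ih =>
    by_cases hn : n < n₀ + t
    · exact IntermediateField.subset_adjoin _ _ (Finset.mem_coe.2
        (Finset.mem_union_right _ (Finset.mem_image_of_mem _ (Finset.mem_range.2 hn))))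
    obtain ⟨k, rfl⟩ : ∃ k, n = k + t := ⟨n - t, by omega⟩
    have h1 := h k
    rw [← Finset.sum_filter_add_sum_filter_not S (fun s => b + s.1 - s.2 = t)] at h1
    have h2 : ∑ s ∈ R, c s * (k + b).descFactorial s.2 * a (k + b + s.1 - s.2)
        = q.eval ((k + b : ℕ) : ℂ) * a (k + t) := by
      rw [hqe, Finset.sum_mul]
      refine Finset.sum_congr rfl fun s hs => ?_
      have h3 := (Finset.mem_filter.1 hs).2
      have h5 := hb s (Finset.mem_filter.1 hs).1
      rw [show k + b + s.1 - s.2 = k + t by omega]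
    rw [h2] at h1
    have h3 : q.eval ((k + b : ℕ) : ℂ) ≠ 0 := hn₀ _ (by omega)
    have h4 : a (k + t) = -(∑ s ∈ S.filter fun s => ¬ b + s.1 - s.2 = t,
        c s * (k + b).descFactorial s.2 * a (k + b + s.1 - s.2)) / q.eval ((k + b : ℕ) : ℂ) := by
      rw [eq_div_iff h3, mul_comm]
      exact eq_neg_of_add_eq_zero_left h1
    rw [h4]
    refine div_mem (neg_mem (sum_mem fun s hs => ?_)) ?_
    · have h5 := (Finset.mem_filter.1 hs)
      have h6 := hb s h5.1
      have h7 := hmax s h5.1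
      exact mul_mem (mul_mem (hcK _ h5.1) (natCast_mem _ _)) (ih _ (by omega))
    · rw [hqe]
      exact sum_mem fun s hs => mul_mem (hcK _ (Finset.mem_filter.1 hs).1) (natCast_mem _ _)

namespace Entire

theorem differentiable_of_hasSum {c : ℕ → ℂ} {f : ℂ → ℂ}
    (h : ∀ z, HasSum (fun n => c n * z ^ n) (f z)) : Differentiable ℂ f := by
  intro z
  set r : ℝ := ‖z‖ + 1
  have hr : 0 ≤ r := by positivity
  have h1 : DifferentiableOn ℂ (fun w => ∑' n, c n * w ^ n) (Metric.ball 0 r) := by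
    refine Complex.differentiableOn_tsum_of_summable_norm (h (r : ℂ)).summable.norm
      (fun n => ((differentiable_id.pow n).const_mul (c n)).differentiableOn)
      Metric.isOpen_ball fun n w hw => ?_
    rw [norm_mul, norm_mul, norm_pow, norm_pow, Complex.norm_of_nonneg hr]
    have : ‖w‖ ≤ r := (mem_ball_zero_iff.1 hw).le
    gcongr
  have h2 : (fun w => ∑' n, c n * w ^ n) = f := funext fun w => (h w).tsum_eq
  rw [h2] at h1
  exact h1.differentiableAt (Metric.isOpen_ball.mem_nhds (by simp [r]))

theorem coeff_taylor_of_hasSum {c : ℕ → ℂ} {f : Entire}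
    (h : ∀ z, HasSum (fun n => c n * z ^ n) (f z)) (n : ℕ) :
    PowerSeries.coeff n (taylor f) = c n := by
  have key (e : ℕ → ℂ) (he : ∀ z, HasSum (fun n => e n * z ^ n) (f z)) :
      HasFPowerSeriesAt f.1 (FormalMultilinearSeries.ofScalars ℂ e) 0 := by
    rw [hasFPowerSeriesAt_iff]
    refine Filter.Eventually.of_forall fun z => ?_
    simpa [FormalMultilinearSeries.coeff_ofScalars, mul_comm] using he z
  have := (key _ (hasSum_taylor f)).eq_formalMultilinearSeries (key c h)
  have h2 := congrArg (fun p => FormalMultilinearSeries.coeff p n) this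
  simpa [FormalMultilinearSeries.coeff_ofScalars] using h2

theorem factorial_mul_coeff_taylor_iterate_D (f : Entire) (j k : ℕ) :
    k.factorial * PowerSeries.coeff k (taylor (D^[j] f)) =
      (k + j).factorial * PowerSeries.coeff (k + j) (taylor f) := by
  have (g : Entire) (m : ℕ) :
      m.factorial * PowerSeries.coeff m (taylor g) = (D^[m] g) 0 := by
    rw [coeff_taylor, D_iterate_apply, mul_div_cancel₀]
    exact Nat.cast_ne_zero.2 (Nat.factorial_ne_zero _)
  rw [this, this, Function.iterate_add_apply]

theorem recurrence_of_differential_equation {f : Entire} {r : ℕ} {p : ℕ → ℂ[X]}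
    (h : ∑ j ∈ Finset.range r, p j • D^[j] f = 0) {b : ℕ} (hb : ∀ j, (p j).natDegree ≤ b) (n : ℕ) :
    ∑ s ∈ Finset.range r ×ˢ Finset.range (b + 1), (p s.1).coeff s.2 * (n + b).descFactorial s.2 *
      ((n + b + s.1 - s.2).factorial * PowerSeries.coeff (n + b + s.1 - s.2) (taylor f)) = 0 := by
  have h1 := congrArg (fun g => ((n + b).factorial : ℂ) * PowerSeries.coeff (n + b) (taylor g)) h
  simp only [map_sum, map_zero, mul_zero, Finset.mul_sum, taylor_smul_poly] at h1
  rw [Finset.sum_product, ← h1]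
  refine Finset.sum_congr rfl fun j _ => ?_
  rw [PowerSeries.coeff_mul, Finset.Nat.sum_antidiagonal_eq_sum_range_succ_mk, Finset.mul_sum]
  refine Finset.sum_subset_zero_on_sdiff (Finset.range_mono (by omega)) (fun l hl => ?_)
    fun l hl => ?_
  · have : (p j).coeff l = 0 := coeff_eq_zero_of_natDegree_lt
      ((hb j).trans_lt (by simp at hl; omega))
    simp [this]
  · have hl' : l ≤ n + b := by simp at hl; omega
    simp only
    rw [show n + b + j - l = n + b - l + j by omega, ← factorial_mul_coeff_taylor_iterate_D,
      ← Nat.factorial_mul_descFactorial hl']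
    push_cast
    simp
    ring

/-- The Taylor data of a solution of a linear differential equation with algebraic
coefficients lie in a number field as soon as they are algebraic. -/
theorem exists_finiteDimensional_of_differential_equation {f : Entire} {a : ℕ → ℂ}
    (ha : ∀ n, IsAlgebraic ℚ (a n))
    (haf : ∀ n, PowerSeries.coeff n (taylor f) = a n / n.factorial) {r : ℕ} {p : ℕ → ℂ[X]}
    (hp : ∀ j i, IsAlgebraic ℚ ((p j).coeff i)) (hp0 : ∃ j < r, p j ≠ 0)
    (hpr : ∀ j, r ≤ j → p j = 0)
    (h : ∑ j ∈ Finset.range r, p j • D^[j] f = 0) :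
    ∃ K : IntermediateField ℚ ℂ, FiniteDimensional ℚ K ∧ ∀ n, a n ∈ K := by
  classical
  set b := (Finset.range r).sup fun j => (p j).natDegree
  have hb (j) : (p j).natDegree ≤ b := by
    by_cases hj : j < r
    · exact Finset.le_sup (f := fun j => (p j).natDegree) (Finset.mem_range.2 hj)
    · simp [hpr j (not_lt.1 hj)]
  have hrec := recurrence_of_differential_equation h hb
  refine exists_finiteDimensional_of_recurrence ha (b := b)
    (S := (Finset.range r ×ˢ Finset.range (b + 1)).filter fun s => (p s.1).coeff s.2 ≠ 0)
    (c := fun s => (p s.1).coeff s.2) ?_ (fun s hs => (Finset.mem_filter.1 hs).2)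
    (fun s => hp _ _) (fun s hs => ?_) fun n => ?_
  · obtain ⟨j, hj, hj0⟩ := hp0
    refine ⟨(j, (p j).natDegree), ?_⟩
    simp [hj, hj0, hb]
  · have := (Finset.mem_filter.1 hs).1
    simp at this
    omega
  · refine Eq.trans ?_ (hrec n)
    rw [Finset.sum_filter]
    refine Finset.sum_congr rfl fun s _ => ?_
    rw [haf, mul_div_cancel₀ _ (Nat.cast_ne_zero.2 (Nat.factorial_ne_zero _))]
    split_ifs with h0
    · rfl
    · rw [not_not.1 h0]; simp

end Entire

theorem exists_ringHom_comp_eq {K L : Type*} [Field K] [CharZero K] [Field L] [CharZero L]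
    [Algebra.IsAlgebraic ℚ L] (i : K →+* L) (σ : K →+* ℂ) : ∃ τ : L →+* ℂ, τ.comp i = σ := by
  let _ := i.toAlgebra
  let _ := σ.toAlgebra
  have : IsScalarTower ℚ K L := .of_algebraMap_eq' (Subsingleton.elim _ _)
  have : Algebra.IsAlgebraic K L := Algebra.IsAlgebraic.tower_top (K := ℚ) K
  exact ⟨(IsAlgClosed.lift (R := K) (S := L) (M := ℂ)).toRingHom, AlgHom.comp_algebraMap _⟩

theorem house_le_of_forall_norm_le {K : Type*} [Field K] [NumberField K] {x : K} {c : ℝ}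
    (h : ∀ σ : K →+* ℂ, ‖σ x‖ ≤ c) : NumberField.house x ≤ c := by
  rw [NumberField.house, NumberField.canonicalEmbedding.norm_le_iff]
  exact h

namespace Entire

theorem exists_isEType_of_isEFunctionWith {a : ℕ → Qbar} {f : Entire}
    (h : IsEFunctionWith a f) {K : IntermediateField ℚ ℂ} [NumberField K]
    (hK : ∀ n, (a n : ℂ) ∈ K) : IsEType K f := by
  obtain ⟨hsum, ⟨C, hC, hCa⟩, ⟨D, hD, d, hd, hda⟩, -⟩ := h
  have hle : K ≤ Qbar := fun x hx =>
    mem_algebraicClosure_iff.2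
      ((Algebra.IsAlgebraic.isAlgebraic (R := ℚ) (⟨x, hx⟩ : K)).algebraMap (A := ℂ))
  refine ⟨fun n => ⟨a n, hK n⟩, ⟨⟨max C 1, le_max_right _ _, fun n => ?_⟩,
    max D 1, le_max_right _ _, d, fun n => ⟨(hd n).1, (hd n).2.trans ?_, fun m hm => ?_⟩⟩,
    coeff_taylor_of_hasSum hsum⟩
  · refine house_le_of_forall_norm_le fun σ => ?_
    have : Algebra.IsAlgebraic ℚ Qbar := ⟨fun x =>
      (isAlgebraic_algebraMap_iff (algebraMap Qbar ℂ).injective).1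
        (mem_algebraicClosure_iff.1 x.2)⟩
    obtain ⟨τ, hτ⟩ := exists_ringHom_comp_eq (IntermediateField.inclusion hle).toRingHom σ
    rw [← hτ]
    refine le_trans (hCa τ n) ?_
    gcongr
    exact le_max_left _ _
  · gcongr
    exact le_max_left _ _
  · refine (isIntegral_algebraMap_iff (algebraMap K ℂ).injective).1 ?_
    simpa using hda n m hm

end Entire

theorem exists_map_eq_of_coeff_mem {K : IntermediateField ℚ ℂ} {p : ℂ[X]}
    (h : ∀ k, p.coeff k ∈ K) : ∃ q : K[X], q.map (algebraMap K ℂ) = p := by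
  rw [← mem_lifts, lifts_iff_coeff_lifts]
  exact fun k => ⟨⟨_, h k⟩, rfl⟩

/-- Finitely many E-functions, together with finitely many algebraic numbers, are
defined over a common number field. -/
theorem exists_numberField_isEType {n : ℕ} {F : Fin n → Entire}
    (hF : ∀ i, IsEFunction (F i)) {S : Set ℂ} (hS : S.Finite) (hSalg : ∀ x ∈ S, IsAlgebraic ℚ x) :
    ∃ K : IntermediateField ℚ ℂ, ∃ _ : NumberField K, S ⊆ K ∧ ∀ i, Entire.IsEType K (F i) := by
  choose a ha using hF
  have hfield (i) : ∃ K : IntermediateField ℚ ℂ, FiniteDimensional ℚ K ∧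
      ∀ n, (a i n : ℂ) ∈ K := by
    obtain ⟨r, p, hp, ⟨j, hj⟩, h⟩ := (ha i).2.2.2
    refine Entire.exists_finiteDimensional_of_differential_equation (f := F i)
      (fun n => mem_algebraicClosure_iff.1 (a i n).2)
      (Entire.coeff_taylor_of_hasSum (ha i).1) (r := r + 1)
      (p := fun k => if hk : k < r + 1 then p ⟨k, hk⟩ else 0) (fun k l => ?_)
      ⟨j, j.2, by rwa [dif_pos j.2]⟩ (fun k hk => dif_neg (not_lt.2 hk)) ?_
    · split_ifs
      · exact hp _ _
      · simpa using isAlgebraic_zero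
    · rw [Finset.sum_range]
      refine Entire.ext fun z => ?_
      rw [Entire.sum_smul_apply, Entire.zero_apply, ← h z]
      refine Finset.sum_congr rfl fun k _ => ?_
      rw [dif_pos k.2, Entire.D_iterate_apply, coe_aeval_eq_eval]
  choose L hL haL using hfield
  have hfin : FiniteDimensional ℚ (IntermediateField.adjoin ℚ S) := by
    have := hS.to_subtype
    exact IntermediateField.finiteDimensional_adjoin fun x hx => (hSalg x hx).isIntegral
  have hfin2 : FiniteDimensional ℚ (⨆ i, L i : IntermediateField ℚ ℂ) :=
    IntermediateField.finiteDimensional_iSup_of_finite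
  have hfin3 := IntermediateField.finiteDimensional_sup (IntermediateField.adjoin ℚ S) (⨆ i, L i)
  have hK : NumberField (IntermediateField.adjoin ℚ S ⊔ ⨆ i, L i : IntermediateField ℚ ℂ) :=
    { to_charZero := inferInstance, to_finiteDimensional := hfin3 }
  refine ⟨_, hK, (IntermediateField.subset_adjoin ℚ S).trans
    (SetLike.coe_subset_coe.2 le_sup_left), fun i => ?_⟩
  exact Entire.exists_isEType_of_isEFunctionWith (ha i) fun n =>
    (le_iSup L i |>.trans le_sup_right) (haL i n)

/-- **Beukers' refinement of the Siegel–Shidlovskii theorem (2006).**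
If the E-functions `f 0, …, f (n-1)` satisfy the differential system `Y' = A Y` with
`A` an `n × n` matrix over `ℚ̄(z)` (given here by `A = B / T` where `B = T·A` has
polynomial entries with algebraic coefficients), `α` is algebraic with `α·T(α) ≠ 0`,
and `P ∈ ℚ̄[X_1,…,X_n]` is homogeneous with `P(f 0 (α), …, f (n-1) (α)) = 0`, then
there is `Q ∈ ℚ̄[Z][X_1,…,X_n]`, homogeneous in the `Xᵢ`, with `Q(α, X) = P(X)` and
`Q(z, f 0 (z), …, f (n-1) (z)) = 0` identically. -/
theorem beukers_lifting (n : ℕ) (f : Fin n → ℂ → ℂ)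
    (hf : ∀ i, IsEFunction (f i))
    (B : Matrix (Fin n) (Fin n) (Polynomial ℂ))
    (hB : ∀ i j k, IsAlgebraic ℚ ((B i j).coeff k))
    (T : Polynomial ℂ) (hT : T ≠ 0) (hTalg : ∀ k, IsAlgebraic ℚ (T.coeff k))
    (hsys : ∀ i, ∀ z : ℂ, T.eval z * deriv (f i) z = ∑ j, (B i j).eval z * f j z)
    (α : ℂ) (hα : IsAlgebraic ℚ α) (hreg : α * T.eval α ≠ 0)
    (P : MvPolynomial (Fin n) ℂ) (d : ℕ)
    (hPalg : ∀ m : Fin n →₀ ℕ, IsAlgebraic ℚ (P.coeff m))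
    (hPhom : P.IsHomogeneous d)
    (hPvan : MvPolynomial.eval (fun i => f i α) P = 0) :
    ∃ Q : MvPolynomial (Fin n) (Polynomial ℂ),
      (∀ m : Fin n →₀ ℕ, ∀ k : ℕ, IsAlgebraic ℚ ((Q.coeff m).coeff k)) ∧
      Q.IsHomogeneous d ∧
      MvPolynomial.map (Polynomial.evalRingHom α) Q = P ∧
      ∀ z : ℂ, MvPolynomial.eval (fun i => f i z)
        (MvPolynomial.map (Polynomial.evalRingHom z) Q) = 0 := by
  classical
  have hdiff (i) : Differentiable ℂ (f i) :=
    Entire.differentiable_of_hasSum (hf i).choose_spec.1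
  let F : Fin n → Entire := fun i => ⟨f i, hdiff i⟩
  let S : Set ℂ := {α} ∪ (Set.range P.coeff ∪ (Set.range T.coeff ∪
    ⋃ i, ⋃ j, Set.range (B i j).coeff))
  have hcoeff (p : ℂ[X]) : (Set.range p.coeff).Finite := by
    refine ((p.support.image p.coeff) ∪ {0}).finite_toSet.subset ?_
    rintro _ ⟨k, rfl⟩
    by_cases hk : p.coeff k = 0
    · simp [hk]
    · exact Finset.mem_coe.2 (Finset.mem_union_left _
        (Finset.mem_image_of_mem _ (mem_support_iff.2 hk)))
  have hPfin : (Set.range P.coeff).Finite := by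
    refine ((P.support.image P.coeff) ∪ {0}).finite_toSet.subset ?_
    rintro _ ⟨k, rfl⟩
    by_cases hk : P.coeff k = 0
    · simp [hk]
    · exact Finset.mem_coe.2 (Finset.mem_union_left _
        (Finset.mem_image_of_mem _ (MvPolynomial.mem_support_iff.2 hk)))
  have hSfin : S.Finite := (Set.finite_singleton _).union (hPfin.union ((hcoeff T).union
    (Set.finite_iUnion fun i => Set.finite_iUnion fun j => hcoeff _)))
  obtain ⟨K, hKn, hSK, hFE⟩ := exists_numberField_isEType (F := F) hf hSfin (by
    rintro x (hx | ⟨m, rfl⟩ | ⟨k, rfl⟩ | hx)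
    · rwa [Set.mem_singleton_iff.1 hx]
    · exact hPalg m
    · exact hTalg k
    · simp only [Set.mem_iUnion] at hx
      obtain ⟨i, j, k, rfl⟩ := hx
      exact hB i j k)
  have hαK : α ∈ K := hSK (Or.inl rfl)
  have hPK (m) : P.coeff m ∈ K := hSK (Or.inr (Or.inl ⟨m, rfl⟩))
  obtain ⟨T', hT'⟩ := exists_map_eq_of_coeff_mem (K := K) (p := T)
    fun k => hSK (Or.inr (Or.inr (Or.inl ⟨k, rfl⟩)))
  have hB' (i j) := exists_map_eq_of_coeff_mem (K := K) (p := B i j)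
    fun k => hSK (Or.inr (Or.inr (Or.inr (Set.mem_iUnion.2 ⟨i, Set.mem_iUnion.2 ⟨j, k, rfl⟩⟩))))
  choose B' hB' using hB'
  have hFD (i) : T' • Entire.D (F i) ∈ Entire.homSpan K F 1 := by
    have : T' • Entire.D (F i) = ∑ j, B' i j • F j := Entire.ext fun z => by
      rw [Entire.sum_smul_apply, Entire.smul_poly_apply, Entire.D_apply,
        ← eval_map_algebraMap, hT']
      simp_rw [← eval_map_algebraMap, hB']
      exact hsys i z
    rw [this]
    exact Submodule.sum_mem _ fun j _ =>
      Submodule.smul_mem _ _ (Entire.apply_mem_homSpan K F j)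
  let a : K := ⟨α, hαK⟩
  have haα : algebraMap K ℂ a = α := rfl
  have ha0 : a ≠ 0 := fun h => left_ne_zero_of_mul hreg (by rw [← haα, h, map_zero])
  have hTa : T'.eval a ≠ 0 := fun h => right_ne_zero_of_mul hreg (by
    rw [← haα, ← hT', eval_map_algebraMap, aeval_algebraMap_apply_eq_algebraMap_eval, h, map_zero])
  have hsupp : P.support ⊆ Entire.expSet n d := fun m hm => by
    rw [Entire.mem_expSet]
    have := hPhom (MvPolynomial.mem_support_iff.1 hm)
    rw [← this, Finsupp.weight_apply]
    simp [Finsupp.sum_fintype]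
  have hsum (z : ℂ) (u : (Fin n →₀ ℕ) → K[X]) :
      (∑ m ∈ Entire.expSet n d, u m • Entire.mono F m) z =
        ∑ m ∈ Entire.expSet n d, aeval z (u m) * ∏ i, f i z ^ m i := by
    rw [AddSubmonoidClass.coe_finsetSum, Finset.sum_apply]
    refine Finset.sum_congr rfl fun m _ => ?_
    rw [Entire.smul_poly_apply, Entire.mono, ← Entire.eval_apply, map_prod]
    rfl
  set x := ∑ m ∈ Entire.expSet n d, (C ⟨P.coeff m, hPK m⟩ : K[X]) • Entire.mono F m with hx
  have hxα : x (algebraMap K ℂ a) = 0 := by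
    rw [hx, hsum, haα, ← hPvan, MvPolynomial.eval_eq']
    refine (Finset.sum_subset_zero_on_sdiff hsupp (fun m hm => ?_) fun m _ => ?_).symm
    · rw [aeval_C]
      exact mul_eq_zero_of_left
        (MvPolynomial.notMem_support_iff.1 (Finset.mem_sdiff.1 hm).2) _
    · rw [aeval_C]
      rfl
  obtain ⟨x', hx', hxx'⟩ := Entire.exists_mem_homSpan_of_apply_eq_zero hFE hFD ha0 hTa
    (Entire.sum_mem_homSpan K F _) hxα
  obtain ⟨q, rfl⟩ := Entire.exists_sum_of_mem_homSpan K F hx'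
  let u (m : Fin n →₀ ℕ) : K[X] := C ⟨P.coeff m, hPK m⟩ - (X - C a) * q m
  refine ⟨∑ m ∈ Entire.expSet n d, MvPolynomial.monomial m ((u m).map (algebraMap K ℂ)),
    fun m k => ?_, MvPolynomial.IsHomogeneous.sum _ _ _ fun m hm =>
      MvPolynomial.isHomogeneous_monomial _
        (by rw [Finsupp.degree_eq_sum, Entire.mem_expSet.1 hm]), ?_, fun z => ?_⟩
  · rw [MvPolynomial.coeff_sum]
    simp_rw [MvPolynomial.coeff_monomial]
    rw [Finset.sum_ite_eq']
    split_ifs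
    · rw [coeff_map]
      exact (Algebra.IsAlgebraic.isAlgebraic (R := ℚ) _).algebraMap
    · simpa using isAlgebraic_zero
  · refine MvPolynomial.ext _ _ fun m => ?_
    rw [MvPolynomial.coeff_map, MvPolynomial.coeff_sum]
    simp_rw [MvPolynomial.coeff_monomial]
    rw [Finset.sum_ite_eq']
    split_ifs with hm
    · rw [coe_evalRingHom, eval_map_algebraMap, ← haα, aeval_algebraMap_apply_eq_algebraMap_eval]
      simp only [u, eval_sub, eval_mul, eval_C, eval_X, sub_self, zero_mul, sub_zero]
      rfl
    · rw [map_zero]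
      exact (MvPolynomial.notMem_support_iff.1 fun h => hm (hsupp h)).symm
  · have h1 : ∑ m ∈ Entire.expSet n d, u m • Entire.mono F m = 0 := by
      refine (Finset.sum_congr rfl fun m _ => sub_smul _ _ _).trans
        ((Finset.sum_sub_distrib _ _).trans (sub_eq_zero.2 (hxx'.trans ?_)))
      rw [Finset.smul_sum]
      exact Finset.sum_congr rfl fun m _ => smul_smul _ _ _
    rw [map_sum, map_sum, ← Entire.zero_apply z, ← h1, hsum]
    refine Finset.sum_congr rfl fun m _ => ?_
    rw [MvPolynomial.map_monomial, MvPolynomial.eval_monomial, coe_evalRingHom,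
      eval_map_algebraMap, Finsupp.prod_fintype _ _ fun _ => pow_zero _]
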